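/- Let 0 < ε < 1 and C > 0 be constants. There exist constants r₀ and c (depending only on C and ε) such that the following holds for all sufficiently large n. Let A = (a_{ij}) be an n×n symmetric real matrix with ρ_q(A) ≥ n^{−C}. Then there exist disjoint index sets I₀, I ⊆ {1,…,n} with |I₀| ≤ r₀ and |I| ≥ n − c·n^ε, a nonzero integer k with |k| ≤ n^c, integers k_{i i₀} (i ∈ I, i₀ ∈ I₀) of absolute value at most n^c, real numbers a'_{ij} (i, j ∈ I), an integer s ≤ r₀ and real numbers g₁,…,g_s (independent of i), such that for every i ∈ I: (i) a_{ij} = a'_{ij}/k² − Σ_{i₀∈I₀} k_{i i₀} a_{i₀ j}/k − Σ_{i₀∈I₀} k_{j i₀} a_{i₀ i}/k for all j ∈ I; and (ii) all but at most c·n^ε of the numbers a'_{ij}, j ∈ I, can be written as Σ_{h=1}^s (p_h/q_h)·g_h with integers p_h, q_h satisfying q_h ≠ 0 and |p_h|, |q_h| ≤ n^c. -/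

import Mathlib

open scoped Classical BigOperators

noncomputable section

/-- The real number (±1) corresponding to a Boolean sign bit. -/
def signv (b : Bool) : ℝ := if b then 1 else -1

/-- The quadratic concentration probability `ρ_q(A) = sup_a P(Σ a_{ij} x_i x_j = a)`, where
`x` is a vector of iid Rademacher random variables. -/
def rhoQ (n : ℕ) (A : Matrix (Fin n) (Fin n) ℝ) : ℝ :=
  ⨆ a : ℝ, ((Finset.univ.filter fun x : Fin n → Bool =>
      ∑ i, ∑ j, A i j * signv (x i) * signv (x j) = a).card : ℝ) / 2 ^ n

set_option linter.unusedSectionVars false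

/-! Uniform averages on finite types -/

/-- The average of a function on a finite type. -/
def avg {Ω : Type*} [Fintype Ω] (f : Ω → ℝ) : ℝ := (∑ x, f x) / Fintype.card Ω

/-- The real indicator of a proposition. -/
def ind (p : Prop) : ℝ := if p then 1 else 0

/-- Uniform probability on a finite type. -/
def pr {Ω : Type*} [Fintype Ω] (p : Ω → Prop) : ℝ := avg fun x => ind (p x)

lemma ind_true {p : Prop} (h : p) : ind p = 1 := if_pos h

lemma ind_false {p : Prop} (h : ¬ p) : ind p = 0 := if_neg h

lemma ind_nonneg (p : Prop) : 0 ≤ ind p := by unfold ind; split_ifs <;> norm_num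

lemma ind_le_one (p : Prop) : ind p ≤ 1 := by unfold ind; split_ifs <;> norm_num

lemma ind_mono {p q : Prop} (h : p → q) : ind p ≤ ind q := by
  by_cases hp : p
  · rw [ind_true hp, ind_true (h hp)]
  · rw [ind_false hp]; exact ind_nonneg q

section Average
variable {Ω Ω' : Type*} [Fintype Ω] [Fintype Ω']

lemma avg_mono {f g : Ω → ℝ} (h : ∀ x, f x ≤ g x) : avg f ≤ avg g := by
  unfold avg
  gcongr with x
  exact h x

lemma avg_nonneg {f : Ω → ℝ} (h : ∀ x, 0 ≤ f x) : 0 ≤ avg f :=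
  div_nonneg (Finset.sum_nonneg fun x _ => h x) (Nat.cast_nonneg _)

lemma avg_add (f g : Ω → ℝ) : avg (fun x => f x + g x) = avg f + avg g := by
  unfold avg; rw [Finset.sum_add_distrib, add_div]

lemma avg_mul_left (c : ℝ) (f : Ω → ℝ) : avg (fun x => c * f x) = c * avg f := by
  unfold avg; rw [← Finset.mul_sum, mul_div_assoc]

lemma avg_sum {β : Type*} (s : Finset β) (f : β → Ω → ℝ) :
    avg (fun x => ∑ b ∈ s, f b x) = ∑ b ∈ s, avg (f b) := by
  unfold avg; rw [Finset.sum_comm, Finset.sum_div]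

lemma avg_const [Nonempty Ω] (c : ℝ) : avg (fun _ : Ω => c) = c := by
  unfold avg
  have : (Fintype.card Ω : ℝ) ≠ 0 := by exact_mod_cast Fintype.card_ne_zero
  simp [this]

lemma avg_prod (f : Ω × Ω' → ℝ) : avg f = avg fun x => avg fun y => f (x, y) := by
  unfold avg
  rw [Fintype.sum_prod_type, Fintype.card_prod, ← Finset.sum_div, div_div, Nat.cast_mul,
    mul_comm (Fintype.card Ω' : ℝ)]

lemma avg_equiv (e : Ω ≃ Ω') (f : Ω' → ℝ) : avg (fun x => f (e x)) = avg f := by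
  unfold avg
  rw [Fintype.card_congr e, e.sum_comp]

lemma exists_avg_le [Nonempty Ω] (f : Ω → ℝ) : ∃ x, avg f ≤ f x := by
  by_contra! h
  have h1 : ∑ x, f x < ∑ _x : Ω, avg f :=
    Finset.sum_lt_sum_of_nonempty Finset.univ_nonempty fun x _ => h x
  have h2 : (0 : ℝ) < Fintype.card Ω := by exact_mod_cast Fintype.card_pos
  have h3 : ∑ x, f x = avg f * Fintype.card Ω := by unfold avg; field_simp
  rw [h3] at h1
  simp at h1
  linarith [mul_comm (avg f) (Fintype.card Ω : ℝ)]

lemma pr_nonneg (p : Ω → Prop) : 0 ≤ pr p := avg_nonneg fun _ => ind_nonneg _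

lemma pr_le_one (p : Ω → Prop) : pr p ≤ 1 := by
  unfold pr avg
  apply div_le_one_of_le₀ _ (Nat.cast_nonneg _)
  calc ∑ x, ind (p x) ≤ ∑ _x : Ω, (1 : ℝ) := Finset.sum_le_sum fun _ _ => ind_le_one _
    _ = _ := by simp

lemma pr_mono {p q : Ω → Prop} (h : ∀ x, p x → q x) : pr p ≤ pr q :=
  avg_mono fun x => ind_mono (h x)

lemma pr_equiv (e : Ω ≃ Ω') (p : Ω' → Prop) : pr (fun x => p (e x)) = pr p :=
  avg_equiv e fun y => ind (p y)

lemma pr_prod (p : Ω × Ω' → Prop) : pr p = avg fun x => pr fun y => p (x, y) := avg_prod _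

lemma pr_prod_swap (p : Ω × Ω' → Prop) : pr p = avg fun y => pr fun x => p (x, y) := by
  rw [← pr_equiv (Equiv.prodComm Ω' Ω), pr_prod]; rfl

lemma exists_of_pr_pos {p : Ω → Prop} (h : 0 < pr p) : ∃ x, p x := by
  by_contra! hp
  have : pr p ≤ pr (fun _ : Ω => False) := pr_mono fun x hx => hp x hx
  have h2 : pr (fun _ : Ω => False) = 0 := by simp [pr, avg, ind]
  linarith

lemma pr_le_sum {β : Type*} {p : Ω → Prop} (S : Finset β) (q : β → Ω → Prop)
    (h : ∀ x, p x → ∃ s ∈ S, q s x) : pr p ≤ ∑ s ∈ S, pr (q s) := by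
  unfold pr
  rw [← avg_sum]
  apply avg_mono
  intro x
  by_cases hp : p x
  · obtain ⟨s, hs, hq⟩ := h x hp
    rw [ind_true hp, ← ind_true hq]
    exact Finset.single_le_sum (f := fun s => ind (q s x)) (fun i _ => ind_nonneg _) hs
  · rw [ind_false hp]
    exact Finset.sum_nonneg fun i _ => ind_nonneg _

lemma pr_pigeonhole {β : Type*} {p : Ω → Prop} (hp : 0 < pr p) (S : Finset β)
    (q : β → Ω → Prop) (h : ∀ x, p x → ∃ s ∈ S, q s x) :
    ∃ s ∈ S, pr p ≤ S.card * pr (q s) := by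
  have h1 := pr_le_sum S q h
  obtain ⟨x, hx⟩ := exists_of_pr_pos hp
  obtain ⟨s0, hs0, -⟩ := h x hx
  by_contra! h2
  have h3 : ∑ s ∈ S, pr (q s) * S.card < ∑ _s ∈ S, pr p :=
    Finset.sum_lt_sum_of_nonempty ⟨s0, hs0⟩ fun s hs => by
      rw [mul_comm]; exact h2 s hs
  rw [← Finset.sum_mul, Finset.sum_const, nsmul_eq_mul, mul_comm] at h3
  have h4 : (0 : ℝ) < S.card := by exact_mod_cast Finset.card_pos.mpr ⟨s0, hs0⟩
  have := lt_of_mul_lt_mul_left h3 h4.le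
  linarith

/-- If the average of `f ≤ 1` is at least `2 * a`, then `f ≥ a` with probability at least `a`. -/
lemma half_le_pr {f : Ω → ℝ} {a : ℝ} (hf : ∀ x, f x ≤ 1) (ha : 0 ≤ a) (h : 2 * a ≤ avg f) :
    a ≤ pr fun x => a ≤ f x := by
  rcases isEmpty_or_nonempty Ω with hE | hN
  · have : avg f = 0 := by simp [avg]
    have : a = 0 := by linarith
    rw [this]; exact pr_nonneg _
  · have h1 : avg f ≤ avg fun x => a + ind (a ≤ f x) := by
      apply avg_mono
      intro x
      by_cases hx : a ≤ f x
      · rw [ind_true hx]; linarith [hf x]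
      · rw [ind_false hx]; linarith
    rw [avg_add, avg_const] at h1
    unfold pr
    linarith

end Average

/-- A bipartite Cauchy-Schwarz inequality for sums over a relation. -/
lemma sum_rel_sq_le {α β : Type*} (s : Finset α) (u : Finset β) (f : α → ℝ) (g : β → ℝ)
    (hf : ∀ x, 0 ≤ f x) (hg : ∀ y, 0 ≤ g y) (T : α → β → Prop) (R : α → α → Prop)
    (R' : β → β → Prop) (hR : ∀ x x' y, T x y → T x' y → R x x')
    (hR' : ∀ x y y', T x y → T x y' → R' y y') :
    (∑ x ∈ s, ∑ y ∈ u, f x * g y * ind (T x y)) ^ 2 ≤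
      (∑ x ∈ s, ∑ x' ∈ s, f x * f x' * ind (R x x')) *
      (∑ y ∈ u, ∑ y' ∈ u, g y * g y' * ind (R' y y')) := by
  set N : α → ℝ := fun x => ∑ y ∈ u, g y * ind (T x y) with hN
  set N' : β → ℝ := fun y => ∑ x ∈ s, f x * ind (T x y) with hN'
  have hN0 : ∀ x, 0 ≤ N x := fun x =>
    Finset.sum_nonneg fun y _ => mul_nonneg (hg y) (ind_nonneg _)
  have hN'0 : ∀ y, 0 ≤ N' y := fun y =>
    Finset.sum_nonneg fun x _ => mul_nonneg (hf x) (ind_nonneg _)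
  have e : ∑ x ∈ s, ∑ y ∈ u, f x * g y * ind (T x y) =
      ∑ z ∈ s ×ˢ u, f z.1 * g z.2 * ind (T z.1 z.2) := by rw [Finset.sum_product]
  have key := Finset.sum_sq_le_sum_mul_sum_of_sq_le_mul (s ×ˢ u)
    (r := fun z => f z.1 * g z.2 * ind (T z.1 z.2))
    (f := fun z => f z.1 * g z.2 * ind (T z.1 z.2) * (N' z.2 / N z.1))
    (g := fun z => f z.1 * g z.2 * ind (T z.1 z.2) * (N z.1 / N' z.2))
    (fun z _ => mul_nonneg (mul_nonneg (mul_nonneg (hf _) (hg _)) (ind_nonneg _))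
      (div_nonneg (hN'0 _) (hN0 _)))
    (fun z _ => mul_nonneg (mul_nonneg (mul_nonneg (hf _) (hg _)) (ind_nonneg _))
      (div_nonneg (hN0 _) (hN'0 _)))
    (by
      rintro ⟨x, y⟩ hz
      apply le_of_eq
      obtain ⟨hx, hy⟩ := Finset.mem_product.mp hz
      simp only at hx hy ⊢
      by_cases hT : T x y
      · rw [ind_true hT]
        have h1 : g y ≤ N x := by
          have := Finset.single_le_sum (f := fun y => g y * ind (T x y))
            (fun i _ => mul_nonneg (hg i) (ind_nonneg _)) hy
          simpa [ind_true hT] using this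
        have h2 : f x ≤ N' y := by
          have := Finset.single_le_sum (f := fun x => f x * ind (T x y))
            (fun i _ => mul_nonneg (hf i) (ind_nonneg _)) hx
          simpa [ind_true hT] using this
        rcases (hf x).eq_or_lt with h | h
        · rw [← h]; simp
        rcases (hg y).eq_or_lt with h' | h'
        · rw [← h']; simp
        have h3 : 0 < N x := by linarith
        have h4 : 0 < N' y := by linarith
        field_simp
      · rw [ind_false hT]; simp)
  rw [e]
  refine key.trans ?_
  have hA : ∑ z ∈ s ×ˢ u, f z.1 * g z.2 * ind (T z.1 z.2) * (N' z.2 / N z.1) ≤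
      ∑ x ∈ s, ∑ x' ∈ s, f x * f x' * ind (R x x') := by
    rw [Finset.sum_product]
    apply Finset.sum_le_sum
    intro x _
    set F := ∑ x' ∈ s, f x' * ind (R x x') with hF
    have hF0 : 0 ≤ F := Finset.sum_nonneg fun x' _ => mul_nonneg (hf _) (ind_nonneg _)
    have h1 : ∀ y ∈ u, f x * g y * ind (T x y) * (N' y / N x) ≤
        f x / N x * F * (g y * ind (T x y)) := by
      intro y _
      by_cases hT : T x y
      · have : N' y ≤ F := by
          apply Finset.sum_le_sum
          intro x' _
          exact mul_le_mul_of_nonneg_left (ind_mono fun h => hR x x' y hT h) (hf _)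
        have h0 : 0 ≤ f x / N x := div_nonneg (hf _) (hN0 _)
        have h3 : 0 ≤ g y * ind (T x y) := mul_nonneg (hg _) (ind_nonneg _)
        calc f x * g y * ind (T x y) * (N' y / N x) = f x / N x * N' y * (g y * ind (T x y)) := by
              ring
          _ ≤ _ := by gcongr
      · rw [ind_false hT]; simp
    refine (Finset.sum_le_sum h1).trans ?_
    rw [← Finset.mul_sum]
    change f x / N x * F * N x ≤ _
    have : ∑ x' ∈ s, f x * f x' * ind (R x x') = f x * F := by
      rw [hF, Finset.mul_sum]; exact Finset.sum_congr rfl fun _ _ => by ring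
    rw [this]
    rcases (hN0 x).eq_or_lt with h | h
    · rw [← h]; simp; exact mul_nonneg (hf _) hF0
    · apply le_of_eq; field_simp
  have hB : ∑ z ∈ s ×ˢ u, f z.1 * g z.2 * ind (T z.1 z.2) * (N z.1 / N' z.2) ≤
      ∑ y ∈ u, ∑ y' ∈ u, g y * g y' * ind (R' y y') := by
    rw [Finset.sum_product_right]
    apply Finset.sum_le_sum
    intro y _
    set F := ∑ y' ∈ u, g y' * ind (R' y y') with hF
    have hF0 : 0 ≤ F := Finset.sum_nonneg fun x' _ => mul_nonneg (hg _) (ind_nonneg _)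
    have h1 : ∀ x ∈ s, f x * g y * ind (T x y) * (N x / N' y) ≤
        g y / N' y * F * (f x * ind (T x y)) := by
      intro x _
      by_cases hT : T x y
      · have : N x ≤ F := by
          apply Finset.sum_le_sum
          intro y' _
          exact mul_le_mul_of_nonneg_left (ind_mono fun h => hR' x y y' hT h) (hg _)
        have h0 : 0 ≤ g y / N' y := div_nonneg (hg _) (hN'0 _)
        have h3 : 0 ≤ f x * ind (T x y) := mul_nonneg (hf _) (ind_nonneg _)
        calc f x * g y * ind (T x y) * (N x / N' y) = g y / N' y * N x * (f x * ind (T x y)) := by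
              ring
          _ ≤ _ := by gcongr
      · rw [ind_false hT]; simp
    refine (Finset.sum_le_sum h1).trans ?_
    rw [← Finset.mul_sum]
    change g y / N' y * F * N' y ≤ _
    have : ∑ y' ∈ u, g y * g y' * ind (R' y y') = g y * F := by
      rw [hF, Finset.mul_sum]; exact Finset.sum_congr rfl fun _ _ => by ring
    rw [this]
    rcases (hN'0 y).eq_or_lt with h | h
    · rw [← h]; simp; exact mul_nonneg (hg _) hF0
    · apply le_of_eq; field_simp
  refine mul_le_mul hA hB ?_ ?_
  · exact Finset.sum_nonneg fun z _ => mul_nonneg (mul_nonneg (mul_nonneg (hf _) (hg _))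
      (ind_nonneg _)) (div_nonneg (hN0 _) (hN'0 _))
  · exact Finset.sum_nonneg fun x _ => Finset.sum_nonneg fun x' _ =>
      mul_nonneg (mul_nonneg (hf _) (hf _)) (ind_nonneg _)

section GroupAlgebra
variable {X : Type*} [AddCommGroup X]

/-- The total weight that an element of the group algebra gives to a set. -/
def mass (K : Set X) : AddMonoidAlgebra ℝ X →ₗ[ℝ] ℝ where
  toFun f := f.coeff.sum fun x c => c * ind (x ∈ K)
  map_add' f g := by
    rw [AddMonoidAlgebra.coeff_add]
    exact Finsupp.sum_add_index' (by simp) (by intros; ring)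
  map_smul' a f := by
    rw [AddMonoidAlgebra.coeff_smul, Finsupp.sum_smul_index' (by simp), Finsupp.sum, Finsupp.sum]
    simp [Finset.mul_sum, mul_assoc]

lemma mass_apply (K : Set X) (f : AddMonoidAlgebra ℝ X) :
    mass K f = ∑ x ∈ f.coeff.support, f.coeff x * ind (x ∈ K) := rfl

lemma mass_single (K : Set X) (x : X) (c : ℝ) :
    mass K (AddMonoidAlgebra.single x c) = c * ind (x ∈ K) := by
  change (AddMonoidAlgebra.single x c).coeff.sum (fun x c => c * ind (x ∈ K)) = _
  rw [AddMonoidAlgebra.coeff_single, Finsupp.sum_single_index (by simp)]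

lemma eq_sum_single (f : AddMonoidAlgebra ℝ X) :
    f = ∑ x ∈ f.coeff.support, AddMonoidAlgebra.single x (f.coeff x) :=
  (AddMonoidAlgebra.sum_coeff_single f).symm

lemma mass_mul (K : Set X) (f g : AddMonoidAlgebra ℝ X) :
    mass K (f * g) = ∑ x ∈ f.coeff.support, ∑ y ∈ g.coeff.support,
      f.coeff x * g.coeff y * ind (x + y ∈ K) := by
  conv_lhs => rw [eq_sum_single f, eq_sum_single g]
  rw [Finset.sum_mul_sum, map_sum]
  refine Finset.sum_congr rfl fun x _ => ?_
  rw [map_sum]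
  refine Finset.sum_congr rfl fun y _ => ?_
  rw [AddMonoidAlgebra.single_mul_single, mass_single]

lemma mass_single_mul (K : Set X) (x : X) (c : ℝ) (g : AddMonoidAlgebra ℝ X) :
    mass K (AddMonoidAlgebra.single x c * g) = c * mass {y | x + y ∈ K} g := by
  conv_lhs => rw [eq_sum_single g]
  rw [Finset.mul_sum, map_sum, mass_apply, Finset.mul_sum]
  refine Finset.sum_congr rfl fun y _ => ?_
  rw [AddMonoidAlgebra.single_mul_single, mass_single, mul_assoc]
  rfl

/-- Nonnegative symmetric elements of the real group algebra. -/
def SymNonneg (f : AddMonoidAlgebra ℝ X) : Prop :=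
  (∀ x, 0 ≤ f.coeff x) ∧ ∀ x, f.coeff (-x) = f.coeff x

lemma mass_nonneg {f : AddMonoidAlgebra ℝ X} (hf : ∀ x, 0 ≤ f.coeff x) (K : Set X) :
    0 ≤ mass K f :=
  Finset.sum_nonneg fun x _ => mul_nonneg (hf x) (ind_nonneg _)

lemma coeff_eq_mass (f : AddMonoidAlgebra ℝ X) (z : X) : f.coeff z = mass {z} f := by
  rw [mass_apply]
  by_cases hz : z ∈ f.coeff.support
  · rw [Finset.sum_eq_single_of_mem z hz]
    · rw [ind_true (Set.mem_singleton z), mul_one]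
    · intro y _ hy
      rw [ind_false (by simpa using hy), mul_zero]
  · rw [Finset.sum_eq_zero]
    · simpa using hz
    · intro y hy
      rw [ind_false, mul_zero]
      rintro rfl
      exact hz hy

lemma sum_neg_support {f : AddMonoidAlgebra ℝ X} (hf : ∀ x, f.coeff (-x) = f.coeff x)
    (F : X → ℝ) : ∑ x ∈ f.coeff.support, F (-x) = ∑ x ∈ f.coeff.support, F x := by
  apply Finset.sum_nbij' (fun x => -x) (fun x => -x)
  · intro x hx; simpa [hf] using hx
  · intro x hx; simpa [hf] using hx
  · intro x _; simp
  · intro x _; simp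
  · intro x _; rfl

lemma SymNonneg.mul {f g : AddMonoidAlgebra ℝ X} (hf : SymNonneg f) (hg : SymNonneg g) :
    SymNonneg (f * g) := by
  constructor
  · intro x
    rw [coeff_eq_mass, mass_mul]
    exact Finset.sum_nonneg fun x _ => Finset.sum_nonneg fun y _ =>
      mul_nonneg (mul_nonneg (hf.1 x) (hg.1 y)) (ind_nonneg _)
  · intro z
    rw [coeff_eq_mass, coeff_eq_mass, mass_mul, mass_mul, ← sum_neg_support hf.2]
    refine Finset.sum_congr rfl fun x _ => ?_
    rw [← sum_neg_support hg.2]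
    refine Finset.sum_congr rfl fun y _ => ?_
    rw [hf.2, hg.2]
    congr 2
    simp only [Set.mem_singleton_iff, eq_iff_iff]
    rw [← neg_add, neg_inj]

lemma symNonneg_one : SymNonneg (1 : AddMonoidAlgebra ℝ X) := by
  constructor <;> intro x <;>
    simp only [AddMonoidAlgebra.one_def, AddMonoidAlgebra.coeff_single, Finsupp.single_apply]
  · split_ifs <;> norm_num
  · simp [eq_comm]

lemma SymNonneg.prod {β : Type*} (s : Finset β) {f : β → AddMonoidAlgebra ℝ X}
    (h : ∀ b ∈ s, SymNonneg (f b)) : SymNonneg (∏ b ∈ s, f b) :=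
  Finset.prod_induction _ _ (fun _ _ => SymNonneg.mul) symNonneg_one h

lemma SymNonneg.pow {f : AddMonoidAlgebra ℝ X} (h : SymNonneg f) (m : ℕ) : SymNonneg (f ^ m) := by
  induction m with
  | zero => simpa using symNonneg_one
  | succ k ih => rw [pow_succ]; exact ih.mul h

lemma mass_mul_sq_le {f g : AddMonoidAlgebra ℝ X} (hf : SymNonneg f) (hg : SymNonneg g)
    {K K' : Set X} (hK : ∀ x y, x ∈ K → y ∈ K → x - y ∈ K') :
    mass K (f * g) ^ 2 ≤ mass K' (f ^ 2) * mass K' (g ^ 2) := by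
  have h := sum_rel_sq_le f.coeff.support g.coeff.support f.coeff g.coeff hf.1 hg.1
    (fun x y => x + y ∈ K) (fun x x' => x + -x' ∈ K') (fun y y' => y + -y' ∈ K')
    (fun x x' y h h' => by have := hK _ _ h h'; simpa [sub_eq_add_neg] using this)
    (fun x y y' h h' => by
      have := hK _ _ h h'
      rwa [add_sub_add_left_eq_sub, sub_eq_add_neg] at this)
  rw [mass_mul, pow_two f, pow_two g, mass_mul, mass_mul]
  refine h.trans (le_of_eq ?_)
  congr 1
  · refine Finset.sum_congr rfl fun x _ => ?_
    rw [← sum_neg_support hf.2]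
    exact Finset.sum_congr rfl fun x' _ => by rw [neg_neg, hf.2]
  · refine Finset.sum_congr rfl fun x _ => ?_
    rw [← sum_neg_support hg.2]
    exact Finset.sum_congr rfl fun x' _ => by rw [neg_neg, hg.2]

lemma exists_mass_prod_le {β : Type*} (t : ℕ) : ∀ (K : ℕ → Set X)
    (_ : ∀ j x y, x ∈ K j → y ∈ K j → x - y ∈ K (j + 1)) (s : Finset β)
    (f : β → AddMonoidAlgebra ℝ X) (_ : ∀ b ∈ s, SymNonneg (f b)) (_ : s.card = 2 ^ t),
    ∃ b ∈ s, mass (K 0) (∏ b ∈ s, f b) ≤ mass (K t) (f b ^ 2 ^ t) := by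
  induction t with
  | zero =>
    intro K _ s f _ hs
    obtain ⟨b, rfl⟩ := Finset.card_eq_one.mp (by simpa using hs)
    exact ⟨b, by simp, by simp⟩
  | succ t ih =>
    intro K hK s f hf hs
    obtain ⟨s₁, hs₁, hc₁⟩ := Finset.exists_subset_card_eq (s := s) (n := 2 ^ t)
      (by rw [hs, pow_succ]; omega)
    have hc₂ : (s \ s₁).card = 2 ^ t := by
      rw [Finset.card_sdiff_of_subset hs₁, hc₁, hs, pow_succ]; omega
    have key : ∀ s' ⊆ s, s'.card = 2 ^ t → ∃ b ∈ s,
        mass (K 1) ((∏ b ∈ s', f b) ^ 2) ≤ mass (K (t + 1)) (f b ^ 2 ^ (t + 1)) := by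
      intro s' hs' hc'
      obtain ⟨b, hb, hle⟩ := ih (fun j => K (j + 1)) (fun j => hK (j + 1)) s' (fun b => f b ^ 2)
        (fun b hb => (hf b (hs' hb)).pow 2) hc'
      refine ⟨b, hs' hb, ?_⟩
      rw [← Finset.prod_pow]
      refine hle.trans (le_of_eq ?_)
      rw [← pow_mul, pow_succ' 2 t]
    obtain ⟨b₁, hb₁, h₁⟩ := key s₁ hs₁ hc₁
    obtain ⟨b₂, hb₂, h₂⟩ := key (s \ s₁) Finset.sdiff_subset hc₂
    have hg₁ : SymNonneg (∏ b ∈ s₁, f b) := SymNonneg.prod _ fun b hb => hf b (hs₁ hb)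
    have hg₂ : SymNonneg (∏ b ∈ s \ s₁, f b) :=
      SymNonneg.prod _ fun b hb => hf b (Finset.sdiff_subset hb)
    have h := mass_mul_sq_le hg₁ hg₂ (hK 0)
    rw [mul_comm (∏ b ∈ s₁, f b), Finset.prod_sdiff hs₁] at h
    have hn := mass_nonneg (SymNonneg.prod s hf).1 (K 0)
    have hn₁ := mass_nonneg (hg₁.pow 2).1 (K (0 + 1))
    have hn₂ := mass_nonneg (hg₂.pow 2).1 (K (0 + 1))
    simp only [zero_add] at h hn₁ hn₂
    rcases le_total (mass (K 1) ((∏ b ∈ s₁, f b) ^ 2)) (mass (K 1) ((∏ b ∈ s \ s₁, f b) ^ 2))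
      with hle | hle
    · exact ⟨b₂, hb₂, (abs_le_of_sq_le_sq' (by nlinarith) hn₂).2.trans h₂⟩
    · exact ⟨b₁, hb₁, (abs_le_of_sq_le_sq' (by nlinarith) hn₁).2.trans h₁⟩

/-- The law of a fair random sign times `v`. -/
def step (v : X) : AddMonoidAlgebra ℝ X :=
  AddMonoidAlgebra.single v (1 / 2) + AddMonoidAlgebra.single (-v) (1 / 2)

lemma symNonneg_step (v : X) : SymNonneg (step v) := by
  constructor <;> intro x <;>
    simp only [step, AddMonoidAlgebra.coeff_add, AddMonoidAlgebra.coeff_single,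
      Finsupp.add_apply, Finsupp.single_apply]
  · split_ifs <;> norm_num
  · rw [add_comm, neg_inj]
    congr 2
    simp only [eq_iff_iff]
    rw [eq_comm, neg_eq_iff_eq_neg, eq_comm]

lemma mass_univ_step_mul (K : Set X) (v : X) (g : AddMonoidAlgebra ℝ X) :
    mass K (step v * g) = (mass {y | v + y ∈ K} g + mass {y | -v + y ∈ K} g) / 2 := by
  rw [step, add_mul, map_add, mass_single_mul, mass_single_mul]; ring

/-- The integer sign of a Boolean. -/
def sgz (b : Bool) : ℤ := if b then 1 else -1

lemma pr_signs_eq_mass {ι : Type*} [Fintype ι] [DecidableEq ι] (K : Set X) (v : ι → X) :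
    pr (fun η : ι → Bool => ∑ i, sgz (η i) • v i ∈ K) = mass K (∏ i, step (v i)) := by
  have h : ∀ i, step (v i) = ∑ b ∈ (Finset.univ : Finset Bool),
      AddMonoidAlgebra.single (sgz b • v i) (1 / 2 : ℝ) := by
    intro i; simp [step, sgz]
  simp_rw [h]
  rw [Finset.prod_univ_sum, map_sum]
  simp_rw [AddMonoidAlgebra.prod_single, mass_single]
  unfold pr avg
  rw [Fintype.piFinset_univ, Finset.sum_div]
  refine Finset.sum_congr rfl fun η _ => ?_
  simp [div_eq_mul_inv, mul_comm]

lemma exists_translate_mass_le {ι : Type*} (s : Finset ι) (v : ι → X) :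
    ∀ (K : Set X) (f : AddMonoidAlgebra ℝ X), ∃ a : X,
      mass K ((∏ i ∈ s, step (v i)) * f) ≤ mass {y | a + y ∈ K} f := by
  induction s using Finset.induction_on with
  | empty => intro K f; exact ⟨0, by simp⟩
  | insert i s hi ih =>
    intro K f
    rw [Finset.prod_insert hi, mul_assoc, mass_univ_step_mul]
    obtain ⟨a, ha⟩ := ih {y | v i + y ∈ K} f
    obtain ⟨b, hb⟩ := ih {y | -v i + y ∈ K} f
    simp only [Set.mem_ofPred_eq, ← add_assoc] at ha hb
    rcases le_total (mass {y | v i + a + y ∈ K} f) (mass {y | -v i + b + y ∈ K} f) with h | h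
    · exact ⟨-v i + b, by linarith⟩
    · exact ⟨v i + a, by linarith⟩

lemma exists_disjoint_or_cover {ι : Type*} [DecidableEq ι] (bad : Finset ι → Prop) (T : ℕ)
    (hT : ∀ B, bad B → B.card ≤ T) (h0 : ¬ bad ∅) (N : ℕ) :
    (∃ s : Finset (Finset ι), s.card = N ∧ (∀ B ∈ s, bad B) ∧
      (s : Set (Finset ι)).PairwiseDisjoint id) ∨
    ∃ E : Finset ι, E.card ≤ N * T ∧ ∀ B, bad B → ¬ Disjoint B E := by
  induction N with
  | zero => exact Or.inl ⟨∅, by simp, by simp, by simp⟩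
  | succ N ih =>
    rcases ih with ⟨s, hs, hb, hd⟩ | ⟨E, hE, h⟩
    · by_cases hex : ∃ B, bad B ∧ Disjoint B (s.biUnion id)
      · obtain ⟨B, hB, hBd⟩ := hex
        left
        have hBs : B ∉ s := by
          intro hmem
          have h1 : B ⊆ s.biUnion id := Finset.subset_biUnion_of_mem id hmem
          have h2 : Disjoint B B := hBd.mono_right h1
          rw [disjoint_self] at h2
          rw [h2] at hB
          exact h0 hB
        refine ⟨insert B s, by rw [Finset.card_insert_of_notMem hBs, hs], ?_, ?_⟩
        · intro B' hB'
          rcases Finset.mem_insert.mp hB' with rfl | h'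
          · exact hB
          · exact hb _ h'
        · rw [Finset.coe_insert]
          apply hd.insert
          intro B' hB' _
          exact hBd.mono_right (Finset.subset_biUnion_of_mem id hB')
      · right
        refine ⟨s.biUnion id, ?_, fun B hB hdis => hex ⟨B, hB, hdis⟩⟩
        calc (s.biUnion id).card ≤ s.card * T :=
              Finset.card_biUnion_le_card_mul _ _ _ fun B hB => hT B (hb B hB)
          _ ≤ (N + 1) * T := by rw [hs]; gcongr; omega
    · exact Or.inr ⟨E, hE.trans (by gcongr; omega), h⟩

/-- If a random signed sum is concentrated, then away from few indices the `2^t`-fold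
convolution powers of all small blocks of steps are concentrated as well. -/
lemma exists_exceptional_blocks {ι : Type*} [Fintype ι] [DecidableEq ι] (v : ι → X)
    (K : ℕ → Set X) (hK : ∀ j x y, x ∈ K j → y ∈ K j → x - y ∈ K (j + 1)) (t : ℕ) (ht : 1 ≤ t)
    (ρ : ℝ) (hρ : ρ ≤ pr fun η : ι → Bool => ∑ i, sgz (η i) • v i ∈ K 0) (hρ0 : 0 < ρ) (T : ℕ) :
    ∃ E : Finset ι, E.card ≤ 2 ^ t * T ∧ ∀ B : Finset ι, Disjoint B E → B.card ≤ T →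
      ρ ≤ mass (K t) (∏ i ∈ B, step (v i) ^ 2 ^ t) := by
  set bad : Finset ι → Prop := fun B =>
    B.card ≤ T ∧ mass (K t) (∏ i ∈ B, step (v i) ^ 2 ^ t) < ρ with hbad
  have h0 : ¬ bad ∅ := by
    rintro ⟨-, h⟩
    obtain ⟨η, hη⟩ := exists_of_pr_pos (hρ0.trans_le hρ)
    have h1 := hK 0 _ _ hη hη
    have h2 : ∀ j, (0 : X) ∈ K (j + 1) := by
      intro j
      induction j with
      | zero => simpa using h1
      | succ j ih => simpa using hK (j + 1) _ _ ih ih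
    have h3 : (0 : X) ∈ K t := by
      have := h2 (t - 1)
      rwa [Nat.sub_add_cancel ht] at this
    rw [Finset.prod_empty, AddMonoidAlgebra.one_def, mass_single, ind_true h3, mul_one] at h
    linarith [pr_le_one fun η : ι → Bool => ∑ i, sgz (η i) • v i ∈ K 0]
  rcases exists_disjoint_or_cover bad T (fun B h => h.1) h0 (2 ^ t) with ⟨s, hs, hb, hd⟩ | ⟨E, hE, h⟩
  · exfalso
    rw [pr_signs_eq_mass] at hρ
    set U := s.biUnion id with hU
    obtain ⟨a, ha⟩ := exists_translate_mass_le (Finset.univ \ U) v (K 0) (∏ i ∈ U, step (v i))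
    rw [Finset.prod_sdiff (Finset.subset_univ U)] at ha
    have hK' : ∀ j x y, x ∈ (fun j => if j = 0 then {y | a + y ∈ K 0} else K j) j →
        y ∈ (fun j => if j = 0 then {y | a + y ∈ K 0} else K j) j →
        x - y ∈ (fun j => if j = 0 then {y | a + y ∈ K 0} else K j) (j + 1) := by
      intro j x y hx hy
      simp only [Nat.succ_ne_zero, if_false] at hx hy ⊢
      by_cases hj : j = 0
      · subst hj
        have := hK 0 _ _ hx hy
        rwa [add_sub_add_left_eq_sub] at this
      · rw [if_neg hj] at hx hy
        exact hK j _ _ hx hy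
    obtain ⟨B, hB, hle⟩ := exists_mass_prod_le t _ hK' s (fun B => ∏ i ∈ B, step (v i))
      (fun B _ => SymNonneg.prod _ fun i _ => symNonneg_step _) hs
    have hprod : ∏ i ∈ U, step (v i) = ∏ B ∈ s, ∏ i ∈ B, step (v i) :=
      Finset.prod_biUnion hd
    simp only [if_true] at hle
    rw [if_neg (by omega), ← hprod, ← Finset.prod_pow] at hle
    exact absurd (hb B hB).2 (by linarith)
  · exact ⟨E, hE, fun B hBE hBT => by
      by_contra! hlt
      exact h B ⟨hBT, hlt⟩ hBE⟩

end GroupAlgebra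

/-- The binomial weights. -/
def bw (m b : ℕ) : ℝ := m.choose b / 2 ^ m

lemma bw_nonneg (m b : ℕ) : 0 ≤ bw m b := by unfold bw; positivity

lemma sum_bw (m : ℕ) : ∑ b ∈ Finset.range (m + 1), bw m b = 1 := by
  unfold bw
  rw [← Finset.sum_div, ← Nat.cast_sum, Nat.sum_range_choose]
  push_cast
  exact div_self (by positivity)

lemma centralBinom_sq_mul_le (h : ℕ) : h.centralBinom ^ 2 * (2 * h + 1) ≤ 16 ^ h := by
  induction h with
  | zero => simp
  | succ h ih =>
    have e := Nat.succ_mul_centralBinom_succ h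
    have h1 : (h + 1) ^ 2 * ((h + 1).centralBinom ^ 2 * (2 * (h + 1) + 1)) ≤
        (h + 1) ^ 2 * 16 ^ (h + 1) := by
      calc (h + 1) ^ 2 * ((h + 1).centralBinom ^ 2 * (2 * (h + 1) + 1))
          = ((h + 1) * (h + 1).centralBinom) ^ 2 * (2 * h + 3) := by ring
        _ = 4 * (2 * h + 1) * (2 * h + 3) * (h.centralBinom ^ 2 * (2 * h + 1)) := by
            rw [e]; ring
        _ ≤ 4 * (2 * h + 1) * (2 * h + 3) * 16 ^ h := by gcongr
        _ ≤ (16 * (h + 1) ^ 2) * 16 ^ h := Nat.mul_le_mul_right _ (by nlinarith)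
        _ = _ := by ring
    exact Nat.le_of_mul_le_mul_left h1 (by positivity)

lemma bw_half_sq_mul_le (h : ℕ) : bw (2 * h) h ^ 2 * (2 * h + 1) ≤ 1 := by
  have := centralBinom_sq_mul_le h
  have h2 : ((h.centralBinom : ℝ)) ^ 2 * (2 * h + 1) ≤ 16 ^ h := by exact_mod_cast this
  unfold bw
  rw [← Nat.centralBinom_eq_two_mul_choose, div_pow, ← pow_mul, mul_comm (2 * h) 2, ← mul_assoc,
    pow_mul 2 (2 * 2), div_mul_eq_mul_div]
  norm_num
  rw [div_le_one (by positivity)]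
  exact h2

lemma sum_choose_class_le {m k q : ℕ} (S : Finset ℕ)
    (hS : ∀ b ∈ S, ∀ b' ∈ S, (q : ℤ) ∣ (b : ℤ) - b') (hkm : k ≤ m) (hkq : k < q) :
    ∑ b ∈ S, m.choose b ≤ 2 ^ (m - k) * k.choose (k / 2) := by
  have h1 : ∀ b, m.choose b ≤ ∑ x ∈ (Finset.HasAntidiagonal.antidiagonal b).filter (fun x => x.1 ≤ m - k ∧ x.2 ≤ k),
      (m - k).choose x.1 * k.choose (k / 2) := by
    intro b
    conv_lhs => rw [← Nat.sub_add_cancel hkm]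
    rw [Nat.add_choose_eq, Finset.sum_filter]
    apply Finset.sum_le_sum
    intro x _
    split_ifs with hx
    · exact Nat.mul_le_mul_left _ (Nat.choose_le_middle _ _)
    · rw [not_and_or, not_le, not_le] at hx
      rcases hx with hx | hx
      · rw [Nat.choose_eq_zero_of_lt hx]; simp
      · rw [Nat.choose_eq_zero_of_lt hx]; simp
  calc ∑ b ∈ S, m.choose b ≤ ∑ b ∈ S,
        ∑ x ∈ (Finset.HasAntidiagonal.antidiagonal b).filter (fun x => x.1 ≤ m - k ∧ x.2 ≤ k),
        (m - k).choose x.1 * k.choose (k / 2) := Finset.sum_le_sum fun b _ => h1 b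
    _ = ∑ z ∈ S.sigma fun b => (Finset.HasAntidiagonal.antidiagonal b).filter (fun x => x.1 ≤ m - k ∧ x.2 ≤ k),
        (m - k).choose z.2.1 * k.choose (k / 2) := by rw [Finset.sum_sigma]
    _ = ∑ i ∈ (S.sigma fun b => (Finset.HasAntidiagonal.antidiagonal b).filter
        (fun x => x.1 ≤ m - k ∧ x.2 ≤ k)).image (fun z => z.2.1),
        (m - k).choose i * k.choose (k / 2) := by
        rw [Finset.sum_image]
        rintro ⟨b, x⟩ hx ⟨b', x'⟩ hx' hxx
        simp only [Finset.coe_sigma, Set.mem_sigma_iff, Finset.mem_coe, Finset.mem_filter,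
          Finset.HasAntidiagonal.mem_antidiagonal] at hx hx' hxx
        obtain ⟨hb, he, -, hk⟩ := hx
        obtain ⟨hb', he', -, hk'⟩ := hx'
        have hd := hS b hb b' hb'
        rw [← he, ← he', hxx] at hd
        have hd2 : (q : ℤ) ∣ (x.2 : ℤ) - x'.2 := by
          convert hd using 1; push_cast; ring
        have hz : (x.2 : ℤ) - x'.2 = 0 := by
          apply Int.eq_zero_of_abs_lt_dvd hd2
          rw [abs_lt]; constructor <;> omega
        have h2 : x.2 = x'.2 := by omega
        have h3 : x = x' := Prod.ext hxx h2
        subst h3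
        have h4 : b = b' := by omega
        subst h4
        rfl
    _ ≤ ∑ i ∈ Finset.range (m - k + 1), (m - k).choose i * k.choose (k / 2) := by
        apply Finset.sum_le_sum_of_subset
        intro i hi
        simp only [Finset.mem_image, Finset.mem_sigma, Finset.mem_filter] at hi
        obtain ⟨z, ⟨-, -, hz, -⟩, rfl⟩ := hi
        rw [Finset.mem_range]; omega
    _ = _ := by rw [← Finset.sum_mul, Nat.sum_range_choose]

lemma sum_bw_class_le {m k q : ℕ} (S : Finset ℕ)
    (hS : ∀ b ∈ S, ∀ b' ∈ S, (q : ℤ) ∣ (b : ℤ) - b') (hkm : k ≤ m) (hkq : k < q) :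
    ∑ b ∈ S, bw m b ≤ bw k (k / 2) := by
  have h := sum_choose_class_le S hS hkm hkq
  unfold bw
  rw [← Finset.sum_div, div_le_div_iff₀ (by positivity) (by positivity)]
  have h2 : (∑ b ∈ S, (m.choose b : ℝ)) ≤ 2 ^ (m - k) * k.choose (k / 2) := by exact_mod_cast h
  calc (∑ b ∈ S, (m.choose b : ℝ)) * 2 ^ k ≤ 2 ^ (m - k) * k.choose (k / 2) * 2 ^ k := by gcongr
    _ = k.choose (k / 2) * (2 ^ (m - k) * 2 ^ k) := by ring
    _ = _ := by rw [← pow_add, Nat.sub_add_cancel hkm]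

lemma sum_bw_class_pow_le {h l q : ℕ} (hh : 1 ≤ h) (hq : 2 ≤ q) (hql : q ≤ (2 * h) ^ l)
    (S : Finset ℕ) (hS : ∀ b ∈ S, ∀ b' ∈ S, (q : ℤ) ∣ (b : ℤ) - b') :
    (∑ b ∈ S, bw (2 * h) b) ^ (4 + 2 * l) * q ≤ 1 := by
  set γ := ∑ b ∈ S, bw (2 * h) b with hγ
  have hγ0 : 0 ≤ γ := Finset.sum_nonneg fun _ _ => bw_nonneg _ _
  have hhalf : γ ≤ 1 / 2 := by
    have := sum_bw_class_le (m := 2 * h) (k := 1) S hS (by omega) (by omega)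
    refine this.trans (le_of_eq ?_)
    simp [bw]
  have hγ1 : γ ≤ 1 := by linarith
  rcases eq_or_lt_of_le hq with rfl | hq3
  · have : γ ^ (4 + 2 * l) ≤ γ ^ 1 := pow_le_pow_of_le_one hγ0 hγ1 (by omega)
    push_cast
    linarith
  set k := min ((q - 1) / 2) h with hk
  have hb : γ ^ 2 * (2 * k + 1) ≤ 1 := by
    have h1 := sum_bw_class_le (m := 2 * h) (k := 2 * k) S hS (by omega) (by omega)
    rw [Nat.mul_div_cancel_left _ (by norm_num)] at h1
    have h2 := bw_half_sq_mul_le k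
    calc γ ^ 2 * (2 * k + 1) ≤ bw (2 * k) k ^ 2 * (2 * k + 1) := by gcongr
      _ ≤ 1 := h2
  rcases min_choice ((q - 1) / 2) h with hc | hc
  · have h3 : q ≤ (2 * k + 1) ^ 2 := by
      have : q - 1 ≤ 2 * k + 1 := by omega
      have h5 : q ≤ (q - 1) ^ 2 := by
        obtain ⟨c, rfl⟩ := Nat.exists_eq_add_of_lt hq3
        simp only [Nat.add_sub_cancel]; nlinarith
      exact h5.trans (Nat.pow_le_pow_left this 2)
    have h3' : (q : ℝ) ≤ (2 * k + 1) ^ 2 := by exact_mod_cast h3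
    calc γ ^ (4 + 2 * l) * q ≤ γ ^ 4 * (2 * k + 1) ^ 2 := by
          apply mul_le_mul _ h3' (by positivity) (by positivity)
          exact pow_le_pow_of_le_one hγ0 hγ1 (by omega)
      _ = (γ ^ 2 * (2 * k + 1)) ^ 2 := by ring
      _ ≤ 1 := pow_le_one₀ (by positivity) hb
  · have h3 : q ≤ (2 * k + 1) ^ l := hql.trans (Nat.pow_le_pow_left (by omega) l)
    have h3' : (q : ℝ) ≤ (2 * k + 1) ^ l := by exact_mod_cast h3
    calc γ ^ (4 + 2 * l) * q ≤ γ ^ (2 * l) * (2 * k + 1) ^ l := by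
          apply mul_le_mul _ h3' (by positivity) (by positivity)
          exact pow_le_pow_of_le_one hγ0 hγ1 (by omega)
      _ = (γ ^ 2 * (2 * k + 1)) ^ l := by rw [mul_pow, ← pow_mul]
      _ ≤ 1 := pow_le_one₀ (by positivity) hb

section
variable {X : Type*} [AddCommGroup X]

lemma step_pow (v : X) (m : ℕ) : step v ^ m = ∑ b ∈ Finset.range (m + 1),
    AddMonoidAlgebra.single ((2 * (b : ℤ) - m) • v) (bw m b) := by
  unfold step
  rw [add_pow]
  refine Finset.sum_congr rfl fun b hb => ?_
  have hb' : b ≤ m := by rw [Finset.mem_range] at hb; omega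
  rw [AddMonoidAlgebra.single_pow, AddMonoidAlgebra.single_pow,
    AddMonoidAlgebra.single_mul_single, ← nsmul_eq_mul', AddMonoidAlgebra.smul_single,
    ← pow_add, Nat.add_sub_cancel' hb']
  congr 1
  · rw [smul_neg, ← natCast_zsmul, ← natCast_zsmul, ← neg_smul, ← add_smul, Nat.cast_sub hb']
    congr 1; ring
  · rw [bw, nsmul_eq_mul]; simp [div_eq_mul_inv]

lemma mass_prod_sum {ι : Type*} (K : Set X) (B : Finset ι) (N : ℕ) (p : ℕ → ℝ) (w : ι → ℕ → X) :
    mass K (∏ i ∈ B, ∑ b ∈ Finset.range N, AddMonoidAlgebra.single (w i b) (p b)) =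
      ∑ β ∈ Fintype.piFinset fun _ : B => Finset.range N,
        (∏ i, p (β i)) * ind (∑ i : B, w i (β i) ∈ K) := by
  rw [← Finset.prod_coe_sort, Finset.prod_univ_sum, map_sum]
  refine Finset.sum_congr rfl fun β _ => ?_
  rw [AddMonoidAlgebra.prod_single, mass_single]

/-- No nontrivial combination of the `v i`, `i ∈ W`, with coefficients at most `L` lies in `K`. -/
def Dissoc {ι : Type*} (K : Set X) (L : ℕ) (v : ι → X) (W : Finset ι) : Prop :=
  ∀ s : ι → ℤ, (∀ i ∈ W, |s i| ≤ L) → ∑ i ∈ W, s i • v i ∈ K → ∀ i ∈ W, s i = 0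

lemma Dissoc.mass_le {ι : Type*} {K : Set X} {h : ℕ} {v : ι → X} {W : Finset ι}
    (hW : Dissoc K (2 * h) v W) : mass K (∏ i ∈ W, step (v i) ^ (2 * h)) ≤ bw (2 * h) h ^ W.card := by
  simp_rw [step_pow]
  rw [mass_prod_sum]
  have hz : ∀ β ∈ Fintype.piFinset fun _ : W => Finset.range (2 * h + 1), β ≠ (fun _ => h) →
      (∏ i, bw (2 * h) (β i)) * ind (∑ i : W, (2 * ((β i : ℕ) : ℤ) - ((2 * h : ℕ) : ℤ)) • v i ∈ K)
        = 0 := by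
    intro β hβ hne
    rw [Fintype.mem_piFinset] at hβ
    rw [ind_false, mul_zero]
    intro hmem
    apply hne
    have := hW (fun i => if hi : i ∈ W then 2 * ((β ⟨i, hi⟩ : ℕ) : ℤ) - ((2 * h : ℕ) : ℤ) else 0)
      (fun i hi => by
        rw [dif_pos hi]
        have := hβ ⟨i, hi⟩
        rw [Finset.mem_range] at this
        rw [abs_le]; push_cast; constructor <;> omega)
      (by
        rw [← Finset.sum_coe_sort]
        simpa using hmem)
    funext ⟨i, hi⟩
    have h1 := this i hi
    rw [dif_pos hi] at h1
    push_cast at h1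
    omega
  rw [Finset.sum_eq_single_of_mem (fun _ => h) (by simp; omega) hz]
  simp only [Finset.prod_const, Finset.card_univ, Fintype.card_coe]
  have : 0 ≤ bw (2 * h) h ^ W.card := pow_nonneg (bw_nonneg _ _) _
  nlinarith [ind_le_one (∑ i : W, (2 * (h : ℤ) - ((2 * h : ℕ) : ℤ)) • v i ∈ K)]

lemma card_le_of_mass {h C d : ℕ} (hh : 1 ≤ h) {ρ : ℝ} (hρ : 1 ≤ (2 * h : ℝ) ^ C * ρ)
    (hle : ρ ≤ bw (2 * h) h ^ d) : d ≤ 2 * C := by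
  by_contra! hd
  have h0 : 0 ≤ bw (2 * h) h := bw_nonneg _ _
  have hpos : (0 : ℝ) < (2 * h : ℝ) ^ C := by
    have : (1 : ℝ) ≤ h := by exact_mod_cast hh
    positivity
  have hρ0 : 0 < ρ := by
    by_contra! hn
    nlinarith
  have h1 := bw_half_sq_mul_le h
  have hh' : (1 : ℝ) ≤ h := by exact_mod_cast hh
  have h2 : bw (2 * h) h ^ 2 * (2 * h) < 1 := by
    rcases h0.eq_or_lt with he | hl
    · rw [← he]; norm_num
    · nlinarith [pow_pos hl 2]
  have hb1 : bw (2 * h) h ≤ 1 := by nlinarith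
  have h3 : 1 ≤ ((2 * h : ℝ) ^ C * ρ) ^ 2 := one_le_pow₀ hρ
  have h4 : ((2 * h : ℝ) ^ C * ρ) ^ 2 ≤ ((2 * h : ℝ) ^ C * bw (2 * h) h ^ (2 * C + 1)) ^ 2 := by
    have : ρ ≤ bw (2 * h) h ^ (2 * C + 1) := hle.trans (pow_le_pow_of_le_one h0 hb1 hd)
    gcongr
  have h5 : ((2 * h : ℝ) ^ C * bw (2 * h) h ^ (2 * C + 1)) ^ 2 =
      (bw (2 * h) h ^ 2 * (2 * h)) ^ (2 * C) * bw (2 * h) h ^ 2 := by ring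
  have h6 : (bw (2 * h) h ^ 2 * (2 * h)) ^ (2 * C) ≤ 1 := pow_le_one₀ (by positivity) h2.le
  have h7 : bw (2 * h) h ^ 2 < 1 := by nlinarith [pow_nonneg h0 2]
  rw [h5] at h4
  nlinarith [pow_nonneg h0 2]

/-- A Littlewood-Offord statement for approximate relations: if a random signed sum lies in
`K 0` with polynomially large probability, then up to few exceptions every vector has a
bounded integer relation with boundedly many fixed vectors, up to an element of `K t`. -/
lemma exists_relations {ι : Type*} [Fintype ι] [DecidableEq ι] (v : ι → X)
    (K : ℕ → Set X) (hK : ∀ j x y, x ∈ K j → y ∈ K j → x - y ∈ K (j + 1)) (t : ℕ) (ht : 1 ≤ t)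
    (C : ℕ) (hC : 1 ≤ ((2 : ℝ) ^ t) ^ C * pr fun η : ι → Bool => ∑ i, sgz (η i) • v i ∈ K 0) :
    ∃ W E : Finset ι, W.card ≤ 2 * C ∧ E.card ≤ 2 ^ t * (2 * C + 1) + 2 * C ∧
      ∀ j ∉ E, j ∉ W ∧ ∃ s : ι → ℤ, s j ≠ 0 ∧ (∀ i, |s i| ≤ 2 ^ t) ∧
        s j • v j + ∑ h ∈ W, s h • v h ∈ K t := by
  set ρ := pr fun η : ι → Bool => ∑ i, sgz (η i) • v i ∈ K 0 with hρ
  have hpos : (0 : ℝ) < ((2 : ℝ) ^ t) ^ C := by positivity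
  have hρ0 : 0 < ρ := by
    by_contra! hn
    nlinarith
  obtain ⟨h, hh⟩ : ∃ h, 2 ^ t = 2 * h := ⟨2 ^ (t - 1), by
    rw [← pow_succ', Nat.sub_add_cancel ht]⟩
  have hh1 : 1 ≤ h := by
    have := Nat.pos_of_ne_zero (pow_ne_zero t (two_ne_zero (α := ℕ)))
    omega
  have hC' : 1 ≤ (2 * h : ℝ) ^ C * ρ := by
    have : ((2 : ℝ) ^ t) = 2 * h := by exact_mod_cast hh
    rwa [this] at hC
  obtain ⟨E, hE, hblock⟩ := exists_exceptional_blocks v K hK t ht ρ le_rfl hρ0 (2 * C + 1)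
  have hsmall : ∀ W : Finset ι, Disjoint W E → W.card ≤ 2 * C + 1 → Dissoc (K t) (2 ^ t) v W →
      W.card ≤ 2 * C := by
    intro W hWE hWc hWd
    have h1 := hblock W hWE hWc
    rw [hh] at h1 hWd
    exact card_le_of_mass hh1 hC' (h1.trans hWd.mass_le)
  obtain ⟨W, hWmem, hWmax⟩ := Finset.exists_max_image
    ((Finset.univ : Finset (Finset ι)).filter fun W => Disjoint W E ∧ W.card ≤ 2 * C + 1 ∧
      Dissoc (K t) (2 ^ t) v W) Finset.card ⟨∅, by
        simp only [Finset.mem_filter, Finset.mem_univ, true_and]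
        exact ⟨Finset.disjoint_empty_left _, by simp, fun s _ _ i hi => absurd hi (by simp)⟩⟩
  simp only [Finset.mem_filter, Finset.mem_univ, true_and] at hWmem hWmax
  obtain ⟨hWE, hWc, hWd⟩ := hWmem
  have hWc' := hsmall W hWE hWc hWd
  refine ⟨W, E ∪ W, hWc', (Finset.card_union_le _ _).trans (by omega), ?_⟩
  intro j hj
  rw [Finset.mem_union, not_or] at hj
  obtain ⟨hjE, hjW⟩ := hj
  refine ⟨hjW, ?_⟩
  have hnd : ¬ Dissoc (K t) (2 ^ t) v (insert j W) := by
    intro hd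
    have := hWmax (insert j W) ⟨by
      rw [Finset.disjoint_insert_left]; exact ⟨hjE, hWE⟩, by
      rw [Finset.card_insert_of_notMem hjW]; omega, hd⟩
    rw [Finset.card_insert_of_notMem hjW] at this
    omega
  unfold Dissoc at hnd
  push Not at hnd
  obtain ⟨s, hs, hsum, i, hi, hne⟩ := hnd
  refine ⟨fun i => if i ∈ insert j W then s i else 0, ?_, ?_, ?_⟩
  · simp only [Finset.mem_insert_self, if_true]
    intro h0
    have h1 : ∑ i ∈ W, s i • v i ∈ K t := by
      rw [Finset.sum_insert hjW, h0] at hsum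
      simpa using hsum
    have h2 := hWd s (fun i hi => hs i (Finset.mem_insert_of_mem hi)) h1
    rcases Finset.mem_insert.mp hi with rfl | hi'
    · exact hne h0
    · exact hne (h2 i hi')
  · intro i
    beta_reduce
    split_ifs with hi
    · exact_mod_cast hs i hi
    · simp
  · rw [Finset.sum_insert hjW] at hsum
    simp only [Finset.mem_insert_self, if_true]
    convert hsum using 2
    refine Finset.sum_congr rfl fun i hi => ?_
    rw [if_pos (Finset.mem_insert_of_mem hi)]

end

section
variable {X : Type*} [AddCommGroup X]

/-- The law of a centred binomial variable times `κ`. -/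
def binStep (h : ℕ) (κ : X) : AddMonoidAlgebra ℝ X :=
  ∑ b ∈ Finset.range (2 * h + 1), AddMonoidAlgebra.single (((b : ℤ) - h) • κ) (bw (2 * h) b)

lemma mass_prod_binStep_le_one {ι : Type*} (K : Set X) (B : Finset ι) (h : ℕ) (κ : ι → X) :
    mass K (∏ i ∈ B, binStep h (κ i)) ≤ 1 := by
  unfold binStep
  rw [mass_prod_sum]
  calc _ ≤ ∑ β ∈ Fintype.piFinset fun _ : B => Finset.range (2 * h + 1),
        ∏ i, bw (2 * h) (β i) := by
        apply Finset.sum_le_sum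
        intro β _
        have : 0 ≤ ∏ i, bw (2 * h) (β i) := Finset.prod_nonneg fun _ _ => bw_nonneg _ _
        nlinarith [ind_le_one (∑ i : B, ((β i : ℤ) - h) • κ i ∈ K)]
    _ = 1 := by
        rw [← Finset.prod_univ_sum]
        simp [sum_bw]

lemma coeff_prod_binStep_nonneg {ι : Type*} (B : Finset ι) (h : ℕ) (κ : ι → X) (y : X) :
    0 ≤ (∏ i ∈ B, binStep h (κ i)).coeff y := by
  unfold binStep
  rw [coeff_eq_mass, mass_prod_sum]
  exact Finset.sum_nonneg fun β _ =>
    mul_nonneg (Finset.prod_nonneg fun _ _ => bw_nonneg _ _) (ind_nonneg _)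

lemma mem_of_coeff_prod_binStep_ne {ι : Type*} (B : Finset ι) (h : ℕ) (κ : ι → X)
    (H : AddSubgroup X) (hH : ∀ i ∈ B, κ i ∈ H) {y : X}
    (hy : (∏ i ∈ B, binStep h (κ i)).coeff y ≠ 0) : y ∈ H := by
  unfold binStep at hy
  rw [coeff_eq_mass, mass_prod_sum] at hy
  obtain ⟨β, -, hβ⟩ := Finset.exists_ne_zero_of_sum_ne_zero hy
  have : ∑ i : B, ((β i : ℤ) - h) • κ i ∈ ({y} : Set X) := by
    by_contra hn
    rw [ind_false hn, mul_zero] at hβ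
    exact hβ rfl
  rw [Set.mem_singleton_iff] at this
  rw [← this]
  exact H.sum_mem fun i _ => H.zsmul_mem (hH i i.2) _

lemma mass_step_le_mass_binStep {ι Y : Type*} [AddCommGroup Y] [IsAddTorsionFree X]
    (B : Finset ι) (h : ℕ) (v : ι → X) (κ : ι → Y) (Γ : Set Y)
    (hΓ : ∀ s : ι → ℤ, (∀ i, |s i| ≤ h) → ∑ i ∈ B, s i • v i = 0 → ∑ i ∈ B, s i • κ i ∈ Γ) :
    mass {0} (∏ i ∈ B, step (v i) ^ (2 * h)) ≤ mass Γ (∏ i ∈ B, binStep h (κ i)) := by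
  unfold binStep
  simp_rw [step_pow]
  rw [mass_prod_sum, mass_prod_sum]
  apply Finset.sum_le_sum
  intro β hβ
  rw [Fintype.mem_piFinset] at hβ
  apply mul_le_mul_of_nonneg_left _ (Finset.prod_nonneg fun _ _ => bw_nonneg _ _)
  apply ind_mono
  intro h0
  rw [Set.mem_singleton_iff] at h0
  have h1 : (2 : ℤ) • ∑ i : B, ((β i : ℤ) - h) • v i = 0 := by
    rw [← h0, Finset.smul_sum]
    refine Finset.sum_congr rfl fun i _ => ?_
    rw [← mul_smul]; congr 1; push_cast; ring
  have h2 : ∑ i : B, ((β i : ℤ) - h) • v i = 0 := by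
    exact zsmul_right_injective (two_ne_zero (α := ℤ)) (by simpa using h1)
  have := hΓ (fun i => if hi : i ∈ B then (β ⟨i, hi⟩ : ℤ) - h else 0) (fun i => by
      split_ifs with hi
      · have := hβ ⟨i, hi⟩
        rw [Finset.mem_range] at this
        rw [abs_le]; constructor <;> omega
      · simp) (by
      rw [← Finset.sum_coe_sort]; simpa using h2)
  rw [← Finset.sum_coe_sort] at this
  simpa using this

lemma mass_coset_insert_pow_le {h l q D : ℕ} (hh : 1 ≤ h) (hq : 2 ≤ q) (hql : q ≤ (2 * h) ^ l)
    (hD : D = 4 + 2 * l) (Γ H : AddSubgroup X) (hΓH : Γ ≤ H) (F : AddMonoidAlgebra ℝ X)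
    (hF0 : ∀ y, 0 ≤ F.coeff y) (hFH : ∀ y, F.coeff y ≠ 0 → y ∈ H) (k : ℕ)
    (hF : ∀ a, mass {y | y - a ∈ Γ} F ^ D * k ≤ 1) (κ : X)
    (hκ : ∀ z : ℤ, z • κ ∈ H → (q : ℤ) ∣ z) (a : X) :
    mass {y | y - a ∈ Γ} (binStep h κ * F) ^ D * ((k * q : ℕ) : ℝ) ≤ 1 := by
  set A : ℕ → X := fun b => a - ((b : ℤ) - h) • κ with hA
  have e : mass {y | y - a ∈ Γ} (binStep h κ * F) =
      ∑ b ∈ Finset.range (2 * h + 1), bw (2 * h) b * mass {y | y - A b ∈ Γ} F := by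
    rw [binStep, Finset.sum_mul, map_sum]
    refine Finset.sum_congr rfl fun b _ => ?_
    rw [mass_single_mul]
    congr 3
    ext y
    simp only [Set.mem_ofPred_eq, hA]
    have : ((b : ℤ) - h) • κ + y - a = y - (a - ((b : ℤ) - h) • κ) := by abel
    rw [this]
  set S := (Finset.range (2 * h + 1)).filter fun b => A b ∈ H with hS
  have e2 : mass {y | y - a ∈ Γ} (binStep h κ * F) =
      ∑ b ∈ S, bw (2 * h) b * mass {y | y - A b ∈ Γ} F := by
    rw [e, hS, Finset.sum_filter]
    refine Finset.sum_congr rfl fun b _ => ?_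
    split_ifs with hb
    · rfl
    · have : mass {y | y - A b ∈ Γ} F = 0 := by
        rw [mass_apply]
        apply Finset.sum_eq_zero
        intro y hy
        rw [ind_false, mul_zero]
        intro hyb
        apply hb
        have h1 := hFH y (by simpa using hy)
        have h2 := H.sub_mem h1 (hΓH hyb)
        simpa using h2
      rw [this, mul_zero]
  have hSq : ∀ b ∈ S, ∀ b' ∈ S, (q : ℤ) ∣ (b : ℤ) - b' := by
    intro b hb b' hb'
    apply hκ
    have h1 := H.sub_mem (Finset.mem_filter.mp hb').2 (Finset.mem_filter.mp hb).2
    have : A b' - A b = ((b : ℤ) - b') • κ := by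
      simp only [hA, sub_smul]; abel
    rwa [this] at h1
  have hγ := sum_bw_class_pow_le hh hq hql S hSq
  rw [← hD] at hγ
  have hD0 : D ≠ 0 := by omega
  rw [e2]
  rcases S.eq_empty_or_nonempty with hSe | hSn
  · rw [hSe]; simp [hD0]
  obtain ⟨b0, hb0, hmax⟩ := Finset.exists_max_image S (fun b => mass {y | y - A b ∈ Γ} F) hSn
  set M := mass {y | y - A b0 ∈ Γ} F with hM
  have hM0 : 0 ≤ M := mass_nonneg hF0 _
  have hγ0 : 0 ≤ ∑ b ∈ S, bw (2 * h) b := Finset.sum_nonneg fun _ _ => bw_nonneg _ _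
  have hle : ∑ b ∈ S, bw (2 * h) b * mass {y | y - A b ∈ Γ} F ≤ (∑ b ∈ S, bw (2 * h) b) * M := by
    rw [Finset.sum_mul]
    exact Finset.sum_le_sum fun b hb => mul_le_mul_of_nonneg_left (hmax b hb) (bw_nonneg _ _)
  have h0 : 0 ≤ ∑ b ∈ S, bw (2 * h) b * mass {y | y - A b ∈ Γ} F :=
    Finset.sum_nonneg fun b _ => mul_nonneg (bw_nonneg _ _) (mass_nonneg hF0 _)
  calc (∑ b ∈ S, bw (2 * h) b * mass {y | y - A b ∈ Γ} F) ^ D * ((k * q : ℕ) : ℝ)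
      ≤ ((∑ b ∈ S, bw (2 * h) b) * M) ^ D * ((k * q : ℕ) : ℝ) := by gcongr
    _ = ((∑ b ∈ S, bw (2 * h) b) ^ D * q) * (M ^ D * k) := by push_cast; ring
    _ ≤ 1 := mul_le_one₀ hγ (by positivity) (hF _)

end

section
variable {ι : Type} [Fintype ι] [DecidableEq ι]

/-- The integer-valued functions inside the rational-valued ones. -/
def intLattice (ι : Type) : AddSubgroup (ι → ℚ) where
  carrier := {y | ∀ i, ∃ z : ℤ, y i = z}
  zero_mem' i := ⟨0, by simp⟩
  add_mem' {x y} hx hy i := by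
    obtain ⟨a, ha⟩ := hx i
    obtain ⟨b, hb⟩ := hy i
    exact ⟨a + b, by simp [ha, hb]⟩
  neg_mem' {x} hx i := by
    obtain ⟨a, ha⟩ := hx i
    exact ⟨-a, by simp [ha]⟩

/-- The group generated by the integer lattice and the vectors `κ i`, `i ∈ B`. -/
def latticeSpan (κ : ι → ι → ℚ) (B : Finset ι) : AddSubgroup (ι → ℚ) :=
  intLattice ι ⊔ AddSubgroup.closure (κ '' B)

lemma intLattice_le_latticeSpan (κ : ι → ι → ℚ) (B : Finset ι) :
    intLattice ι ≤ latticeSpan κ B := le_sup_left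

lemma mem_latticeSpan {κ : ι → ι → ℚ} {B : Finset ι} {i : ι} (hi : i ∈ B) :
    κ i ∈ latticeSpan κ B :=
  (le_sup_right : _ ≤ latticeSpan κ B) (AddSubgroup.subset_closure ⟨i, hi, rfl⟩)

lemma latticeSpan_le {κ : ι → ι → ℚ} {B : Finset ι} {H : AddSubgroup (ι → ℚ)}
    (h0 : intLattice ι ≤ H) (h : ∀ i ∈ B, κ i ∈ H) : latticeSpan κ B ≤ H :=
  sup_le h0 ((AddSubgroup.closure_le _).mpr fun _ ⟨i, hi, he⟩ => he ▸ h i hi)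

/-- The block `B` spans a lattice of exponent dividing `k`, on whose cosets the binomial
random walk has small mass in terms of `k`. -/
def GoodBlock (h D : ℕ) (κ : ι → ι → ℚ) (d : ℕ) (B : Finset ι) (k : ℕ) : Prop :=
  0 < k ∧ (∀ y ∈ latticeSpan κ B, k • y ∈ intLattice ι) ∧
    (∀ a, mass {y | y - a ∈ intLattice ι} (∏ i ∈ B, binStep h (κ i)) ^ D * k ≤ 1) ∧
    2 ^ B.card ≤ k * 2 ^ d

lemma goodBlock_start (h D : ℕ) {κ : ι → ι → ℚ} {W : Finset ι}
    (hW : ∀ i ∈ W, κ i ∈ intLattice ι) : GoodBlock h D κ W.card W 1 := by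
  refine ⟨one_pos, fun y hy => ?_, fun a => ?_, by simp⟩
  · rw [one_smul]
    exact latticeSpan_le le_rfl hW hy
  · rw [Nat.cast_one, mul_one]
    exact pow_le_one₀ (mass_nonneg (coeff_prod_binStep_nonneg _ _ _) _)
      (mass_prod_binStep_le_one _ _ _ _)

lemma exists_goodBlock_insert {h l D : ℕ} (hh : 1 ≤ h) (hD : D = 4 + 2 * l) {κ : ι → ι → ℚ} {d : ℕ}
    {B : Finset ι} {k : ℕ} (hB : GoodBlock h D κ d B k) {i : ι} (hi : κ i ∉ latticeSpan κ B)
    {p : ℕ} (hp : 0 < p) (hpl : p ≤ (2 * h) ^ l) (hpκ : p • κ i ∈ intLattice ι) :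
    ∃ q, q ≤ (2 * h) ^ l ∧ GoodBlock h D κ d (insert i B) (k * q) := by
  obtain ⟨hk, hspan, hmass, hcard⟩ := hB
  set H := latticeSpan κ B with hH
  set q := addOrderOf (QuotientAddGroup.mk (κ i) : (ι → ℚ) ⧸ H) with hq
  have hiB : i ∉ B := fun h => hi (mem_latticeSpan h)
  have hqp : q ∣ p := by
    apply addOrderOf_dvd_of_nsmul_eq_zero
    rw [← QuotientAddGroup.mk_nsmul, QuotientAddGroup.eq_zero_iff]
    exact intLattice_le_latticeSpan _ _ hpκ
  have hq0 : 0 < q := Nat.pos_of_dvd_of_pos hqp hp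
  have hql : q ≤ (2 * h) ^ l := (Nat.le_of_dvd hp hqp).trans hpl
  have hqκ : q • κ i ∈ H := by
    rw [← QuotientAddGroup.eq_zero_iff, QuotientAddGroup.mk_nsmul]
    exact addOrderOf_nsmul_eq_zero _
  have hq1 : q ≠ 1 := by
    intro h1
    rw [h1, one_smul] at hqκ
    exact hi hqκ
  have hq2 : 2 ≤ q := by omega
  have hdiv : ∀ z : ℤ, z • κ i ∈ H → (q : ℤ) ∣ z := by
    intro z hz
    rw [hq, addOrderOf_dvd_iff_zsmul_eq_zero, ← QuotientAddGroup.mk_zsmul,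
      QuotientAddGroup.eq_zero_iff]
    exact hz
  refine ⟨q, hql, Nat.mul_pos hk hq0, ?_, ?_, ?_⟩
  · have hle : latticeSpan κ (insert i B) ≤
        (intLattice ι).comap (DistribSMul.toAddMonoidHom (ι → ℚ) (k * q)) := by
      apply latticeSpan_le
      · intro y hy
        exact (intLattice ι).nsmul_mem hy _
      · intro j hj
        rcases Finset.mem_insert.mp hj with rfl | hj
        · change (k * q) • κ j ∈ intLattice ι
          rw [mul_smul]
          exact hspan _ hqκ
        · change (k * q) • κ j ∈ intLattice ι
          rw [mul_comm, mul_smul]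
          exact (intLattice ι).nsmul_mem (hspan _ (mem_latticeSpan hj)) _
    exact fun y hy => hle hy
  · intro a
    rw [Finset.prod_insert hiB]
    exact mass_coset_insert_pow_le hh hq2 hql hD _ H (intLattice_le_latticeSpan _ _) _
      (coeff_prod_binStep_nonneg _ _ _)
      (fun y hy => mem_of_coeff_prod_binStep_ne B h κ H (fun i hi => mem_latticeSpan hi) hy)
      k hmass _ hdiv a
  · rw [Finset.card_insert_of_notMem hiB, pow_succ]
    calc 2 ^ B.card * 2 ≤ (k * 2 ^ d) * q := Nat.mul_le_mul hcard hq2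
      _ = _ := by ring

end

lemma exists_mul_le_two_pow (A : ℕ) : ∃ t₀, ∀ t, t₀ ≤ t → A * t ≤ 2 ^ t := by
  have h : ∀ t, 4 ≤ t → t ^ 2 ≤ 2 ^ t := by
    intro t ht
    induction t, ht using Nat.le_induction with
    | base => norm_num
    | succ t ht ih => rw [pow_succ 2 t]; nlinarith
  refine ⟨max 4 A, fun t ht => ?_⟩
  calc A * t ≤ t * t := Nat.mul_le_mul_right _ ((le_max_right _ _).trans ht)
    _ = t ^ 2 := (pow_two t).symm
    _ ≤ 2 ^ t := h t ((le_max_left _ _).trans ht)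

/-- The exponents of the scales at which dissociated sets are compared. -/
def scaleStep (C l : ℕ) : ℕ := C * (4 + 2 * l) + 3 + 2 * l

/-- Iterated scales. -/
def scale (C : ℕ) : ℕ → ℕ
  | 0 => 1
  | j + 1 => scaleStep C (scale C j)

lemma scale_le_succ (C j : ℕ) : scale C j ≤ scale C (j + 1) := by
  simp only [scale, scaleStep]; nlinarith

lemma scale_mono (C : ℕ) : Monotone (scale C) := monotone_nat_of_le_succ (scale_le_succ C)

section
variable {ι : Type} [Fintype ι] [DecidableEq ι]

lemma exists_dissoc_scale {v : ι → ℝ} {V : Finset ι} {C m r : ℕ}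
    (hr : ∀ W ⊆ V, W.card = r → ¬ Dissoc {0} (m ^ 1) v W) (j : ℕ) : ∀ W ⊆ V, W.card + j = r →
    Dissoc {0} (m ^ scale C j) v W → ∃ W' ⊆ V, ∃ l, l ≤ scale C r ∧ W'.card ≤ r ∧
      Dissoc {0} (m ^ scaleStep C l) v W' ∧ scaleStep C l ≤ scale C r ∧
      ∀ i ∈ V, i ∉ W' → ¬ Dissoc {0} (m ^ l) v (insert i W') := by
  induction j with
  | zero => intro W hW hc hd; exact absurd hd (hr W hW (by simpa using hc))
  | succ j ih =>
    intro W hW hc hd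
    by_cases hall : ∀ i ∈ V, i ∉ W → ¬ Dissoc {0} (m ^ scale C j) v (insert i W)
    · exact ⟨W, hW, scale C j, scale_mono C (by omega), by omega, hd,
        scale_mono C (show j + 1 ≤ r by omega), hall⟩
    · push Not at hall
      obtain ⟨i, hiV, hiW, hdi⟩ := hall
      exact ih (insert i W) (Finset.insert_subset hiV hW)
        (by rw [Finset.card_insert_of_notMem hiW]; omega) hdi

lemma exists_relation_of_not_dissoc {v : ι → ℝ} {L L' : ℕ} (hL : L ≤ L') {W : Finset ι} {i : ι}
    (hi : i ∉ W) (hW : Dissoc {0} L' v W) (hn : ¬ Dissoc {0} L v (insert i W)) :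
    ∃ (q : ℕ) (p : ι → ℤ), 0 < q ∧ q ≤ L ∧ (∀ h, |p h| ≤ L) ∧
      (q : ℝ) * v i = ∑ h ∈ W, (p h : ℝ) * v h := by
  unfold Dissoc at hn
  push Not at hn
  obtain ⟨s, hs, hsum, j, hj, hne⟩ := hn
  rw [Finset.sum_insert hi, Set.mem_singleton_iff] at hsum
  have hsi : s i ≠ 0 := by
    intro h0
    rw [h0, zero_smul, zero_add] at hsum
    have h2 := hW s (fun i hi => (hs i (Finset.mem_insert_of_mem hi)).trans (by exact_mod_cast hL))
      hsum
    rcases Finset.mem_insert.mp hj with rfl | hj'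
    · exact hne h0
    · exact hne (h2 j hj')
  have hsi' := hs i (Finset.mem_insert_self _ _)
  simp only [zsmul_eq_mul] at hsum
  refine ⟨(s i).natAbs, fun h => if h ∈ W then -(s i).sign * s h else 0,
    Int.natAbs_pos.mpr hsi, by
      rw [Int.abs_eq_natAbs] at hsi'; exact_mod_cast hsi', ?_, ?_⟩
  · intro h
    beta_reduce
    split_ifs with hh
    · rw [abs_mul, abs_neg, Int.abs_sign_of_ne_zero hsi, one_mul]
      exact hs h (Finset.mem_insert_of_mem hh)
    · simp
  · have e1 : (((s i).natAbs : ℕ) : ℝ) = ((s i).sign : ℝ) * s i := by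
      have := Int.sign_mul_self_eq_natAbs (s i)
      have h2 : (((s i).sign * s i : ℤ) : ℝ) = (((s i).natAbs : ℤ) : ℝ) := by
        rw [this]
      push_cast at h2
      rw [h2]; simp
    have e2 : ∑ h ∈ W, (((if h ∈ W then -(s i).sign * s h else 0 : ℤ)) : ℝ) * v h =
        -((s i).sign : ℝ) * ∑ h ∈ W, (s h : ℝ) * v h := by
      rw [Finset.mul_sum]
      refine Finset.sum_congr rfl fun h hh => ?_
      rw [if_pos hh]; push_cast; ring
    rw [e1, e2]
    linear_combination ((s i).sign : ℝ) * hsum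

lemma sum_mem_intLattice {v : ι → ℝ} {W V B : Finset ι} {k L N b : ℕ} {q : ι → ℕ}
    {p : ι → ι → ℤ} (hBV : B ⊆ V) (hq : ∀ i ∈ V, 0 < q i) (hp : ∀ i ∈ V, ∀ h ∈ W, |p i h| ≤ L)
    (hv : ∀ i ∈ V, (q i : ℝ) * v i = ∑ h ∈ W, (p i h : ℝ) * v h) (hk : 0 < k)
    {κ : ι → ι → ℚ} (hκ : κ = fun i h => if h ∈ W then (p i h : ℚ) / q i else 0)
    (hkκ : ∀ i ∈ B, k • κ i ∈ intLattice ι) (hW : Dissoc {0} N v W)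
    (hN : B.card * b * (k * L) ≤ N) (s : ι → ℤ) (hs : ∀ i, |s i| ≤ b)
    (h0 : ∑ i ∈ B, s i • v i = 0) : ∑ i ∈ B, s i • κ i ∈ (intLattice ι : Set (ι → ℚ)) := by
  have hz : ∀ i ∈ B, ∀ h ∈ W, ∃ z : ℤ, (k : ℚ) * κ i h = z ∧ z * q i = k * p i h := by
    intro i hi h hh
    obtain ⟨z, hz⟩ := hkκ i hi h
    refine ⟨z, by simpa using hz, ?_⟩
    have hq0 : (q i : ℚ) ≠ 0 := by exact_mod_cast (hq i (hBV hi)).ne'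
    have : (z : ℚ) * q i = k * p i h := by
      rw [← hz, hκ]
      simp only [Pi.smul_apply, nsmul_eq_mul, if_pos hh]
      field_simp
    exact_mod_cast this
  choose! z hz1 hz2 using hz
  have hzb : ∀ i ∈ B, ∀ h ∈ W, |z i h| ≤ k * L := by
    intro i hi h hh
    have h1 : |z i h| * q i = k * |p i h| := by
      have := congrArg abs (hz2 i hi h hh)
      simpa [abs_mul] using this
    have h2 : (1 : ℤ) ≤ q i := by exact_mod_cast hq i (hBV hi)
    have h3 := hp i (hBV hi) h hh
    nlinarith [abs_nonneg (z i h), abs_nonneg (p i h)]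
  have hkv : ∀ i ∈ B, (k : ℝ) * v i = ∑ h ∈ W, (z i h : ℝ) * v h := by
    intro i hi
    have hq0 : (q i : ℝ) ≠ 0 := by exact_mod_cast (hq i (hBV hi)).ne'
    apply mul_left_cancel₀ hq0
    calc (q i : ℝ) * (k * v i) = k * ((q i : ℝ) * v i) := by ring
      _ = ∑ h ∈ W, (k * p i h : ℝ) * v h := by
        rw [hv i (hBV hi), Finset.mul_sum]
        exact Finset.sum_congr rfl fun h _ => by ring
      _ = ∑ h ∈ W, (z i h * q i : ℝ) * v h := by
        refine Finset.sum_congr rfl fun h hh => ?_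
        have := hz2 i hi h hh
        have h3 : ((z i h : ℝ)) * q i = k * p i h := by exact_mod_cast this
        rw [h3]
      _ = _ := by
        rw [Finset.mul_sum]
        exact Finset.sum_congr rfl fun h _ => by ring
  have hS := hW (fun h => ∑ i ∈ B, s i * z i h) (fun h hh => by
      calc |∑ i ∈ B, s i * z i h| ≤ ∑ i ∈ B, |s i * z i h| := Finset.abs_sum_le_sum_abs _ _
        _ ≤ ∑ _i ∈ B, (b : ℤ) * (k * L) := by
            apply Finset.sum_le_sum
            intro i hi
            rw [abs_mul]
            exact mul_le_mul (hs i) (hzb i hi h hh) (abs_nonneg _) (by positivity)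
        _ ≤ N := by
            rw [Finset.sum_const, nsmul_eq_mul, ← mul_assoc]
            exact_mod_cast hN) (by
      rw [Set.mem_singleton_iff]
      simp only [zsmul_eq_mul] at h0 ⊢
      push_cast
      calc ∑ h ∈ W, (∑ i ∈ B, (s i : ℝ) * z i h) * v h
          = ∑ h ∈ W, ∑ i ∈ B, (s i : ℝ) * (z i h * v h) := by
            refine Finset.sum_congr rfl fun h _ => ?_
            rw [Finset.sum_mul]
            exact Finset.sum_congr rfl fun i _ => by ring
        _ = ∑ i ∈ B, (s i : ℝ) * ∑ h ∈ W, (z i h * v h : ℝ) := by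
            rw [Finset.sum_comm]
            exact Finset.sum_congr rfl fun i _ => by rw [Finset.mul_sum]
        _ = ∑ i ∈ B, (s i : ℝ) * (k * v i) :=
            Finset.sum_congr rfl fun i hi => by rw [hkv i hi]
        _ = k * ∑ i ∈ B, (s i : ℝ) * v i := by
            rw [Finset.mul_sum]
            exact Finset.sum_congr rfl fun i _ => by ring
        _ = 0 := by rw [h0, mul_zero])
  have hzero : ∑ i ∈ B, s i • κ i = 0 := by
    funext h
    simp only [Finset.sum_apply, zsmul_eq_mul, Pi.zero_apply]
    by_cases hh : h ∈ W
    · have hk0 : (k : ℚ) ≠ 0 := by exact_mod_cast hk.ne'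
      apply mul_left_cancel₀ hk0
      rw [mul_zero, Finset.mul_sum]
      calc ∑ i ∈ B, (k : ℚ) * (s i * κ i h) = ∑ i ∈ B, ((s i * z i h : ℤ) : ℚ) := by
            refine Finset.sum_congr rfl fun i hi => ?_
            push_cast
            rw [← hz1 i hi h hh]; ring
        _ = 0 := by rw [← Int.cast_sum]; exact_mod_cast hS h hh
    · apply Finset.sum_eq_zero
      intro i _
      rw [hκ]; simp [hh]
  rw [hzero]
  exact (intLattice ι).zero_mem

set_option maxHeartbeats 1000000 in
/-- Inverse Littlewood-Offord theorem with a common denominator. -/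
lemma exists_common_denominator (C : ℕ) : ∃ r K t₀ : ℕ, ∀ t, t₀ ≤ t → ∀ (ι : Type) [Fintype ι]
    [DecidableEq ι] (v : ι → ℝ) (a : ℝ),
    1 ≤ ((2 : ℝ) ^ t) ^ C * pr (fun η : ι → Bool => ∑ i, sgz (η i) • v i = a) →
    ∃ (E W : Finset ι) (k : ℕ) (c : ι → ι → ℤ), E.card ≤ (2 ^ t) ^ 2 ∧ W.card ≤ r ∧ 0 < k ∧
      k ≤ (2 ^ t) ^ K ∧ (∀ i h, |c i h| ≤ ((2 ^ t) ^ K : ℕ)) ∧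
      ∀ i ∉ E, (k : ℝ) * v i = ∑ h ∈ W, (c i h : ℝ) * v h := by
  set r := 2 * C + 1 with hr
  set K := scale C r with hK
  set A := C * (4 + 2 * K) + 1 + r with hA
  obtain ⟨t₀, ht₀⟩ := exists_mul_le_two_pow A
  refine ⟨r, K, max 1 t₀, fun t ht ι _ _ v a hρ => ?_⟩
  have ht1 : 1 ≤ t := (le_max_left _ _).trans ht
  have hAt := ht₀ t ((le_max_right _ _).trans ht)
  set ρ := pr (fun η : ι → Bool => ∑ i, sgz (η i) • v i = a) with hρdef
  set m := 2 ^ t with hm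
  have hmR : ((2 : ℝ) ^ t) = m := by rw [hm]; norm_cast
  rw [hmR] at hρ
  obtain ⟨h, hh⟩ : ∃ h, m = 2 * h := ⟨2 ^ (t - 1), by
    rw [← pow_succ', Nat.sub_add_cancel ht1]⟩
  have hm0 : 0 < m := pow_pos two_pos t
  have hh1 : 1 ≤ h := by omega
  have hm2 : 2 ≤ m := by omega
  have hrm : r ≤ m := by nlinarith
  have hpos : (0 : ℝ) < (m : ℝ) ^ C := by positivity
  have hρ0 : 0 < ρ := by
    by_contra! hn
    nlinarith
  obtain ⟨E, hE, hblock⟩ := exists_exceptional_blocks v (fun j => if j = 0 then {a} else {0})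
    (by
      intro j x y hx hy
      by_cases hj : j = 0
      · simp only [hj, if_true, Set.mem_singleton_iff] at hx hy
        simp [hx, hy]
      · simp only [if_neg hj, Set.mem_singleton_iff] at hx hy
        simp [hx, hy]) t ht1 ρ (by simp [hρdef]) hρ0 m
  simp only [if_neg (show t ≠ 0 by omega), ← hm] at hblock hE
  set V := Finset.univ \ E with hV
  have hVE : ∀ B ⊆ V, B.card ≤ m → ρ ≤ mass {0} (∏ i ∈ B, step (v i) ^ (2 * h)) := by
    intro B hB hBm
    rw [← hh]
    refine hblock B ?_ hBm
    exact Finset.disjoint_of_subset_left hB Finset.sdiff_disjoint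
  have hρh : 1 ≤ (2 * h : ℝ) ^ C * ρ := by
    rw [hh] at hρ; push_cast at hρ; exact hρ
  obtain ⟨W, hWV, l, hlK, hWr, hWd, hsK, hWn⟩ := exists_dissoc_scale (v := v) (V := V) (C := C)
    (m := m) (r := r) (by
      intro W hW hc hd
      have h1 := hVE W hW (by omega)
      rw [pow_one, hh] at hd
      have := card_le_of_mass hh1 hρh (h1.trans hd.mass_le)
      omega) r ∅ (Finset.empty_subset _) (by simp) (fun s _ _ i hi => absurd hi (by simp))
  set D := 4 + 2 * l with hD
  have hlS : l ≤ scaleStep C l := by simp only [scaleStep]; nlinarith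
  have hrel : ∀ i, ∃ (q : ℕ) (p : ι → ℤ), i ∈ V → 0 < q ∧ q ≤ m ^ l ∧ (∀ h ∈ W, |p h| ≤ (m ^ l : ℕ)) ∧
      (q : ℝ) * v i = ∑ h ∈ W, (p h : ℝ) * v h ∧ (i ∈ W → q = 1) := by
    intro i
    by_cases hiV : i ∈ V
    · by_cases hiW : i ∈ W
      · refine ⟨1, Pi.single i 1, fun _ => ⟨one_pos, Nat.one_le_pow _ _ hm0, ?_, ?_, fun _ => rfl⟩⟩
        · intro h _
          have h1 : (1 : ℤ) ≤ (m ^ l : ℕ) := by exact_mod_cast Nat.one_le_pow _ _ hm0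
          by_cases hhi : h = i
          · subst hhi; simpa using h1
          · rw [Pi.single_eq_of_ne hhi]; simp
        · rw [Finset.sum_eq_single_of_mem i hiW]
          · simp
          · intro j _ hj
            rw [Pi.single_eq_of_ne hj]; simp
      · obtain ⟨q, p, h1, h2, h3, h4⟩ := exists_relation_of_not_dissoc
          (Nat.pow_le_pow_right hm0 hlS) hiW hWd (hWn i hiV hiW)
        exact ⟨q, p, fun _ => ⟨h1, h2, fun h _ => h3 h, h4, fun h => absurd h hiW⟩⟩
    · exact ⟨0, 0, fun h => absurd h hiV⟩
  choose q p hqp using hrel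
  set κ : ι → ι → ℚ := fun i h => if h ∈ W then (p i h : ℚ) / q i else 0 with hκ
  have hqκ : ∀ i ∈ V, q i • κ i ∈ intLattice ι := by
    intro i hi h
    by_cases hh : h ∈ W
    · refine ⟨p i h, ?_⟩
      have : (q i : ℚ) ≠ 0 := by exact_mod_cast (hqp i hi).1.ne'
      simp only [hκ, Pi.smul_apply, nsmul_eq_mul, if_pos hh]
      field_simp
    · exact ⟨0, by simp [hκ, hh]⟩
  have hκW : ∀ i ∈ W, κ i ∈ intLattice ι := by
    intro i hi
    have h1 := hqκ i (hWV hi)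
    rwa [(hqp i (hWV hi)).2.2.2.2 hi, one_smul] at h1
  set Q := m ^ (C * D + 1) with hQ
  have hQ0 : 1 < Q := Nat.one_lt_pow (by omega) (by omega)
  obtain ⟨B, hBmem, hBmax⟩ := Finset.exists_max_image
    ((Finset.univ : Finset (Finset ι)).filter fun B => B ⊆ V ∧ ∃ k, k < Q ∧
      GoodBlock h D κ W.card B k) Finset.card ⟨W, by
        simp only [Finset.mem_filter, Finset.mem_univ, true_and]
        exact ⟨hWV, 1, hQ0, goodBlock_start h D hκW⟩⟩
  simp only [Finset.mem_filter, Finset.mem_univ, true_and] at hBmem hBmax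
  obtain ⟨hBV, k, hkQ, hBk⟩ := hBmem
  have hall : ∀ i ∈ V, κ i ∈ latticeSpan κ B := by
    by_contra! hex
    obtain ⟨i, hiV, hi⟩ := hex
    obtain ⟨q', hq', hB'⟩ := exists_goodBlock_insert hh1 hD hBk hi (hqp i hiV).1
      (by rw [← hh]; exact (hqp i hiV).2.1) (hqκ i hiV)
    have hiB : i ∉ B := fun h => hi (mem_latticeSpan h)
    have hB'V : insert i B ⊆ V := Finset.insert_subset hiV hBV
    have hk' : Q ≤ k * q' := by
      by_contra! hlt
      have := hBmax (insert i B) ⟨hB'V, k * q', hlt, hB'⟩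
      rw [Finset.card_insert_of_notMem hiB] at this
      omega
    have hcardB : B.card < t * (C * D + 1) + r := by
      have h1 : 2 ^ B.card < 2 ^ (t * (C * D + 1) + r) := by
        calc 2 ^ B.card ≤ k * 2 ^ W.card := hBk.2.2.2
          _ < Q * 2 ^ W.card := Nat.mul_lt_mul_of_pos_right hkQ (by positivity)
          _ ≤ Q * 2 ^ r := Nat.mul_le_mul_left _ (Nat.pow_le_pow_right two_pos hWr)
          _ = _ := by rw [hQ, hm, ← pow_mul, ← pow_add]
      exact (Nat.pow_lt_pow_iff_right (by norm_num)).mp h1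
    have hDK : C * D ≤ C * (4 + 2 * K) := Nat.mul_le_mul_left _ (by omega)
    have hcard : (insert i B).card ≤ m := by
      rw [Finset.card_insert_of_notMem hiB]
      have : t * (C * D + 1) + r ≤ A * t := by
        rw [hA]; nlinarith
      omega
    have h1 := hVE _ hB'V hcard
    have hN : (insert i B).card * h * (k * q' * m ^ l) ≤ m ^ scaleStep C l := by
      have e : m ^ scaleStep C l = m * m * (Q * m ^ l * m ^ l) * 1 := by
        rw [hQ]; simp only [scaleStep]; ring
      rw [e, mul_one]
      have hhm : h ≤ m := by omega
      have hq'' : q' ≤ m ^ l := by rw [hh]; exact hq'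
      gcongr
    have h2 := mass_step_le_mass_binStep (insert i B) h v κ (intLattice ι : Set (ι → ℚ))
      (fun s hs h0 => sum_mem_intLattice hB'V (fun i hi => (hqp i hi).1)
        (fun i hi => (hqp i hi).2.2.1) (fun i hi => (hqp i hi).2.2.2.1) hB'.1 hκ
        (fun i hi => hB'.2.1 _ (mem_latticeSpan hi)) hWd hN s hs h0)
    have h3 := hB'.2.2.1 0
    simp only [sub_zero] at h3
    have h4 : ρ ≤ mass {y | y ∈ intLattice ι} (∏ i ∈ insert i B, binStep h (κ i)) := h1.trans h2
    set x := mass {y | y ∈ intLattice ι} (∏ i ∈ insert i B, binStep h (κ i)) with hx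
    have hx0 : 0 < x := hρ0.trans_le h4
    have h5 : 1 ≤ ((m : ℝ) ^ C * x) ^ D := one_le_pow₀ (hρ.trans (by gcongr))
    have h6 : ((m : ℝ) ^ C * x) ^ D * m = x ^ D * Q := by
      rw [hQ]; push_cast; ring
    have h7 : x ^ D * (Q : ℝ) ≤ x ^ D * ((k * q' : ℕ) : ℝ) := by
      gcongr
    have h8 : (2 : ℝ) ≤ m := by exact_mod_cast hm2
    nlinarith
  have hz : ∀ i h, ∃ z : ℤ, (i ∈ V → h ∈ W → (z : ℤ) * q i = k * p i h) ∧ |z| ≤ (m ^ K : ℕ) := by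
    intro i h
    by_cases hc : i ∈ V ∧ h ∈ W
    · obtain ⟨hi, hhW⟩ := hc
      obtain ⟨z, hz⟩ := hBk.2.1 _ (hall i hi) h
      have hq0 : (q i : ℚ) ≠ 0 := by exact_mod_cast (hqp i hi).1.ne'
      have hzq : z * q i = k * p i h := by
        have : (z : ℚ) * q i = k * p i h := by
          rw [← hz, hκ]
          simp only [Pi.smul_apply, nsmul_eq_mul, if_pos hhW]
          field_simp
        exact_mod_cast this
      refine ⟨z, fun _ _ => hzq, ?_⟩
      have h1 : |z| * q i = k * |p i h| := by
        have := congrArg abs hzq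
        simpa [abs_mul] using this
      have h2 : (1 : ℤ) ≤ q i := by exact_mod_cast (hqp i hi).1
      have h3 := (hqp i hi).2.2.1 h hhW
      have h4 : |z| ≤ k * (m ^ l : ℕ) := by
        nlinarith [abs_nonneg z, abs_nonneg (p i h)]
      have h5 : k * m ^ l ≤ m ^ K := by
        calc k * m ^ l ≤ Q * m ^ l := Nat.mul_le_mul_right _ hkQ.le
          _ = m ^ (C * D + 1 + l) := by rw [hQ, ← pow_add]
          _ ≤ m ^ K := Nat.pow_le_pow_right hm0 (by
              refine le_trans ?_ hsK
              simp only [scaleStep, hD]; omega)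
      exact h4.trans (by exact_mod_cast h5)
    · exact ⟨0, fun h1 h2 => absurd ⟨h1, h2⟩ hc, by simp⟩
  choose c hc1 hc2 using hz
  refine ⟨E, W, k, c, by rw [pow_two]; exact hE, hWr, hBk.1, ?_, hc2, ?_⟩
  · refine hkQ.le.trans (Nat.pow_le_pow_right hm0 ?_)
    refine le_trans ?_ hsK
    simp only [scaleStep, hD]; omega
  · intro i hi
    have hiV : i ∈ V := by simp [hV, hi]
    have hq0 : (q i : ℝ) ≠ 0 := by exact_mod_cast (hqp i hiV).1.ne'
    apply mul_left_cancel₀ hq0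
    calc (q i : ℝ) * (k * v i) = k * ((q i : ℝ) * v i) := by ring
      _ = ∑ h ∈ W, (k * p i h : ℝ) * v h := by
        rw [(hqp i hiV).2.2.2.1, Finset.mul_sum]
        exact Finset.sum_congr rfl fun h _ => by ring
      _ = ∑ h ∈ W, (c i h * q i : ℝ) * v h := by
        refine Finset.sum_congr rfl fun h hh => ?_
        have h3 : ((c i h : ℝ)) * q i = k * p i h := by exact_mod_cast hc1 i h hiV hh
        rw [h3]
      _ = _ := by
        rw [Finset.mul_sum]
        exact Finset.sum_congr rfl fun h _ => by ring

end

/-! Decoupling -/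

section Decoupling
variable {ι : Type} [Fintype ι] [DecidableEq ι]

/-- The lazy sign vector: the signs `ξ` on the random set `D`, and zero elsewhere. -/
def lazyv (D ξ : ι → Bool) (j : ι) : ℝ := if D j then (sgz (ξ j) : ℝ) else 0

/-- A quadratic polynomial evaluated at a sign vector. -/
def quad (M : ι → ι → ℝ) (l : ι → ℝ) (x : ι → Bool) : ℝ :=
  ∑ i, ∑ j, M i j * (sgz (x i) : ℝ) * (sgz (x j) : ℝ) + ∑ i, l i * (sgz (x i) : ℝ)

/-- The change of variables between a pair of sign vectors (and an auxiliary one) and the triple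
consisting of their disagreement set and the signs on it and off it. -/
def mixEquiv (ι : Type) : (ι → Bool) × (ι → Bool) × (ι → Bool) ≃
    (ι → Bool) × (ι → Bool) × (ι → Bool) where
  toFun p := (fun i => if p.1 i then p.2.1 i else p.2.2 i,
    fun i => if p.1 i then !p.2.1 i else p.2.2 i, fun i => if p.1 i then p.2.2 i else p.2.1 i)
  invFun q := (fun i => xor (q.1 i) (q.2.1 i), fun i => if xor (q.1 i) (q.2.1 i) then q.1 i else q.2.2 i,
    fun i => if xor (q.1 i) (q.2.1 i) then q.2.2 i else q.1 i)
  left_inv := by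
    rintro ⟨d, s, e⟩
    refine Prod.ext ?_ (Prod.ext ?_ ?_) <;> funext i <;> simp only <;>
      cases d i <;> cases s i <;> cases e i <;> rfl
  right_inv := by
    rintro ⟨d, s, e⟩
    refine Prod.ext ?_ (Prod.ext ?_ ?_) <;> funext i <;> simp only <;>
      cases d i <;> cases s i <;> cases e i <;> rfl

lemma pr_fst {Ω Ω' : Type*} [Fintype Ω] [Fintype Ω'] [Nonempty Ω'] (p : Ω → Prop) :
    pr (fun z : Ω × Ω' => p z.1) = pr p := by
  rw [pr_prod]
  unfold pr
  simp only [avg_const]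

lemma pr_pair_eq_mix (P : (ι → Bool) → (ι → Bool) → Prop) :
    pr (fun q : (ι → Bool) × (ι → Bool) => P q.1 q.2) =
      pr fun p : (ι → Bool) × (ι → Bool) × (ι → Bool) =>
        P (fun i => if p.1 i then p.2.1 i else p.2.2 i)
          (fun i => if p.1 i then !p.2.1 i else p.2.2 i) := by
  have h1 := pr_equiv (mixEquiv ι) (fun q => P q.1 q.2.1)
  have h2 := pr_equiv (Equiv.prodAssoc (ι → Bool) (ι → Bool) (ι → Bool)) (fun q => P q.1 q.2.1)
  have h3 := pr_fst (Ω' := ι → Bool) (fun q : (ι → Bool) × (ι → Bool) => P q.1 q.2)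
  exact (h3.symm.trans h2).trans h1.symm

lemma sgz_mix_left (d s e : Bool) : ((sgz (if d then s else e) : ℤ) : ℝ) =
    (if d then 0 else (sgz e : ℝ)) + (if d then (sgz s : ℝ) else 0) := by
  cases d <;> simp

lemma sgz_mix_right (d s e : Bool) : ((sgz (if d then !s else e) : ℤ) : ℝ) =
    (if d then 0 else (sgz e : ℝ)) - (if d then (sgz s : ℝ) else 0) := by
  cases d <;> cases s <;> simp [sgz]

/-- Decoupling of a quadratic polynomial. -/
lemma pr_quad_sq_le (M : ι → ι → ℝ) (hM : ∀ i j, M i j = M j i) (l : ι → ℝ) (a : ℝ) :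
    (pr fun x => quad M l x = a) ^ 2 ≤ pr fun p : (ι → Bool) × (ι → Bool) × (ι → Bool) =>
      ∑ i, sgz (p.2.2 i) • (if p.1 i then 0 else ∑ j, M i j * lazyv p.1 p.2.1 j) =
        -(∑ i, l i * lazyv p.1 p.2.1 i) / 2 := by
  have h1 : (pr fun x => quad M l x = a) ^ 2 ≤
      pr fun q : (ι → Bool) × (ι → Bool) => quad M l q.1 = quad M l q.2 := by
    have : (pr fun x => quad M l x = a) ^ 2 =
        pr fun q : (ι → Bool) × (ι → Bool) => quad M l q.1 = a ∧ quad M l q.2 = a := by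
      rw [pr_prod, pow_two]
      conv_lhs => rhs; unfold pr
      rw [← avg_mul_left]
      congr 1
      funext x
      by_cases hx : quad M l x = a
      · simp [hx, ind]
      · simp [hx, ind, pr, avg]
    rw [this]
    exact pr_mono fun q hq => hq.1.trans hq.2.symm
  refine h1.trans ?_
  rw [pr_pair_eq_mix (fun x y => quad M l x = quad M l y)]
  apply pr_mono
  rintro ⟨D, ξ, η⟩ h
  simp only [quad, sgz_mix_right] at h ⊢
  simp only [sgz_mix_left] at h
  set u : ι → ℝ := fun i => if D i then 0 else (sgz (η i) : ℝ) with hu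
  have hw : ∀ i, (if D i then (sgz (ξ i) : ℝ) else 0) = lazyv D ξ i := fun i => rfl
  simp only [hw] at h
  have hu' : ∀ i, (if D i then 0 else (sgz (η i) : ℝ)) = u i := fun i => rfl
  simp only [hu'] at h
  have e1 : ∑ i, sgz (η i) • (if D i then 0 else ∑ j, M i j * lazyv D ξ j) =
      ∑ i, ∑ j, M i j * u i * lazyv D ξ j := by
    apply Finset.sum_congr rfl
    intro i _
    simp only [hu]
    split_ifs
    · simp
    · rw [zsmul_eq_mul, Finset.mul_sum]
      exact Finset.sum_congr rfl fun j _ => by ring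
  have e2 : ∑ i, ∑ j, M i j * u i * lazyv D ξ j = ∑ i, ∑ j, M i j * lazyv D ξ i * u j := by
    rw [Finset.sum_comm]
    exact Finset.sum_congr rfl fun j _ => Finset.sum_congr rfl fun i _ => by rw [hM i j]; ring
  rw [e1]
  have e3 : ∑ i, ∑ j, M i j * (u i + lazyv D ξ i) * (u j + lazyv D ξ j) -
      ∑ i, ∑ j, M i j * (u i - lazyv D ξ i) * (u j - lazyv D ξ j) =
      2 * (∑ i, ∑ j, M i j * u i * lazyv D ξ j) + 2 * ∑ i, ∑ j, M i j * lazyv D ξ i * u j := by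
    simp only [Finset.mul_sum, ← Finset.sum_sub_distrib, ← Finset.sum_add_distrib]
    exact Finset.sum_congr rfl fun j _ => Finset.sum_congr rfl fun i _ => by ring
  have e4 : ∑ i, l i * (u i + lazyv D ξ i) - ∑ i, l i * (u i - lazyv D ξ i) =
      2 * ∑ i, l i * lazyv D ξ i := by
    simp only [Finset.mul_sum, ← Finset.sum_sub_distrib]
    exact Finset.sum_congr rfl fun i _ => by ring
  rw [← e2] at e3
  linarith

/-- Concentration of a lazy linear form implies concentration of the linear form. -/
lemma exists_pr_lazy_le (B : ι → ℝ) : ∃ a : ℝ,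
    (pr fun p : (ι → Bool) × (ι → Bool) => ∑ j, B j * lazyv p.1 p.2 j = 0) ≤
      pr fun x : ι → Bool => ∑ j, sgz (x j) • B j = a := by
  have h2 := pr_equiv (Equiv.prodAssoc (ι → Bool) (ι → Bool) (ι → Bool))
    (fun q => ∑ j, B j * lazyv q.1 q.2.1 j = 0)
  have h3 := pr_fst (Ω' := ι → Bool)
    (fun p : (ι → Bool) × (ι → Bool) => ∑ j, B j * lazyv p.1 p.2 j = 0)
  have h4 : (pr fun p : (ι → Bool) × (ι → Bool) => ∑ j, B j * lazyv p.1 p.2 j = 0) ≤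
      pr fun q : (ι → Bool) × (ι → Bool) =>
        ∑ j, sgz (q.1 j) • B j = ∑ j, sgz (q.2 j) • B j := by
    rw [pr_pair_eq_mix (fun x y => ∑ j, sgz (x j) • B j = ∑ j, sgz (y j) • B j), ← h3]
    refine (h2.le).trans (pr_mono ?_)
    rintro ⟨D, ξ, η⟩ h
    simp only [zsmul_eq_mul, sgz_mix_right] at h ⊢
    simp only [sgz_mix_left]
    rw [← sub_eq_zero, ← Finset.sum_sub_distrib]
    refine Eq.trans (b := 2 * ∑ j, B j * lazyv D ξ j) ?_ (by rw [h, mul_zero])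
    rw [Finset.mul_sum]
    refine Finset.sum_congr rfl fun j _ => ?_
    rw [lazyv]; ring
  rw [pr_prod_swap fun q : (ι → Bool) × (ι → Bool) =>
    ∑ j, sgz (q.1 j) • B j = ∑ j, sgz (q.2 j) • B j] at h4
  obtain ⟨y, hy⟩ := exists_avg_le fun y : ι → Bool => pr fun x : ι → Bool =>
    ∑ j, sgz (x j) • B j = ∑ j, sgz (y j) • B j
  exact ⟨_, h4.trans hy⟩

end Decoupling

/-! Linear relations between the rows -/

lemma card_filter_card_le {ι : Type} [Fintype ι] [DecidableEq ι] (r : ℕ) :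
    (Finset.univ.filter fun W : Finset ι => W.card ≤ r).card ≤ (Fintype.card ι + 1) ^ r := by
  induction r with
  | zero => simp [Finset.filter_eq']
  | succ r ih =>
    have hsub : (Finset.univ.filter fun W : Finset ι => W.card ≤ r + 1) ⊆
        ((Finset.univ.filter fun W : Finset ι => W.card ≤ r) ×ˢ (Finset.univ : Finset (Option ι))).image
          fun z => z.2.elim z.1 fun i => Insert.insert i z.1 := by
      intro W hW
      simp only [Finset.mem_filter, Finset.mem_univ, true_and] at hW
      rw [Finset.mem_image]
      rcases W.eq_empty_or_nonempty with rfl | ⟨i, hi⟩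
      · exact ⟨(∅, none), by simp, rfl⟩
      · refine ⟨(W.erase i, some i), ?_, Finset.insert_erase hi⟩
        simp only [Finset.mem_product, Finset.mem_filter, Finset.mem_univ, true_and, and_true]
        rw [Finset.card_erase_of_mem hi]; omega
    calc _ ≤ _ := Finset.card_le_card hsub
      _ ≤ _ := Finset.card_image_le
      _ ≤ (Fintype.card ι + 1) ^ r * (Fintype.card ι + 1) := by
          rw [Finset.card_product, Finset.card_univ, Fintype.card_option]
          exact Nat.mul_le_mul_right _ ih
      _ = _ := (pow_succ _ _).symm

/-- The number of candidates `W` is polynomially bounded. -/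
lemma card_filter_card_le_pow {ι : Type} [Fintype ι] [DecidableEq ι] (r : ℕ) {m e : ℕ} (hm : 2 ≤ m)
    (hn : Fintype.card ι ≤ m ^ e) :
    (Finset.univ.filter fun W : Finset ι => W.card ≤ r).card ≤ m ^ ((e + 1) * r) := by
  refine (card_filter_card_le r).trans ?_
  rw [pow_mul]
  refine Nat.pow_le_pow_left ?_ r
  have : 1 ≤ m ^ e := Nat.one_le_pow _ _ (by omega)
  rw [pow_succ]; nlinarith

lemma exists_row_relations (C e : ℕ) : ∃ r K C' t₀ : ℕ, ∀ t, t₀ ≤ t → ∀ (ι : Type) [Fintype ι]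
    [DecidableEq ι], Fintype.card ι ≤ (2 ^ t) ^ e → ∀ (M : ι → ι → ℝ) (l : ι → ℝ) (a : ℝ),
    (∀ i j, M i j = M j i) → 1 ≤ ((2 : ℝ) ^ t) ^ C * pr (fun x => quad M l x = a) →
    ∃ (W : Finset ι) (k : ℕ) (E : (ι → Bool) × (ι → Bool) → Finset ι), W.card ≤ r ∧ 0 < k ∧
      k ≤ (2 ^ t) ^ K ∧ (∀ ω, (E ω).card ≤ (2 ^ t) ^ 2) ∧
      1 ≤ ((2 : ℝ) ^ t) ^ C' * pr fun ω : (ι → Bool) × (ι → Bool) =>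
        ∀ i ∉ E ω, ω.1 i = false → ∃ c : ι → ℤ, (∀ h, |c h| ≤ ((2 ^ t) ^ K : ℕ)) ∧
          (k : ℝ) * ∑ j, M i j * lazyv ω.1 ω.2 j =
            ∑ h ∈ W, (c h : ℝ) * ∑ j, M h j * lazyv ω.1 ω.2 j := by
  obtain ⟨r, K, t₀, hA⟩ := exists_common_denominator (2 * C + 1)
  refine ⟨r, K, (2 * C + 1) + ((e + 1) * r + K), t₀ + 1, fun t ht ι _ _ hn M l a hM hC => ?_⟩
  set m : ℕ := 2 ^ t with hm
  have hm2 : 2 ≤ m := by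
    calc 2 = 2 ^ 1 := rfl
      _ ≤ m := Nat.pow_le_pow_right two_pos (by omega)
  have hmr : ((2 : ℝ) ^ t) = (m : ℝ) := by rw [hm]; push_cast; rfl
  have hm2r : (2 : ℝ) ≤ m := by exact_mod_cast hm2
  rw [hmr] at hC ⊢
  set ρ := pr fun x => quad M l x = a with hρ
  have hρ0 : 0 < ρ := by
    by_contra! h
    have : (m : ℝ) ^ C * ρ ≤ 0 := mul_nonpos_of_nonneg_of_nonpos (by positivity) h
    linarith
  have hρ2 : 1 ≤ (m : ℝ) ^ (2 * C + 1) * (ρ ^ 2 / 2) := by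
    have h1 : 1 ≤ ((m : ℝ) ^ C * ρ) ^ 2 := one_le_pow₀ hC
    have h2 : (m : ℝ) ^ (2 * C + 1) * (ρ ^ 2 / 2) = ((m : ℝ) ^ C * ρ) ^ 2 * (m / 2) := by ring
    rw [h2]; nlinarith
  have hdec := pr_quad_sq_le M hM l a
  rw [← hρ] at hdec
  have h2 := pr_equiv (Equiv.prodAssoc (ι → Bool) (ι → Bool) (ι → Bool)) (fun p =>
      ∑ i, sgz (p.2.2 i) • (if p.1 i then 0 else ∑ j, M i j * lazyv p.1 p.2.1 j) =
        -(∑ i, l i * lazyv p.1 p.2.1 i) / 2)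
  rw [← h2, pr_prod] at hdec
  set f : (ι → Bool) × (ι → Bool) → ℝ := fun ω => pr fun η : ι → Bool =>
    ∑ i, sgz (η i) • (if ω.1 i then 0 else ∑ j, M i j * lazyv ω.1 ω.2 j) =
        -(∑ i, l i * lazyv ω.1 ω.2 i) / 2 with hf
  have hgood := half_le_pr (f := f) (a := ρ ^ 2 / 2) (fun ω => pr_le_one _) (by positivity)
    (by rw [mul_div_cancel₀ _ two_ne_zero]; exact hdec)
  set q : Finset ι × ℕ → (ι → Bool) × (ι → Bool) → Prop := fun s ω =>
    ∃ F : Finset ι, F.card ≤ m ^ 2 ∧ ∀ i ∉ F, ω.1 i = false → ∃ c : ι → ℤ,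
      (∀ h, |c h| ≤ (m ^ K : ℕ)) ∧ (s.2 : ℝ) * ∑ j, M i j * lazyv ω.1 ω.2 j =
            ∑ h ∈ s.1, (c h : ℝ) * ∑ j, M h j * lazyv ω.1 ω.2 j with hq
  obtain ⟨⟨W, k⟩, hs, hle⟩ := pr_pigeonhole (lt_of_lt_of_le (by positivity) hgood)
    ((Finset.univ.filter fun W : Finset ι => W.card ≤ r) ×ˢ Finset.Icc 1 (m ^ K)) q (by
      rintro ω hω
      obtain ⟨E, W, k, c, hE, hW, hk0, hk, hc, hrel⟩ := hA t (by omega) ι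
        (fun i => if ω.1 i then 0 else ∑ j, M i j * lazyv ω.1 ω.2 j) _ (by
          rw [hmr]
          exact hρ2.trans (mul_le_mul_of_nonneg_left hω (by positivity)))
      refine ⟨(W.filter fun h => ω.1 h = false, k), ?_, E, hE, ?_⟩
      · simp only [Finset.mem_product, Finset.mem_filter, Finset.mem_univ, true_and,
          Finset.mem_Icc]
        exact ⟨(Finset.card_filter_le _ _).trans hW, hk0, hk⟩
      · intro i hi hD
        refine ⟨c i, fun h => hc i h, ?_⟩
        have := hrel i hi
        simp only [hD, Bool.false_eq_true, if_false] at this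
        rw [this, Finset.sum_filter]
        refine Finset.sum_congr rfl fun h _ => ?_
        cases ω.1 h <;> simp)
  simp only [Finset.mem_product, Finset.mem_filter, Finset.mem_univ, true_and,
          Finset.mem_Icc] at hs
  refine ⟨W, k, fun ω => if h : q (W, k) ω then h.choose else ∅, hs.1, hs.2.1, hs.2.2, ?_, ?_⟩
  · intro ω
    beta_reduce
    split_ifs with h
    · exact h.choose_spec.1
    · simp
  · have hmono : pr (q (W, k)) ≤ pr fun ω : (ι → Bool) × (ι → Bool) =>
        ∀ i ∉ (if h : q (W, k) ω then h.choose else ∅), ω.1 i = false →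
          ∃ c : ι → ℤ, (∀ h, |c h| ≤ (m ^ K : ℕ)) ∧
          (k : ℝ) * ∑ j, M i j * lazyv ω.1 ω.2 j =
            ∑ h ∈ W, (c h : ℝ) * ∑ j, M h j * lazyv ω.1 ω.2 j := by
      apply pr_mono
      intro ω h
      rw [dif_pos h]
      exact h.choose_spec.2
    refine le_trans ?_ (mul_le_mul_of_nonneg_left hmono (by positivity))
    have hcard : (((Finset.univ.filter fun W : Finset ι => W.card ≤ r) ×ˢ
        Finset.Icc 1 (m ^ K)).card : ℝ) ≤ (m : ℝ) ^ ((e + 1) * r + K) := by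
      rw [Finset.card_product, Nat.card_Icc, pow_add]
      have := card_filter_card_le_pow (ι := ι) r hm2 hn
      exact_mod_cast Nat.mul_le_mul this (by omega)
    calc (1 : ℝ) ≤ (m : ℝ) ^ (2 * C + 1) * (ρ ^ 2 / 2) := hρ2
      _ ≤ (m : ℝ) ^ (2 * C + 1) * ((m : ℝ) ^ ((e + 1) * r + K) * pr (q (W, k))) := by
        refine mul_le_mul_of_nonneg_left ?_ (by positivity)
        exact hgood.trans (hle.trans (mul_le_mul_of_nonneg_right hcard (pr_nonneg _)))
      _ = _ := by ring

/-! Freezing coordinates, and covering almost all coordinates -/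

section Cover
variable {ι : Type} [Fintype ι] [DecidableEq ι]

/-- The vector agreeing with `x` on `S` and with `y` off `S`. -/
def glue {α : Type} (S : Finset ι) (x y : ι → α) (i : ι) : α := if i ∈ S then x i else y i

lemma glue_of_notMem {α : Type} {S : Finset ι} {i : ι} (h : i ∉ S) (x y : ι → α) :
    glue S x y i = y i := if_neg h

/-- Exchanging the coordinates off `S`. -/
def glueEquiv (α : Type) (S : Finset ι) : (ι → α) × (ι → α) ≃ (ι → α) × (ι → α) where
  toFun p := (glue S p.1 p.2, glue S p.2 p.1)
  invFun p := (glue S p.1 p.2, glue S p.2 p.1)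
  left_inv := by
    rintro ⟨x, y⟩
    refine Prod.ext ?_ ?_ <;> funext i <;> simp only [glue] <;> split_ifs <;> rfl
  right_inv := by
    rintro ⟨x, y⟩
    refine Prod.ext ?_ ?_ <;> funext i <;> simp only [glue] <;> split_ifs <;> rfl

lemma exists_pr_le_glue {α : Type} [Fintype α] [Nonempty α] (S : Finset ι) (p : (ι → α) → Prop) :
    ∃ x, pr p ≤ pr fun y => p (glue S x y) := by
  have h1 := pr_equiv (glueEquiv α S) (fun q => p q.1)
  rw [pr_fst, pr_prod] at h1
  rw [← h1]
  exact exists_avg_le _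

lemma exists_pr_le_glue_pair (S : Finset ι) (p : (ι → Bool) × (ι → Bool) → Prop) :
    ∃ x y, pr p ≤ pr fun ω : (ι → Bool) × (ι → Bool) => p (glue S x ω.1, glue S y ω.2) := by
  let e := Equiv.arrowProdEquivProdArrow ι (fun _ => Bool) (fun _ => Bool)
  obtain ⟨z, hz⟩ := exists_pr_le_glue S (fun z => p (e z))
  rw [pr_equiv e p] at hz
  refine ⟨(e z).1, (e z).2, hz.trans ?_⟩
  rw [← pr_equiv e]
  apply pr_mono
  intro y hy
  convert hy using 1
  refine Prod.ext ?_ ?_ <;> funext i <;> simp only [glue, e] <;> split_ifs with h <;>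
    simp [Equiv.arrowProdEquivProdArrow, glue, h]

lemma avg_prod_apply (g : ι → Bool → ℝ) :
    avg (fun D : ι → Bool => ∏ i, g i (D i)) = ∏ i, (g i true + g i false) / 2 := by
  unfold avg
  have h := Finset.prod_univ_sum (fun _ : ι => (Finset.univ : Finset Bool)) g
  rw [Fintype.piFinset_univ] at h
  rw [← h, Finset.prod_div_distrib, Finset.prod_const, Fintype.card_fun, Fintype.card_bool]
  simp

/-- A lower tail bound for the number of coordinates in `J` at which a random sign vector takes
the value `β`. -/
lemma pr_card_lt_le (J : Finset ι) (β : Bool) (N : ℕ) (hJ : J.card = 16 * N) :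
    (pr fun D : ι → Bool => (J.filter fun i => D i = β).card < 4 * N) * 4 ^ N ≤ 1 := by
  have h1 : (pr fun D : ι → Bool => (J.filter fun i => D i = β).card < 4 * N) ≤
      avg fun D : ι → Bool => 2 ^ (4 * N) *
        ∏ i, (fun i b => if i ∈ J ∧ b = β then (1 / 2 : ℝ) else 1) i (D i) := by
    unfold pr
    apply avg_mono
    intro D
    have hprod : (∏ i, if i ∈ J ∧ D i = β then (1 / 2 : ℝ) else 1) =
        (1 / 2) ^ (J.filter fun i => D i = β).card := by
      rw [← Finset.prod_filter, Finset.prod_const]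
      congr 2
      ext i; simp
    beta_reduce
    rw [hprod]
    by_cases h : (J.filter fun i => D i = β).card < 4 * N
    · rw [ind_true h, one_div, inv_pow, ← div_eq_mul_inv, le_div_iff₀ (by positivity), one_mul]
      exact pow_le_pow_right₀ (by norm_num) h.le
    · rw [ind_false h]; positivity
  have h2 : (avg fun D : ι → Bool => 2 ^ (4 * N) *
        ∏ i, (fun i b => if i ∈ J ∧ b = β then (1 / 2 : ℝ) else 1) i (D i)) =
      2 ^ (4 * N) * (3 / 4) ^ (16 * N) := by
    rw [avg_mul_left]
    congr 1
    refine (avg_prod_apply fun i b => if i ∈ J ∧ b = β then (1 / 2 : ℝ) else 1).trans ?_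
    have : ∀ i, ((if i ∈ J ∧ true = β then (1 / 2 : ℝ) else 1) +
        (if i ∈ J ∧ false = β then (1 / 2 : ℝ) else 1)) / 2 = if i ∈ J then 3 / 4 else 1 := by
      intro i
      by_cases hi : i ∈ J <;> cases β <;> simp [hi] <;> norm_num
    simp only [this]
    rw [Finset.prod_ite_mem, Finset.univ_inter, Finset.prod_const, hJ]
  rw [h2] at h1
  calc _ ≤ (2 ^ (4 * N) * (3 / 4) ^ (16 * N)) * (4 : ℝ) ^ N :=
        mul_le_mul_of_nonneg_right h1 (by positivity)
    _ = (2 ^ 4 * (3 / 4) ^ 16 * 4 : ℝ) ^ N := by rw [pow_mul, pow_mul, ← mul_pow, ← mul_pow]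
    _ ≤ 1 := pow_le_one₀ (by positivity) (by norm_num)

/-- All but few coordinates `i` take the value `β` and avoid the exceptional set with substantial
probability within a given event. -/
lemma exists_cover {Ω' : Type*} [Fintype Ω'] [Nonempty Ω'] (p : (ι → Bool) × Ω' → Prop)
    (E : (ι → Bool) × Ω' → Finset ι) (N : ℕ) (β : Bool) (hN : 0 < N)
    (hE : ∀ ω, (E ω).card ≤ N) (hp : 2 < 4 ^ N * pr p) :
    ∃ J : Finset ι, J.card ≤ 16 * N ∧
      ∀ i ∉ J, pr p ≤ 16 * pr fun ω => p ω ∧ ω.1 i = β ∧ i ∉ E ω := by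
  set Bad : Finset ι :=
    Finset.univ.filter fun i => 16 * (pr fun ω => p ω ∧ ω.1 i = β ∧ i ∉ E ω) < pr p with hBad
  by_cases hc : Bad.card ≤ 16 * N
  · exact ⟨Bad, hc, fun i hi => by simpa [hBad] using hi⟩
  exfalso
  obtain ⟨J, hJB, hJ⟩ := Finset.exists_subset_card_eq (not_le.mp hc).le
  have hlt : ∑ i ∈ J, 16 * (pr fun ω => p ω ∧ ω.1 i = β ∧ i ∉ E ω) ≤ ∑ _i ∈ J, pr p := by
    apply Finset.sum_le_sum
    intro i hi
    have := hJB hi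
    simp only [hBad, Finset.mem_filter, Finset.mem_univ, true_and] at this
    exact this.le
  rw [Finset.sum_const, nsmul_eq_mul, hJ, ← Finset.mul_sum] at hlt
  have htail := pr_card_lt_le J β N hJ
  set T : (ι → Bool) → Prop := fun D => (J.filter fun i => D i = β).card < 4 * N with hT
  have h1 : 3 * (N : ℝ) * pr p ≤ (∑ i ∈ J, pr fun ω => p ω ∧ ω.1 i = β ∧ i ∉ E ω) +
      3 * N * pr T := by
    rw [← pr_fst (Ω' := Ω') T]
    unfold pr
    rw [← avg_sum, ← avg_mul_left, ← avg_mul_left, ← avg_add]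
    apply avg_mono
    intro ω
    have hnn : 0 ≤ ∑ i ∈ J, ind (p ω ∧ ω.1 i = β ∧ i ∉ E ω) :=
      Finset.sum_nonneg fun _ _ => ind_nonneg _
    by_cases hpω : p ω
    · by_cases hTω : T ω.1
      · rw [ind_true hpω, ind_true hTω]; linarith
      · rw [ind_true hpω, ind_false hTω, mul_one, mul_zero, add_zero]
        have hsum : ∑ i ∈ J, ind (p ω ∧ ω.1 i = β ∧ i ∉ E ω) =
            (((J.filter fun i => ω.1 i = β) \ E ω).card : ℝ) := by
          have : (J.filter fun i => ω.1 i = β) \ E ω =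
              J.filter fun i => p ω ∧ ω.1 i = β ∧ i ∉ E ω := by
            ext i; simp [hpω, and_assoc]
          rw [this, Finset.card_filter]
          push_cast
          exact Finset.sum_congr rfl fun i _ => by unfold ind; congr
        rw [hsum]
        have h2 := Finset.le_card_sdiff (E ω) (J.filter fun i => ω.1 i = β)
        have h3 : 4 * N ≤ (J.filter fun i => ω.1 i = β).card := not_lt.mp hTω
        have h4 := hE ω
        have : 3 * N ≤ ((J.filter fun i => ω.1 i = β) \ E ω).card := by omega
        exact_mod_cast this
    · rw [ind_false hpω, mul_zero]
      exact add_nonneg hnn (mul_nonneg (by positivity) (ind_nonneg _))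
  have hN0 : (0 : ℝ) < N := by exact_mod_cast hN
  push_cast at hlt
  have h5 : (3 : ℝ) * N * pr p ≤ N * pr p + 3 * N * pr T := by linarith
  have h6 : 2 * pr p ≤ 3 * pr T := by nlinarith
  have h7 : (0 : ℝ) < 4 ^ N := by positivity
  nlinarith
end Cover

/-! Integer boxes, and bookkeeping of polynomial bounds -/

/-- `v` is a combination of the elements of `G` with integer coefficients of size at most `L`. -/
def Box (G : Finset ℝ) (L : ℕ) (v : ℝ) : Prop :=
  ∃ p : ℝ → ℤ, (∀ g, |p g| ≤ L) ∧ v = ∑ g ∈ G, (p g : ℝ) * g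

namespace Box
variable {G G' : Finset ℝ} {L L' : ℕ} {v w : ℝ}

lemma mono (h : Box G L v) (hG : G ⊆ G') (hL : L ≤ L') : Box G' L' v := by
  obtain ⟨p, hp, hv⟩ := h
  refine ⟨fun g => if g ∈ G then p g else 0, fun g => ?_, ?_⟩
  · have : |p g| ≤ L' := (hp g).trans (by exact_mod_cast hL)
    beta_reduce
    split_ifs
    · exact this
    · simp
  · rw [hv, ← Finset.sum_subset hG (fun g _ hg => by simp [hg])]
    exact Finset.sum_congr rfl fun g hg => by simp [hg]

lemma zero : Box G L 0 := ⟨0, by simp, by simp⟩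

lemma of_mem (h : v ∈ G) : Box G 1 v := by
  refine ⟨Pi.single v 1, fun g => ?_, ?_⟩
  · by_cases hg : g = v
    · subst hg; simp
    · rw [Pi.single_eq_of_ne hg]; simp
  · rw [Finset.sum_eq_single_of_mem v h fun g _ hg => by rw [Pi.single_eq_of_ne hg]; simp]
    simp

lemma add (h : Box G L v) (h' : Box G L' w) : Box G (L + L') (v + w) := by
  obtain ⟨p, hp, hv⟩ := h
  obtain ⟨p', hp', hw⟩ := h'
  refine ⟨p + p', fun g => ?_, ?_⟩
  · refine (abs_add_le _ _).trans ?_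
    push_cast
    exact add_le_add (hp g) (hp' g)
  · rw [hv, hw, ← Finset.sum_add_distrib]
    exact Finset.sum_congr rfl fun g _ => by simp only [Pi.add_apply]; push_cast; ring

lemma zmul (h : Box G L v) {s : ℤ} {S : ℕ} (hs : |s| ≤ S) : Box G (S * L) (s * v) := by
  obtain ⟨p, hp, hv⟩ := h
  refine ⟨fun g => s * p g, fun g => ?_, ?_⟩
  · rw [abs_mul]; push_cast
    exact mul_le_mul hs (hp g) (abs_nonneg _) (by positivity)
  · rw [hv, Finset.mul_sum]
    exact Finset.sum_congr rfl fun g _ => by push_cast; ring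

lemma nmul (h : Box G L v) {s S : ℕ} (hs : s ≤ S) : Box G (S * L) (s * v) := by
  have := h.zmul (s := s) (S := S) (by simpa using hs)
  simpa using this

lemma sub (h : Box G L v) (h' : Box G L' w) : Box G (L + L') (v - w) := by
  have h1 := h.add (h'.zmul (s := -1) (S := 1) (by simp))
  simpa [sub_eq_add_neg] using h1

lemma sum {α : Type*} {s : Finset α} {f : α → ℝ} (h : ∀ x ∈ s, Box G L (f x)) :
    Box G (s.card * L) (∑ x ∈ s, f x) := by
  induction s using Finset.induction_on with
  | empty => simpa using zero
  | insert a s ha ih =>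
    rw [Finset.sum_insert ha, Finset.card_insert_of_notMem ha, Nat.add_mul, one_mul, Nat.add_comm]
    exact (h a (Finset.mem_insert_self _ _)).add (ih fun x hx => h x (Finset.mem_insert_of_mem hx))

end Box

lemma one_le_pow_mul_trans {m x y : ℝ} {a b : ℕ} (hm : 0 ≤ m) (hx : 1 ≤ m ^ a * x)
    (hxy : x ≤ m ^ b * y) : 1 ≤ m ^ (a + b) * y := by
  rw [pow_add, mul_assoc]
  exact hx.trans (mul_le_mul_of_nonneg_left hxy (by positivity))

lemma pos_of_one_le_pow_mul {m x : ℝ} {a : ℕ} (hm : 0 ≤ m) (hx : 1 ≤ m ^ a * x) : 0 < x := by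
  by_contra! h
  have := mul_nonpos_of_nonneg_of_nonpos (pow_nonneg hm a) h
  linarith

lemma two_lt_four_pow_mul {t C N : ℕ} {x : ℝ} (ht : 1 ≤ t) (htC : t * C ≤ 2 ^ t) (hN : 2 ^ t ≤ N)
    (hx : 1 ≤ ((2 : ℝ) ^ t) ^ C * x) : 2 < 4 ^ N * x := by
  have hx0 : 0 < x := pos_of_one_le_pow_mul (by positivity) hx
  have h2 : 2 ≤ 2 ^ t := by
    calc 2 = 2 ^ 1 := rfl
      _ ≤ 2 ^ t := Nat.pow_le_pow_right two_pos ht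
  have h1 : (2 : ℝ) ^ (t * C + 2) ≤ 4 ^ N := by
    rw [show (4 : ℝ) = 2 ^ 2 by norm_num, ← pow_mul]
    exact pow_le_pow_right₀ one_le_two (by omega)
  rw [← pow_mul] at hx
  rw [pow_add] at h1
  nlinarith

lemma pr_pigeonhole_int {Ω ι : Type*} [Fintype Ω] [Fintype ι] [DecidableEq ι] {p : Ω → Prop}
    (hp : 0 < pr p) (W : Finset ι) (L : ℕ) (q : (ι → ℤ) → Ω → Prop)
    (h : ∀ ω, p ω → ∃ c : ι → ℤ, (∀ h ∈ W, |c h| ≤ L) ∧ (∀ h ∉ W, c h = 0) ∧ q c ω) :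
    ∃ c : ι → ℤ, (∀ h, |c h| ≤ L) ∧ pr p ≤ ((2 * L + 1 : ℕ) : ℝ) ^ W.card * pr (q c) := by
  obtain ⟨c, hc, hle⟩ := pr_pigeonhole hp
    (Fintype.piFinset fun h : ι => if h ∈ W then Finset.Icc (-(L : ℤ)) L else {0}) q (by
      intro ω hω
      obtain ⟨c, hc, hc0, hq⟩ := h ω hω
      refine ⟨c, ?_, hq⟩
      rw [Fintype.mem_piFinset]
      intro h
      split_ifs with hW
      · rw [Finset.mem_Icc, ← abs_le]; exact hc h hW
      · rw [Finset.mem_singleton]; exact hc0 h hW)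
  rw [Fintype.mem_piFinset] at hc
  refine ⟨c, fun h => ?_, ?_⟩
  · have := hc h
    split_ifs at this with hW
    · rw [Finset.mem_Icc, ← abs_le] at this; exact this
    · rw [Finset.mem_singleton] at this; simp [this]
  · rw [Fintype.card_piFinset] at hle
    have : ∏ h : ι, (if h ∈ W then Finset.Icc (-(L : ℤ)) L else {0}).card = (2 * L + 1) ^ W.card := by
      have h1 : ∀ h : ι, (if h ∈ W then Finset.Icc (-(L : ℤ)) L else {0}).card =
          if h ∈ W then 2 * L + 1 else 1 := by
        intro h
        split_ifs
        · rw [Int.card_Icc]; omega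
        · rfl
      simp only [h1]
      rw [Finset.prod_ite_mem, Finset.univ_inter, Finset.prod_const]
    rw [this] at hle
    exact_mod_cast hle

lemma two_mul_pow_add_one_le {m K w r : ℕ} (hm : 2 ≤ m) (hw : w ≤ r) :
    ((2 * m ^ K + 1 : ℕ) : ℝ) ^ w ≤ (m : ℝ) ^ ((K + 2) * r) := by
  have h1 : 2 * m ^ K + 1 ≤ m ^ (K + 2) := by
    have : 1 ≤ m ^ K := Nat.one_le_pow _ _ (by omega)
    rw [pow_add]; nlinarith [Nat.pow_le_pow_left hm 2]
  have : (2 * m ^ K + 1) ^ w ≤ m ^ ((K + 2) * r) := by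
    rw [pow_mul]
    exact (Nat.pow_le_pow_left h1 w).trans
      (Nat.pow_le_pow_right (Nat.one_le_pow _ _ (by omega)) hw)
  exact_mod_cast this

/-! Eliminating finitely many rows -/

section Reduction
variable {ι : Type} [Fintype ι] [DecidableEq ι]

/-- The matrix obtained from `k • A` by subtracting from each row and column the combination of
the rows and columns in `W` prescribed by `c`. -/
def reduced (A : ι → ι → ℝ) (k : ℝ) (c : ι → ι → ℝ) (W : Finset ι) (i j : ι) : ℝ :=
  k ^ 2 * A i j - k * ∑ h ∈ W, c i h * A h j - k * ∑ h ∈ W, c j h * A h i +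
    ∑ h ∈ W, ∑ h' ∈ W, c i h * c j h' * A h h'

lemma reduced_symm {A : ι → ι → ℝ} (hA : ∀ i j, A i j = A j i) (k : ℝ) (c : ι → ι → ℝ)
    (W : Finset ι) (i j : ι) : reduced A k c W i j = reduced A k c W j i := by
  unfold reduced
  have : ∑ h ∈ W, ∑ h' ∈ W, c i h * c j h' * A h h' = ∑ h ∈ W, ∑ h' ∈ W, c j h * c i h' * A h h' := by
    rw [Finset.sum_comm]
    exact Finset.sum_congr rfl fun h _ => Finset.sum_congr rfl fun h' _ => by rw [hA h h']; ring
  rw [this, hA i j]; ring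

lemma reduced_eq {A : ι → ι → ℝ} (hA : ∀ i j, A i j = A j i) (k : ℝ) (c : ι → ι → ℝ)
    (W : Finset ι) (i j : ι) : reduced A k c W i j =
      k * (k * A i j - ∑ h ∈ W, c i h * A h j) -
        ∑ h' ∈ W, c j h' * (k * A i h' - ∑ h ∈ W, c i h * A h h') := by
  unfold reduced
  have h1 : ∑ h' ∈ W, c j h' * (k * A i h' - ∑ h ∈ W, c i h * A h h') =
      k * ∑ h ∈ W, c j h * A h i - ∑ h ∈ W, ∑ h' ∈ W, c i h * c j h' * A h h' := by
    rw [Finset.sum_comm, Finset.mul_sum, ← Finset.sum_sub_distrib]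
    refine Finset.sum_congr rfl fun h' _ => ?_
    rw [mul_sub, Finset.mul_sum, hA i h']
    congr 1
    · ring
    · exact Finset.sum_congr rfl fun h _ => by ring
  rw [h1]; ring

lemma sum_reduced {A : ι → ι → ℝ} (k : ℝ) (c : ι → ι → ℝ) (W : Finset ι) (z : ι → ℝ) :
    ∑ i, ∑ j, reduced A k c W i j * z i * z j =
      k ^ 2 * ∑ i, ∑ j, A i j * z i * z j -
        2 * k * ∑ h ∈ W, (∑ i, c i h * z i) * ∑ j, A h j * z j +
        ∑ h ∈ W, ∑ h' ∈ W, (∑ i, c i h * z i) * (∑ i, c i h' * z i) * A h h' := by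
  have e1 : ∑ i, ∑ j, (∑ h ∈ W, c i h * A h j) * z i * z j =
      ∑ h ∈ W, (∑ i, c i h * z i) * ∑ j, A h j * z j := by
    simp only [Finset.sum_mul, Finset.mul_sum]
    rw [Finset.sum_congr rfl fun i _ => Finset.sum_comm, Finset.sum_comm]
    refine Finset.sum_congr rfl fun h _ => ?_
    rw [Finset.sum_comm]
    exact Finset.sum_congr rfl fun i _ => Finset.sum_congr rfl fun j _ => by ring
  have e2 : ∑ i, ∑ j, (∑ h ∈ W, c j h * A h i) * z i * z j =
      ∑ h ∈ W, (∑ i, c i h * z i) * ∑ j, A h j * z j := by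
    rw [← e1, Finset.sum_comm]
    exact Finset.sum_congr rfl fun i _ => Finset.sum_congr rfl fun j _ => by ring
  have e3 : ∑ i, ∑ j, (∑ h ∈ W, ∑ h' ∈ W, c i h * c j h' * A h h') * z i * z j =
      ∑ h ∈ W, ∑ h' ∈ W, (∑ i, c i h * z i) * (∑ i, c i h' * z i) * A h h' := by
    simp only [Finset.sum_mul, Finset.mul_sum]
    rw [Finset.sum_congr rfl fun i _ => Finset.sum_comm, Finset.sum_comm]
    refine Finset.sum_congr rfl fun h _ => ?_
    rw [Finset.sum_congr rfl fun i _ => Finset.sum_congr rfl fun j _ => rfl]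
    rw [Finset.sum_congr rfl fun i _ => Finset.sum_comm, Finset.sum_comm]
    refine Finset.sum_congr rfl fun h' _ => ?_
    rw [Finset.sum_comm]
    exact Finset.sum_congr rfl fun i _ => Finset.sum_congr rfl fun j _ => by ring
  have e4 : ∑ i, ∑ j, reduced A k c W i j * z i * z j =
      k ^ 2 * ∑ i, ∑ j, A i j * z i * z j - k * ∑ i, ∑ j, (∑ h ∈ W, c i h * A h j) * z i * z j -
      k * ∑ i, ∑ j, (∑ h ∈ W, c j h * A h i) * z i * z j +
      ∑ i, ∑ j, (∑ h ∈ W, ∑ h' ∈ W, c i h * c j h' * A h h') * z i * z j := by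
    have : ∀ i j, reduced A k c W i j * z i * z j = k ^ 2 * (A i j * z i * z j) -
        k * ((∑ h ∈ W, c i h * A h j) * z i * z j) - k * ((∑ h ∈ W, c j h * A h i) * z i * z j) +
        (∑ h ∈ W, ∑ h' ∈ W, c i h * c j h' * A h h') * z i * z j := by
      intro i j; unfold reduced; ring
    simp only [this, Finset.sum_add_distrib, Finset.sum_sub_distrib, ← Finset.mul_sum]
  rw [e4, e1, e2, e3]; ring

lemma sum_add_mul_add {A : ι → ι → ℝ} (hA : ∀ i j, A i j = A j i) (u z : ι → ℝ) :
    ∑ i, ∑ j, A i j * (u i + z i) * (u j + z j) = ∑ i, ∑ j, A i j * u i * u j +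
      2 * ∑ j, (∑ i, A i j * u i) * z j + ∑ i, ∑ j, A i j * z i * z j := by
  have e1 : ∑ i, ∑ j, A i j * u i * z j = ∑ j, (∑ i, A i j * u i) * z j := by
    rw [Finset.sum_comm]
    exact Finset.sum_congr rfl fun j _ => by rw [Finset.sum_mul]
  have e2 : ∑ i, ∑ j, A i j * z i * u j = ∑ j, (∑ i, A i j * u i) * z j := by
    refine Finset.sum_congr rfl fun j _ => ?_
    rw [Finset.sum_mul]
    exact Finset.sum_congr rfl fun i _ => by rw [hA j i]; ring
  have : ∀ i j, A i j * (u i + z i) * (u j + z j) = A i j * u i * u j + A i j * u i * z j +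
      A i j * z i * u j + A i j * z i * z j := by intro i j; ring
  simp only [this, Finset.sum_add_distrib]
  rw [e1, e2]; ring

/-- The reduced matrix inherits concentration of the quadratic form. -/
lemma exists_pr_reduced {A : ι → ι → ℝ} (hA : ∀ i j, A i j = A j i) (a : ℝ) (k : ℝ)
    (c : ι → ι → ℤ) (W S : Finset ι) (L : ℕ) (hc : ∀ i h, |c i h| ≤ L)
    (hpos : 0 < pr fun x => quad A 0 x = a) :
    ∃ l a', (pr fun x => quad A 0 x = a) ≤
      ((2 * (Fintype.card ι * L) + 1 : ℕ) : ℝ) ^ W.card * pr fun x => quad (fun i j =>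
        if i ∉ S ∧ j ∉ S then reduced A k (fun i h => c i h) W i j else 0) l x = a' := by
  obtain ⟨x, hx⟩ := exists_pr_le_glue S fun x => quad A 0 x = a
  obtain ⟨σ, -, hσ⟩ := pr_pigeonhole_int (hpos.trans_le hx) W (Fintype.card ι * L)
    (fun σ y => quad A 0 (glue S x y) = a ∧
      ∀ h ∈ W, ∑ i, c i h * (if i ∈ S then 0 else sgz (y i)) = σ h) (by
    intro y hy
    refine ⟨fun h => if h ∈ W then ∑ i, c i h * (if i ∈ S then 0 else sgz (y i)) else 0, ?_, ?_,
      hy, ?_⟩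
    · intro h hW
      beta_reduce
      rw [if_pos hW]
      refine (Finset.abs_sum_le_sum_abs _ _).trans ?_
      refine (Finset.sum_le_card_nsmul _ _ (L : ℤ) fun i _ => ?_).trans ?_
      · rw [abs_mul]
        have h1 : |if i ∈ S then 0 else sgz (y i)| ≤ 1 := by
          split_ifs
          · simp
          · cases y i <;> simp [sgz]
        calc _ ≤ (L : ℤ) * 1 := mul_le_mul (hc i h) h1 (abs_nonneg _) (by positivity)
          _ = _ := mul_one _
      · simp
    · intro h hW; simp [hW]
    · intro h hW; simp [hW])
  refine ⟨fun j => if j ∈ S then 0 else 2 * k * ∑ h ∈ W, (σ h : ℝ) * A h j +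
    2 * k ^ 2 * ∑ i, A i j * (if i ∈ S then (sgz (x i) : ℝ) else 0),
    k ^ 2 * a - k ^ 2 * (∑ i, ∑ j, A i j * (if i ∈ S then (sgz (x i) : ℝ) else 0) *
      (if j ∈ S then (sgz (x j) : ℝ) else 0)) + ∑ h ∈ W, ∑ h' ∈ W, (σ h : ℝ) * σ h' * A h h', ?_⟩
  refine hx.trans (hσ.trans (mul_le_mul_of_nonneg_left (pr_mono ?_) (by positivity)))
  rintro y ⟨hy, hsum⟩
  set u : ι → ℝ := fun i => if i ∈ S then (sgz (x i) : ℝ) else 0 with hu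
  set z : ι → ℝ := fun i => if i ∈ S then 0 else (sgz (y i) : ℝ) with hz
  have hglue : ∀ i, (sgz (glue S x y i) : ℝ) = u i + z i := by
    intro i
    simp only [glue, hu, hz]
    split_ifs <;> simp
  have hσ' : ∀ h ∈ W, ∑ i, (c i h : ℝ) * z i = σ h := by
    intro h hW
    rw [← hsum h hW]
    push_cast
    rfl
  simp only [quad, hglue, Pi.zero_apply, zero_mul, Finset.sum_const_zero, add_zero] at hy
  rw [sum_add_mul_add hA] at hy
  have e1 := sum_reduced (A := A) k (fun i h => (c i h : ℝ)) W z
  have e2 : ∑ h ∈ W, (∑ i, (c i h : ℝ) * z i) * ∑ j, A h j * z j =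
      ∑ h ∈ W, (σ h : ℝ) * ∑ j, A h j * z j :=
    Finset.sum_congr rfl fun h hW => by rw [hσ' h hW]
  have e3 : ∑ h ∈ W, ∑ h' ∈ W, (∑ i, (c i h : ℝ) * z i) * (∑ i, (c i h' : ℝ) * z i) * A h h' =
      ∑ h ∈ W, ∑ h' ∈ W, (σ h : ℝ) * σ h' * A h h' :=
    Finset.sum_congr rfl fun h hW => Finset.sum_congr rfl fun h' hW' => by
      rw [hσ' h hW, hσ' h' hW']
  rw [e2, e3] at e1
  have e4 : ∑ h ∈ W, (σ h : ℝ) * ∑ j, A h j * z j = ∑ j, (∑ h ∈ W, (σ h : ℝ) * A h j) * z j := by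
    simp only [Finset.mul_sum, Finset.sum_mul]
    rw [Finset.sum_comm]
    exact Finset.sum_congr rfl fun j _ => Finset.sum_congr rfl fun h _ => by ring
  have e5 : quad (fun i j => if i ∉ S ∧ j ∉ S then reduced A k (fun i h => c i h) W i j else 0)
      (fun j => if j ∈ S then 0 else 2 * k * ∑ h ∈ W, (σ h : ℝ) * A h j +
        2 * k ^ 2 * ∑ i, A i j * u i) y =
      ∑ i, ∑ j, reduced A k (fun i h => c i h) W i j * z i * z j +
        (2 * k * ∑ j, (∑ h ∈ W, (σ h : ℝ) * A h j) * z j +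
        2 * k ^ 2 * ∑ j, (∑ i, A i j * u i) * z j) := by
    unfold quad
    congr 1
    · refine Finset.sum_congr rfl fun i _ => Finset.sum_congr rfl fun j _ => ?_
      simp only [hz]
      by_cases hi : i ∈ S <;> by_cases hj : j ∈ S <;> simp [hi, hj]
    · rw [Finset.mul_sum, Finset.mul_sum, ← Finset.sum_add_distrib]
      refine Finset.sum_congr rfl fun j _ => ?_
      simp only [hz]
      split_ifs
      · simp
      · ring
  rw [e5, e1, e4, ← hy]
  ring

end Reduction

/-- Up to few exceptions `E i`, the entries of the `i`-th row of `M` lie in a box of bounded rank,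
after multiplication by `d i`. -/
def RowBoxes {ι : Type} (M : ι → ι → ℝ) (E : ι → Finset ι) (G : ι → Finset ℝ) (d : ι → ℕ)
    (m r K : ℕ) : Prop :=
  ∀ i, (E i).card ≤ m ^ 2 ∧ (G i).card ≤ r ∧ 0 < d i ∧ d i ≤ m ^ K ∧
    ∀ j ∉ E i, Box (G i) (m ^ K) (d i * M i j)

/-- After elimination of boundedly many rows, almost every entry of each row lies in a box of
bounded rank, and the quadratic form is still concentrated. -/
lemma exists_reduction (C e : ℕ) : ∃ r K C' t₀ : ℕ, ∀ t, t₀ ≤ t → ∀ (ι : Type) [Fintype ι]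
    [DecidableEq ι], Fintype.card ι ≤ (2 ^ t) ^ e → ∀ (A : ι → ι → ℝ) (a : ℝ),
    (∀ i j, A i j = A j i) → 1 ≤ ((2 : ℝ) ^ t) ^ C * pr (fun x => quad A 0 x = a) →
    ∃ (W S : Finset ι) (k : ℕ) (c : ι → ι → ℤ) (M : ι → ι → ℝ) (l : ι → ℝ) (a' : ℝ)
      (E : ι → Finset ι) (G : ι → Finset ℝ) (d : ι → ℕ),
      W ⊆ S ∧ W.card ≤ r ∧ S.card ≤ 16 * (2 ^ t) ^ 2 + r ∧ 0 < k ∧ k ≤ (2 ^ t) ^ K ∧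
      (∀ i h, |c i h| ≤ ((2 ^ t) ^ K : ℕ)) ∧
      (∀ i ∉ S, ∀ j ∉ S, M i j = reduced A k (fun i h => c i h) W i j) ∧
      (∀ i j, M i j = M j i) ∧ 1 ≤ ((2 : ℝ) ^ t) ^ C' * pr (fun x => quad M l x = a') ∧
      RowBoxes M E G d (2 ^ t) r K := by
  obtain ⟨r₁, K₁, C₁, t₁, h₁⟩ := exists_row_relations C e
  set C₂ := C₁ + (4 + (K₁ + 2) * r₁) with hC₂
  obtain ⟨r₂, K₂, t₂, h₂⟩ := exists_common_denominator C₂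
  obtain ⟨t₃, h₃⟩ := exists_mul_le_two_pow (C₁ + r₁ + r₂ + 1)
  refine ⟨r₁ + r₂, K₁ + K₂ + 1, C + (e + K₁ + 2) * r₁, t₁ + t₂ + t₃ + 1,
    fun t ht ι _ _ hn A a hA hC => ?_⟩
  obtain ⟨W, k, E₁, hW, hk0, hk, hE₁, hp⟩ := h₁ t (by omega) ι hn A 0 a hA hC
  have h3 := h₃ t (by omega)
  set m : ℕ := 2 ^ t with hm
  have hm2 : 2 ≤ m := by
    calc 2 = 2 ^ 1 := rfl
      _ ≤ m := Nat.pow_le_pow_right two_pos (by omega)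
  have hmr : ((2 : ℝ) ^ t) = (m : ℝ) := by rw [hm]; push_cast; rfl
  have hm2r : (2 : ℝ) ≤ m := by exact_mod_cast hm2
  rw [hmr] at hC hp ⊢
  have hrm : r₁ + r₂ ≤ m := by
    have : r₁ + r₂ ≤ (C₁ + r₁ + r₂ + 1) * t := by nlinarith [show 1 ≤ t by omega]
    omega
  set p : (ι → Bool) × (ι → Bool) → Prop := fun ω => ∀ i ∉ E₁ ω, ω.1 i = false →
    ∃ c : ι → ℤ, (∀ h, |c h| ≤ (m ^ K₁ : ℕ)) ∧
      (k : ℝ) * ∑ j, A i j * lazyv ω.1 ω.2 j =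
        ∑ h ∈ W, (c h : ℝ) * ∑ j, A h j * lazyv ω.1 ω.2 j with hpdef
  obtain ⟨J, hJ, hJi⟩ := exists_cover p E₁ (m ^ 2) false (by positivity) hE₁
    (two_lt_four_pow_mul (t := t) (C := C₁) (by omega)
      (by rw [← hm]; have : t * C₁ ≤ (C₁ + r₁ + r₂ + 1) * t := by nlinarith
          omega)
      (by rw [← hm]; nlinarith) (by rw [hmr]; exact hp))
  have hrow : ∀ i, ∃ (c : ι → ℤ) (E W' : Finset ι) (d : ℕ) (b : ι → ι → ℤ),
      (∀ h, |c h| ≤ (m ^ K₁ : ℕ)) ∧ (i ∉ J → E.card ≤ m ^ 2 ∧ W'.card ≤ r₂ ∧ 0 < d ∧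
      d ≤ m ^ K₂ ∧ (∀ i h, |b i h| ≤ (m ^ K₂ : ℕ)) ∧ ∀ j ∉ E,
        (d : ℝ) * (k * A i j - ∑ h ∈ W, (c h : ℝ) * A h j) =
          ∑ h' ∈ W', (b j h' : ℝ) * (k * A i h' - ∑ h ∈ W, (c h : ℝ) * A h h')) := by
    intro i
    by_cases hi : i ∈ J
    · exact ⟨0, ∅, ∅, 0, 0, by simp, fun h => absurd hi h⟩
    have h1 := hJi i hi
    have hpp := pos_of_one_le_pow_mul (by positivity) hp
    obtain ⟨c, hc, hle⟩ := pr_pigeonhole_int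
      (p := fun ω => p ω ∧ ω.1 i = false ∧ i ∉ E₁ ω) (by linarith) W (m ^ K₁)
      (fun c ω => ∑ j, (k * A i j - ∑ h ∈ W, (c h : ℝ) * A h j) * lazyv ω.1 ω.2 j = 0) (by
        rintro ω ⟨hω, hD, hE⟩
        obtain ⟨c, hc, hrel⟩ := hω i hE hD
        refine ⟨fun h => if h ∈ W then c h else 0, fun h hh => by simpa [hh] using hc h,
          fun h hh => by simp [hh], ?_⟩
        have e1 : ∀ j, ∑ h ∈ W, (((if h ∈ W then c h else 0 : ℤ)) : ℝ) * A h j =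
            ∑ h ∈ W, (c h : ℝ) * A h j := fun j =>
          Finset.sum_congr rfl fun h hh => by rw [if_pos hh]
        simp only [e1]
        have e2 : ∑ h ∈ W, (c h : ℝ) * ∑ j, A h j * lazyv ω.1 ω.2 j =
            ∑ j, (∑ h ∈ W, (c h : ℝ) * A h j) * lazyv ω.1 ω.2 j := by
          simp only [Finset.mul_sum, Finset.sum_mul]
          rw [Finset.sum_comm]
          exact Finset.sum_congr rfl fun j _ => Finset.sum_congr rfl fun h _ => by ring
        rw [e2, Finset.mul_sum] at hrel
        simp only [sub_mul, Finset.sum_sub_distrib]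
        rw [sub_eq_zero, ← hrel]
        exact Finset.sum_congr rfl fun j _ => by ring)
    obtain ⟨b, hb⟩ := exists_pr_lazy_le fun j => k * A i j - ∑ h ∈ W, (c h : ℝ) * A h j
    have hfin : 1 ≤ (m : ℝ) ^ C₂ * pr fun x : ι → Bool =>
        ∑ j, sgz (x j) • (k * A i j - ∑ h ∈ W, (c h : ℝ) * A h j) = b := by
      refine one_le_pow_mul_trans (by positivity) hp ?_
      have h16 : (16 : ℝ) ≤ (m : ℝ) ^ 4 := by
        calc (16 : ℝ) = 2 ^ 4 := by norm_num
          _ ≤ _ := by gcongr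
      rw [pow_add, mul_assoc]
      refine h1.trans (mul_le_mul h16 ?_ (pr_nonneg _) (by positivity))
      exact hle.trans (mul_le_mul (two_mul_pow_add_one_le hm2 hW) hb (pr_nonneg _) (by positivity))
    obtain ⟨E, W', d, b', hE, hW', hd0, hd, hb', hrel⟩ := h₂ t (by omega) ι
      (fun j => k * A i j - ∑ h ∈ W, (c h : ℝ) * A h j) b (by rw [hmr]; exact hfin)
    exact ⟨c, E, W', d, b', hc, fun _ => ⟨hE, hW', hd0, hd, hb', hrel⟩⟩
  choose c E W' d b hc hrow using hrow
  set S := J ∪ W with hS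
  obtain ⟨l, a', hl⟩ := exists_pr_reduced hA a k c W S (m ^ K₁) hc
    (pos_of_one_le_pow_mul (by positivity) hC)
  set M : ι → ι → ℝ := fun i j =>
    if i ∉ S ∧ j ∉ S then reduced A k (fun i h => c i h) W i j else 0 with hM
  have hKle : m ^ K₁ ≤ m ^ (K₁ + K₂ + 1) := Nat.pow_le_pow_right (by omega) (by omega)
  refine ⟨W, S, k, c, M, l, a', fun i => if i ∈ S then ∅ else E i,
    fun i => if i ∈ S then ∅ else (W' i ∪ W).image fun j => k * A i j - ∑ h ∈ W, (c i h : ℝ) * A h j,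
    fun i => if i ∈ S then 1 else d i, Finset.subset_union_right, by omega, ?_, hk0, hk.trans hKle,
    fun i h => (hc i h).trans (by exact_mod_cast hKle), ?_, ?_, ?_, ?_⟩
  · have := Finset.card_union_le J W
    rw [← hS] at this
    omega
  · intro i hi j hj
    simp only [hM, hi, hj, not_false_eq_true, and_self, if_true]
  · intro i j
    simp only [hM, reduced_symm hA k _ W i j, and_comm]
  · refine one_le_pow_mul_trans (by positivity) hC (hl.trans ?_)
    refine mul_le_mul_of_nonneg_right ?_ (pr_nonneg _)
    refine le_trans ?_ (two_mul_pow_add_one_le (K := e + K₁) hm2 hW)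
    have : Fintype.card ι * m ^ K₁ ≤ m ^ (e + K₁) := by
      rw [pow_add]; exact Nat.mul_le_mul_right _ hn
    refine pow_le_pow_left₀ (by positivity) ?_ _
    exact_mod_cast (by omega)
  · intro i
    by_cases hi : i ∈ S
    · simp only [hi, if_true]
      refine ⟨by simp, by simp, one_pos, Nat.one_le_pow _ _ (by omega), fun j _ => ?_⟩
      have : M i j = 0 := by simp [hM, hi]
      rw [this, mul_zero]; exact Box.zero
    have hiJ : i ∉ J := fun h => hi (Finset.mem_union_left _ h)
    obtain ⟨hE, hW', hd0, hd, hb, hrel⟩ := hrow i hiJ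
    simp only [hi, if_false]
    refine ⟨hE, Finset.card_image_le.trans ((Finset.card_union_le _ _).trans (by omega)), hd0,
      hd.trans (Nat.pow_le_pow_right (by omega) (by omega)), fun j hj => ?_⟩
    by_cases hjS : j ∈ S
    · have : M i j = 0 := by simp [hM, hjS]
      rw [this, mul_zero]; exact Box.zero
    have hMij : M i j = reduced A k (fun i h => c i h) W i j := by
      simp only [hM, hi, hjS, not_false_eq_true, and_self, if_true]
    set B : ι → ℝ := fun j => k * A i j - ∑ h ∈ W, (c i h : ℝ) * A h j with hB
    have heq : (d i : ℝ) * M i j = k * ∑ h' ∈ W' i, (b i j h' : ℝ) * B h' -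
        d i * ∑ h' ∈ W, (c j h' : ℝ) * B h' := by
      rw [hMij, reduced_eq hA, ← hrel j hj]; ring
    rw [heq]
    have hmem : ∀ h ∈ W' i ∪ W, Box ((W' i ∪ W).image B) 1 (B h) := fun h hh =>
      Box.of_mem (Finset.mem_image_of_mem _ hh)
    have b1 := (Box.sum (s := W' i) fun h hh =>
      (hmem h (Finset.mem_union_left _ hh)).zmul (hb j h)).nmul hk
    have b2 := (Box.sum (s := W) fun h hh =>
      (hmem h (Finset.mem_union_right _ hh)).zmul (hc j h)).nmul hd
    refine (b1.sub b2).mono subset_rfl ?_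
    calc _ = ((W' i).card + W.card) * m ^ (K₁ + K₂) := by rw [pow_add]; ring
      _ ≤ m * m ^ (K₁ + K₂) := Nat.mul_le_mul_right _ (by omega)
      _ = _ := by rw [pow_succ]; ring

lemma Box.prod_mul {ι : Type} [DecidableEq ι] {W : Finset ι} {d : ι → ℕ} {B : ℕ}
    (hd : ∀ h ∈ W, d h ≤ B) (hB : 1 ≤ B) {h : ι} (hh : h ∈ W) {G : Finset ℝ} {L : ℕ} {v : ℝ}
    (hv : Box G L (d h * v)) : Box G (B ^ W.card * L) ((∏ h ∈ W, d h : ℕ) * v) := by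
  have h1 : ∏ h ∈ W.erase h, d h ≤ B ^ W.card := by
    refine (Finset.prod_le_pow_card _ _ B fun i hi => hd i (Finset.mem_of_mem_erase hi)).trans ?_
    exact Nat.pow_le_pow_right hB (Finset.card_le_card (Finset.erase_subset _ _))
  have := hv.nmul h1
  rw [← mul_assoc, ← Nat.cast_mul, Finset.prod_erase_mul _ _ hh] at this
  exact this

/-- Substituting the frozen coordinates, the values of the linear forms `M i` at a random lazy sign
vector lie in a box of bounded rank. -/
lemma exists_frozen_boxes (C e r₀ K₀ : ℕ) : ∃ r K C' t₀ : ℕ, ∀ t, t₀ ≤ t → ∀ (ι : Type) [Fintype ι]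
    [DecidableEq ι], Fintype.card ι ≤ (2 ^ t) ^ e → ∀ (M : ι → ι → ℝ) (l : ι → ℝ) (a : ℝ)
    (E : ι → Finset ι) (G : ι → Finset ℝ) (d : ι → ℕ), (∀ i j, M i j = M j i) →
    1 ≤ ((2 : ℝ) ^ t) ^ C * pr (fun x => quad M l x = a) → RowBoxes M E G d (2 ^ t) r₀ K₀ →
    ∃ (E₀ : Finset ι) (κ : ℕ) (b : ι → ℝ) (G₁ : Finset ℝ), E₀.card ≤ r * (2 ^ t) ^ 2 ∧ 0 < κ ∧
      κ ≤ (2 ^ t) ^ K ∧ G₁.card ≤ r ∧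
      1 ≤ ((2 : ℝ) ^ t) ^ C' * pr fun ω : (ι → Bool) × (ι → Bool) => ∃ F : Finset ι,
        F.card ≤ (2 ^ t) ^ 2 ∧ ∀ i ∉ F, i ∉ E₀ → ω.1 i = false → Box G₁ ((2 ^ t) ^ K)
          (κ * (b i + ∑ j, (sgz (ω.2 j) : ℝ) * if j ∉ E₀ ∧ ω.1 j then M i j else 0)) := by
  obtain ⟨r₁, K₁, C₁, t₁, h₁⟩ := exists_row_relations C e
  obtain ⟨t₃, h₃⟩ := exists_mul_le_two_pow r₁
  refine ⟨r₁ + r₁ * r₀, K₀ * r₁ + K₁ + K₀ + e + 2, C₁, t₁ + t₃ + 1,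
    fun t ht ι _ _ hn M l a E G d hM hC hrow => ?_⟩
  obtain ⟨W, k, E₁, hW, hk0, hk, hE₁, hp⟩ := h₁ t (by omega) ι hn M l a hM hC
  have h3 := h₃ t (by omega)
  set m : ℕ := 2 ^ t with hm
  have hm2 : 2 ≤ m := by
    calc 2 = 2 ^ 1 := rfl
      _ ≤ m := Nat.pow_le_pow_right two_pos (by omega)
  have hr₁m : r₁ ≤ m := le_trans (by nlinarith [show 1 ≤ t by omega]) h3
  have hone : ∀ x, 1 ≤ m ^ x := fun x => Nat.one_le_pow _ _ (by omega)
  obtain ⟨D₀, ξ₀, hfr⟩ := exists_pr_le_glue_pair (W.biUnion E) _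
  have hp' := hp.trans (mul_le_mul_of_nonneg_left hfr (by positivity))
  set E₀ := W.biUnion E with hE₀
  set κ : ℕ := ∏ h ∈ W, d h with hκ
  set b : ι → ℝ := fun i => ∑ j, if j ∈ E₀ then M i j * lazyv D₀ ξ₀ j else 0 with hb
  have hκ0 : 0 < κ := Finset.prod_pos fun h _ => (hrow h).2.2.1
  have hκle : κ ≤ m ^ (K₀ * r₁) := by
    refine (Finset.prod_le_pow_card _ _ (m ^ K₀) fun i _ => (hrow i).2.2.2.1).trans ?_
    rw [pow_mul]
    exact Nat.pow_le_pow_right (hone _) hW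
  set G₁ := W.image (fun h => (κ : ℝ) * b h) ∪ W.biUnion G with hG₁
  refine ⟨E₀, κ * k, b, G₁, ?_, Nat.mul_pos hκ0 hk0, ?_, ?_, ?_⟩
  · refine (Finset.card_biUnion_le_card_mul _ _ _ fun h _ => (hrow h).1).trans ?_
    exact Nat.mul_le_mul_right _ (by omega)
  · calc κ * k ≤ m ^ (K₀ * r₁) * m ^ K₁ := Nat.mul_le_mul hκle hk
      _ = m ^ (K₀ * r₁ + K₁) := (pow_add _ _ _).symm
      _ ≤ _ := Nat.pow_le_pow_right (by omega) (by omega)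
  · refine (Finset.card_union_le _ _).trans (Nat.add_le_add (Finset.card_image_le.trans hW) ?_)
    refine (Finset.card_biUnion_le_card_mul _ _ _ fun h _ => (hrow h).2.1).trans ?_
    exact Nat.mul_le_mul_right _ hW
  · refine hp'.trans (mul_le_mul_of_nonneg_left (pr_mono ?_) (by positivity))
    rintro ⟨D, ξ⟩ hω
    refine ⟨E₁ (glue E₀ D₀ D, glue E₀ ξ₀ ξ), hE₁ _, fun i hi hi0 hD => ?_⟩
    simp only at hD ⊢
    obtain ⟨c, hc, hrel⟩ := hω i hi (by simp only [glue_of_notMem hi0]; exact hD)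
    have hsplit : ∀ i, ∑ j, M i j * lazyv (glue E₀ D₀ D) (glue E₀ ξ₀ ξ) j =
        b i + ∑ j, (sgz (ξ j) : ℝ) * if j ∉ E₀ ∧ D j then M i j else 0 := by
      intro i
      rw [hb, ← Finset.sum_add_distrib]
      refine Finset.sum_congr rfl fun j _ => ?_
      by_cases hj : j ∈ E₀
      · simp [lazyv, glue, hj]
      · cases hDj : D j <;> simp [lazyv, glue, hj, hDj, mul_comm]
    simp only [hsplit] at hrel
    have hbox : ∀ h ∈ W, Box G₁ (1 + m ^ e * m ^ (K₀ * r₁ + K₀))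
        (κ * (b h + ∑ j, (sgz (ξ j) : ℝ) * if j ∉ E₀ ∧ D j then M h j else 0)) := by
      intro h hh
      rw [mul_add]
      refine Box.add (Box.of_mem (Finset.mem_union_left _ (Finset.mem_image_of_mem _ hh))) ?_
      rw [Finset.mul_sum]
      refine (Box.sum (L := m ^ (K₀ * r₁ + K₀)) fun j _ => ?_).mono subset_rfl
        (Nat.mul_le_mul_right _ (by simpa using hn))
      by_cases hj : j ∉ E₀ ∧ D j
      · rw [if_pos hj]
        have hjE : j ∉ E h := fun hje => hj.1 (Finset.mem_biUnion.mpr ⟨h, hh, hje⟩)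
        have h1 := ((hrow h).2.2.2.2 j hjE).prod_mul (W := W) (fun h _ => (hrow h).2.2.2.1)
          (hone _) hh
        have h2 := h1.zmul (s := sgz (ξ j)) (S := 1) (by cases ξ j <;> simp [sgz])
        rw [one_mul] at h2
        have h4 : (κ : ℝ) * ((sgz (ξ j) : ℝ) * M h j) = (sgz (ξ j) : ℝ) * (κ * M h j) := by ring
        rw [h4]
        refine h2.mono ((Finset.subset_biUnion_of_mem G hh).trans Finset.subset_union_right) ?_
        rw [pow_add, ← pow_mul]
        exact Nat.mul_le_mul_right _ (Nat.pow_le_pow_right (by omega) (Nat.mul_le_mul_left _ hW))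
      · rw [if_neg hj, mul_zero, mul_zero]; exact Box.zero
    have heq : ((κ * k : ℕ) : ℝ) *
          (b i + ∑ j, (sgz (ξ j) : ℝ) * if j ∉ E₀ ∧ D j then M i j else 0) =
        ∑ h ∈ W, (c h : ℝ) *
          (κ * (b h + ∑ j, (sgz (ξ j) : ℝ) * if j ∉ E₀ ∧ D j then M h j else 0)) := by
      push_cast
      rw [mul_assoc, hrel, Finset.mul_sum]
      exact Finset.sum_congr rfl fun h _ => by ring
    rw [heq]
    refine (Box.sum fun h hh => (hbox h hh).zmul (hc h)).mono subset_rfl ?_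
    calc W.card * (m ^ K₁ * (1 + m ^ e * m ^ (K₀ * r₁ + K₀)))
        ≤ m * (m ^ K₁ * (m * (m ^ e * m ^ (K₀ * r₁ + K₀)))) := by
          have := Nat.mul_le_mul (hone e) (hone (K₀ * r₁ + K₀))
          refine Nat.mul_le_mul (by omega) (Nat.mul_le_mul_left _ ?_)
          nlinarith
      _ = _ := by ring

/-- For random `D`, almost every column of `M` indexed by `D` agrees off `D`, up to a box of bounded
rank, with a combination of boundedly many columns. -/
lemma exists_column_relations (C K₀ : ℕ) : ∃ r C' t₀ : ℕ, ∀ t, t₀ ≤ t → ∀ (ι : Type)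
    [Fintype ι] [DecidableEq ι] (e : ℕ), Fintype.card ι ≤ (2 ^ t) ^ e → ∀ (M : ι → ι → ℝ)
    (E₀ : Finset ι) (κ : ℕ) (b : ι → ℝ) (G : Finset ℝ),
    (1 ≤ ((2 : ℝ) ^ t) ^ C * pr fun ω : (ι → Bool) × (ι → Bool) => ∃ F : Finset ι,
        F.card ≤ (2 ^ t) ^ 2 ∧ ∀ i ∉ F, i ∉ E₀ → ω.1 i = false → Box G ((2 ^ t) ^ K₀)
          (κ * (b i + ∑ j, (sgz (ω.2 j) : ℝ) * if j ∉ E₀ ∧ ω.1 j then M i j else 0))) →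
    ∃ W : Finset ι, W.card ≤ r ∧ 1 ≤ ((2 : ℝ) ^ t) ^ (C' + (e + 1) * r) *
      pr fun D : ι → Bool => ∃ E : Finset ι, E.card ≤ (2 ^ t) ^ 2 ∧
        ∀ j ∉ E, j ∉ E₀ → D j = true → ∃ s : ι → ℤ, s j ≠ 0 ∧ (∀ h, |s h| ≤ 2 ^ t) ∧
          ∃ F : Finset ι, F.card ≤ (2 ^ t) ^ 3 ∧ ∀ i ∉ F, i ∉ E₀ → D i = false →
            Box G ((2 ^ t) ^ (K₀ + 1)) (κ * (s j * M i j + ∑ h ∈ W, s h * M i h)) := by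
  obtain ⟨t₃, h₃⟩ := exists_mul_le_two_pow (4 * C + 10)
  refine ⟨2 * (C + 1), C + 1, t₃ + 1, fun t ht ι _ _ e hn M E₀ κ b G hp => ?_⟩
  have h3 := h₃ t (by omega)
  set m : ℕ := 2 ^ t with hm
  have hm2 : 2 ≤ m := by
    calc 2 = 2 ^ 1 := rfl
      _ ≤ m := Nat.pow_le_pow_right two_pos (by omega)
  have hmr : ((2 : ℝ) ^ t) = (m : ℝ) := by rw [hm]; push_cast; rfl
  have hm2r : (2 : ℝ) ≤ m := by exact_mod_cast hm2
  have hCm : 4 * C + 10 ≤ m := le_trans (by nlinarith [show 1 ≤ t by omega]) h3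
  rw [hmr] at hp ⊢
  set p : (ι → Bool) × (ι → Bool) → Prop := fun ω => ∃ F : Finset ι,
        F.card ≤ m ^ 2 ∧ ∀ i ∉ F, i ∉ E₀ → ω.1 i = false → Box G (m ^ K₀)
          (κ * (b i + ∑ j, (sgz (ω.2 j) : ℝ) * if j ∉ E₀ ∧ ω.1 j then M i j else 0)) with hpd
  have hp0 := pos_of_one_le_pow_mul (by positivity) hp
  have hhalf : 1 ≤ (m : ℝ) ^ (C + 1) * (pr p / 2) := by
    rw [pow_succ]; nlinarith
  have hgood := half_le_pr (f := fun D => pr fun ξ => p (D, ξ)) (a := pr p / 2)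
    (fun _ => pr_le_one _) (by positivity) (by rw [mul_div_cancel₀ _ two_ne_zero, pr_prod])
  set q : Finset ι → (ι → Bool) → Prop := fun W D => ∃ E : Finset ι, E.card ≤ m ^ 2 ∧
        ∀ j ∉ E, j ∉ E₀ → D j = true → ∃ s : ι → ℤ, s j ≠ 0 ∧ (∀ h, |s h| ≤ 2 ^ t) ∧
          ∃ F : Finset ι, F.card ≤ m ^ 3 ∧ ∀ i ∉ F, i ∉ E₀ → D i = false →
            Box G (m ^ (K₀ + 1)) (κ * (s j * M i j + ∑ h ∈ W, s h * M i h)) with hq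
  obtain ⟨W, hW, hle⟩ := pr_pigeonhole (lt_of_lt_of_le (by positivity) hgood)
    (Finset.univ.filter fun W : Finset ι => W.card ≤ 2 * (C + 1)) q (by
      intro D hD
      obtain ⟨W, E, hW, hE, hrel⟩ := exists_relations
        (fun j i => if j ∉ E₀ ∧ D j then M i j else 0)
        (fun n => {y : ι → ℝ | ∃ F : Finset ι, F.card ≤ 2 ^ n * m ^ 2 ∧ ∀ i ∉ F, i ∉ E₀ →
          D i = false → Box G (2 ^ n * m ^ K₀) (κ * ((if n = 0 then b i else 0) + y i))}) (by
          rintro n x y ⟨F, hF, hx⟩ ⟨F', hF', hy⟩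
          refine ⟨F ∪ F', ?_, fun i hi hi0 hDi => ?_⟩
          · have := Finset.card_union_le F F'
            have : 2 ^ (n + 1) * m ^ 2 = 2 ^ n * m ^ 2 + 2 ^ n * m ^ 2 := by ring
            omega
          · simp only [Finset.mem_union, not_or] at hi
            have h1 := (hx i hi.1 hi0 hDi).sub (hy i hi.2 hi0 hDi)
            rw [← mul_sub, add_sub_add_left_eq_sub] at h1
            rw [if_neg (Nat.succ_ne_zero n), zero_add, pow_succ]
            exact h1.mono subset_rfl (le_of_eq (by ring)))
        t (by omega) (C + 1) (by
          rw [hmr]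
          refine hhalf.trans (mul_le_mul_of_nonneg_left (hD.trans (pr_mono ?_)) (by positivity))
          rintro ξ ⟨F, hF, hx⟩
          refine ⟨F, by simpa using hF, fun i hi hi0 hDi => ?_⟩
          have := hx i hi hi0 hDi
          simpa [Finset.sum_apply] using this)
      refine ⟨W.filter fun h => h ∉ E₀ ∧ D h, ?_, E, ?_, fun j hj hj0 hDj => ?_⟩
      · simp only [Finset.mem_filter, Finset.mem_univ, true_and]
        exact (Finset.card_filter_le _ _).trans hW
      · refine hE.trans ?_
        rw [← hm]
        nlinarith
      · obtain ⟨-, s, hsj, hs, F, hF, hbox⟩ := hrel j hj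
        refine ⟨s, hsj, hs, F, ?_, fun i hi hi0 hDi => ?_⟩
        · rw [← hm] at hF
          exact hF.trans (by rw [pow_succ m 2, mul_comm])
        · have h1 := hbox i hi hi0 hDi
          rw [if_neg (show t ≠ 0 by omega), zero_add, ← hm] at h1
          have e1 : (s j • (fun i => if j ∉ E₀ ∧ D j then M i j else 0) +
              ∑ h ∈ W, s h • fun i => if h ∉ E₀ ∧ D h then M i h else 0) i =
              s j * M i j + ∑ h ∈ W.filter fun h => h ∉ E₀ ∧ D h, s h * M i h := by
            rw [Finset.sum_filter]
            simp only [Pi.add_apply, Pi.smul_apply, Finset.sum_apply]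
            simp only [zsmul_eq_mul, mul_ite, mul_zero]
            rw [if_pos ⟨hj0, hDj⟩]
          rw [e1] at h1
          exact h1.mono subset_rfl (by rw [pow_succ m K₀, mul_comm]))
  refine ⟨W, by simpa using hW, ?_⟩
  refine one_le_pow_mul_trans (by positivity) hhalf (hgood.trans (hle.trans ?_))
  refine mul_le_mul_of_nonneg_right ?_ (pr_nonneg _)
  exact_mod_cast card_filter_card_le_pow (ι := ι) (2 * (C + 1)) hm2 hn

/-- If, with non-negligible probability, a random vector `D` has a small exceptional set, then
almost every index is, with comparable probability, non-exceptional and carries a prescribed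
sign. -/
lemma exists_cover_of_rel {ι : Type} [Fintype ι] [DecidableEq ι]
    (R : (ι → Bool) → Finset ι → Prop) (N : ℕ) (β : Bool) (hN : 0 < N)
    (hp : 2 < 4 ^ N * pr fun D => ∃ E : Finset ι, E.card ≤ N ∧ R D E) :
    ∃ J : Finset ι, J.card ≤ 16 * N ∧ ∀ i ∉ J, (pr fun D => ∃ E : Finset ι, E.card ≤ N ∧ R D E) ≤
      16 * pr fun D => ∃ E : Finset ι, E.card ≤ N ∧ R D E ∧ D i = β ∧ i ∉ E := by
  set p : (ι → Bool) → Prop := fun D => ∃ E : Finset ι, E.card ≤ N ∧ R D E with hpd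
  have hE : ∀ D, ∃ E : Finset ι, E.card ≤ N ∧ (p D → R D E) := fun D => by
    by_cases h : p D
    · obtain ⟨E, hE, hR⟩ := h
      exact ⟨E, hE, fun _ => hR⟩
    · exact ⟨∅, by simp, fun h' => absurd h' h⟩
  choose E hEN hER using hE
  obtain ⟨J, hJ, hJi⟩ := exists_cover (Ω' := Unit) (fun ω => p ω.1) (fun ω => E ω.1) N β hN
    (fun ω => hEN ω.1) (by rw [pr_fst]; exact hp)
  refine ⟨J, hJ, fun i hi => ?_⟩
  have h := hJi i hi
  rw [pr_fst (Ω' := Unit) p,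
    pr_fst (Ω' := Unit) fun D : ι → Bool => p D ∧ D i = β ∧ i ∉ E D] at h
  refine h.trans (mul_le_mul_of_nonneg_left (pr_mono ?_) (by norm_num))
  rintro D ⟨hD, hDi, hiE⟩
  exact ⟨E D, hEN D, hER D hD, hDi, hiE⟩

/-- All but few columns of `M` have almost all their entries, up to bounded denominators, in one
and the same box of bounded rank. -/
lemma exists_uniform_boxes (C e r₀ K₀ : ℕ) : ∃ r K t₀ : ℕ, ∀ t, t₀ ≤ t → ∀ (ι : Type)
    [Fintype ι] [DecidableEq ι], Fintype.card ι ≤ (2 ^ t) ^ e → ∀ (M : ι → ι → ℝ) (l : ι → ℝ)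
    (a : ℝ) (E : ι → Finset ι) (G : ι → Finset ℝ) (d : ι → ℕ), (∀ i j, M i j = M j i) →
    1 ≤ ((2 : ℝ) ^ t) ^ C * pr (fun x => quad M l x = a) → RowBoxes M E G d (2 ^ t) r₀ K₀ →
    ∃ (J : Finset ι) (J' : ι → Finset ι) (G' : Finset ℝ), J.card ≤ (2 ^ t) ^ 4 ∧ G'.card ≤ r ∧
      ∀ j ∉ J, (J' j).card ≤ (2 ^ t) ^ 4 ∧ ∀ i ∉ J' j, ∃ q : ℤ, q ≠ 0 ∧
        |q| ≤ ((2 ^ t) ^ K : ℕ) ∧ Box G' ((2 ^ t) ^ K) (q * M i j) := by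
  obtain ⟨r₁, K₁, C₁, t₁, h₁⟩ := exists_frozen_boxes C e r₀ K₀
  obtain ⟨r₂, C₂, t₂, h₂⟩ := exists_column_relations C₁ K₁
  set C₃ := C₂ + (e + 1) * r₂ with hC₃
  obtain ⟨t₃, h₃⟩ := exists_mul_le_two_pow (C₃ + 4 + r₁ + r₂ + r₂ * r₀ + 40)
  refine ⟨r₁ + r₂ * r₀, K₀ * r₂ + K₀ + K₁ + 3, t₁ + t₂ + t₃ + 1,
    fun t ht ι _ _ hn M l a E G d hM hC hR => ?_⟩
  obtain ⟨E₀, κ, b, G₁, hE₀, hκ0, hκ, hG₁, hp⟩ := h₁ t (by omega) ι hn M l a E G d hM hC hR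
  obtain ⟨W, hW, hq⟩ := h₂ t (by omega) ι e hn M E₀ κ b G₁ hp
  have h3 := h₃ t (by omega)
  clear hp
  set m : ℕ := 2 ^ t with hm
  have hm2 : 2 ≤ m := by
    calc 2 = 2 ^ 1 := rfl
      _ ≤ m := Nat.pow_le_pow_right two_pos (by omega)
  have hmr : ((2 : ℝ) ^ t) = (m : ℝ) := by rw [hm]; push_cast; rfl
  have hmz : ((2 : ℤ) ^ t) = (m : ℤ) := by rw [hm]; push_cast; rfl
  have ht1 : 1 ≤ t := by omega
  have hbig : C₃ + 4 + r₁ + r₂ + r₂ * r₀ + 40 ≤ m := le_trans (Nat.le_mul_of_pos_right _ ht1) h3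
  have hexp : ∀ c, c ≤ C₃ + 4 + r₁ + r₂ + r₂ * r₀ + 40 → t * c ≤ 2 ^ t := fun c hc =>
    le_trans (by rw [mul_comm]; exact Nat.mul_le_mul_right _ hc) h3
  have hm16 : (16 : ℝ) ≤ m := by exact_mod_cast (show 16 ≤ m by omega)
  have hr2m3 : r₁ * m ^ 2 + m ^ 2 ≤ m ^ 3 := by
    calc r₁ * m ^ 2 + m ^ 2 = (r₁ + 1) * m ^ 2 := by ring
      _ ≤ m * m ^ 2 := Nat.mul_le_mul_right _ (by omega)
      _ = m ^ 3 := by ring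
  rw [hmr, ← hC₃] at hq
  set Q : (ι → Bool) → ι → Prop := fun D j => ∃ s : ι → ℤ, s j ≠ 0 ∧ (∀ h, |s h| ≤ 2 ^ t) ∧
    ∃ F : Finset ι, F.card ≤ m ^ 3 ∧ ∀ i ∉ F, i ∉ E₀ → D i = false →
      Box G₁ (m ^ (K₁ + 1)) (κ * (s j * M i j + ∑ h ∈ W, s h * M i h)) with hQ
  have hq1 : 1 ≤ (m : ℝ) ^ C₃ * pr fun D : ι → Bool => ∃ F : Finset ι, F.card ≤ m ^ 3 ∧
      ∀ j ∉ F, D j = true → Q D j := by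
    refine hq.trans (mul_le_mul_of_nonneg_left (pr_mono ?_) (by positivity))
    rintro D ⟨F, hF, hj⟩
    refine ⟨F ∪ E₀, (Finset.card_union_le _ _).trans (by omega), fun j hj' => ?_⟩
    simp only [Finset.mem_union, not_or] at hj'
    exact hj j hj'.1 hj'.2
  obtain ⟨J, hJ, hJj⟩ := exists_cover_of_rel
    (fun (D : ι → Bool) F => ∀ j ∉ F, D j = true → Q D j) (m ^ 3) true (by positivity)
    (two_lt_four_pow_mul ht1 (hexp C₃ (by omega)) (Nat.le_self_pow (by norm_num) _)
      (by rw [hmr]; exact hq1))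
  have hcol : ∀ j, ∃ J₂ : Finset ι, j ∉ J → J₂.card ≤ 16 * (2 * m ^ 3) ∧ ∀ i ∉ J₂,
      ∃ s : ι → ℤ, s j ≠ 0 ∧ (∀ h, |s h| ≤ 2 ^ t) ∧
        Box G₁ (m ^ (K₁ + 1)) (κ * (s j * M i j + ∑ h ∈ W, s h * M i h)) := by
    intro j
    by_cases hj : j ∈ J
    · exact ⟨∅, fun h => absurd hj h⟩
    set R : (ι → Bool) → Finset ι → Prop := fun D F => ∃ s : ι → ℤ, s j ≠ 0 ∧
      (∀ h, |s h| ≤ 2 ^ t) ∧ ∀ i ∉ F, D i = false →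
        Box G₁ (m ^ (K₁ + 1)) (κ * (s j * M i j + ∑ h ∈ W, s h * M i h)) with hRd
    have hq2 : 1 ≤ (m : ℝ) ^ (C₃ + 1) * pr fun D : ι → Bool => ∃ F : Finset ι,
        F.card ≤ 2 * m ^ 3 ∧ R D F := by
      refine one_le_pow_mul_trans (by positivity) hq1 ((hJj j hj).trans ?_)
      rw [pow_one]
      refine mul_le_mul hm16 (pr_mono ?_) (pr_nonneg _) (by positivity)
      rintro D ⟨F, -, hFQ, hDj, hjF⟩
      obtain ⟨s, hsj, hs, F', hF', hb⟩ := hFQ j hjF hDj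
      refine ⟨F' ∪ E₀, (Finset.card_union_le _ _).trans (by omega), s, hsj, hs, fun i hi => ?_⟩
      simp only [Finset.mem_union, not_or] at hi
      exact hb i hi.1 hi.2
    obtain ⟨J₂, hJ₂, hJi⟩ := exists_cover_of_rel R (2 * m ^ 3) false (by positivity)
      (two_lt_four_pow_mul ht1 (hexp (C₃ + 1) (by omega))
        ((Nat.le_self_pow (n := 3) (by norm_num) _).trans (Nat.le_mul_of_pos_left _ two_pos))
        (by rw [hmr]; exact hq2))
    refine ⟨J₂, fun _ => ⟨hJ₂, fun i hi => ?_⟩⟩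
    have hpos : 0 < pr fun D : ι → Bool => ∃ F : Finset ι, F.card ≤ 2 * m ^ 3 ∧ R D F ∧
        D i = false ∧ i ∉ F := by
      have := pos_of_one_le_pow_mul (by positivity) hq2
      linarith [hJi i hi]
    obtain ⟨D, F, -, ⟨s, hsj, hs, hb⟩, hDi, hiF⟩ := exists_of_pr_pos hpos
    exact ⟨s, hsj, hs, hb i hiF hDi⟩
  choose J₂ hJ₂ using hcol
  have hm4 : 40 * m ^ 3 ≤ m ^ 4 := by
    rw [pow_succ m 3, mul_comm]
    exact Nat.mul_le_mul_left _ (by omega)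
  have hEW : (W.biUnion E).card ≤ m ^ 3 := by
    refine (Finset.card_biUnion_le_card_mul _ _ (m ^ 2) fun h _ => (hR h).1).trans ?_
    calc W.card * m ^ 2 ≤ m * m ^ 2 := Nat.mul_le_mul_right _ (by omega)
      _ = m ^ 3 := by ring
  refine ⟨J, fun j => J₂ j ∪ W.biUnion E, G₁ ∪ W.biUnion G, by omega, ?_, fun j hj => ?_⟩
  · refine (Finset.card_union_le _ _).trans (Nat.add_le_add hG₁ ?_)
    exact (Finset.card_biUnion_le_card_mul _ _ r₀ fun h _ => (hR h).2.1).trans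
      (Nat.mul_le_mul_right _ hW)
  obtain ⟨hJ₂c, hJ₂i⟩ := hJ₂ j hj
  refine ⟨(Finset.card_union_le _ _).trans (by omega), fun i hi => ?_⟩
  simp only [Finset.mem_union, Finset.mem_biUnion, not_or, not_exists, not_and] at hi
  obtain ⟨s, hsj, hs, hb⟩ := hJ₂i i hi.1
  have hone : ∀ a, 1 ≤ m ^ a := fun a => Nat.one_le_pow _ _ (by omega)
  have hsm : ∀ h, |s h| ≤ (m : ℤ) := fun h => by rw [← hmz]; exact hs h
  set P : ℕ := ∏ h ∈ W, d h with hP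
  have hP0 : 0 < P := Finset.prod_pos fun h _ => (hR h).2.2.1
  have hPm : P ≤ m ^ (K₀ * r₂) := by
    calc P ≤ ∏ _h ∈ W, m ^ K₀ := Finset.prod_le_prod' fun h _ => (hR h).2.2.2.1
      _ = m ^ (K₀ * W.card) := by rw [Finset.prod_const, ← pow_mul]
      _ ≤ _ := Nat.pow_le_pow_right (by omega) (Nat.mul_le_mul_left _ hW)
  have hbW : ∀ h ∈ W, Box (G₁ ∪ W.biUnion G) (κ * (m * m ^ (K₀ * r₂ + K₀)))
      (κ * ((s h : ℝ) * (P * M i h))) := by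
    intro h hh
    have hBox := (hR h).2.2.2.2 i (hi.2 h hh)
    rw [hM h i] at hBox
    have := Box.prod_mul (fun h _ => (hR h).2.2.2.1) (hone K₀) hh hBox
    rw [← hP] at this
    refine Box.nmul (Box.zmul (this.mono ?_ ?_) (hsm h)) le_rfl
    · exact (Finset.subset_biUnion_of_mem G hh).trans Finset.subset_union_right
    · rw [pow_add, ← pow_mul]
      exact Nat.mul_le_mul_right _ (Nat.pow_le_pow_right (by omega) (Nat.mul_le_mul_left _ hW))
  have hdiff := ((hb.mono Finset.subset_union_left le_rfl).nmul (le_refl P)).sub (Box.sum hbW)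
  refine ⟨P * κ * s j, ?_, ?_, ?_⟩
  · exact mul_ne_zero (mul_ne_zero (by exact_mod_cast hP0.ne') (by exact_mod_cast hκ0.ne')) hsj
  · rw [abs_mul, ← Nat.cast_mul, Nat.abs_cast]
    have h1 : P * κ * m ≤ m ^ (K₀ * r₂ + K₀ + K₁ + 3) := by
      calc P * κ * m ≤ m ^ (K₀ * r₂) * m ^ K₁ * m :=
            Nat.mul_le_mul_right _ (Nat.mul_le_mul hPm hκ)
        _ = m ^ (K₀ * r₂ + K₁ + 1) := by ring
        _ ≤ _ := Nat.pow_le_pow_right (by omega) (by omega)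
    calc ((P * κ : ℕ) : ℤ) * |s j| ≤ (P * κ : ℕ) * m :=
          mul_le_mul_of_nonneg_left (hsm j) (by positivity)
      _ ≤ _ := by exact_mod_cast h1
  · have heq : (P : ℝ) * (κ * (s j * M i j + ∑ h ∈ W, s h * M i h)) -
        ∑ h ∈ W, κ * ((s h : ℝ) * (P * M i h)) = ((P * κ * s j : ℤ) : ℝ) * M i j := by
      have : ∑ h ∈ W, κ * ((s h : ℝ) * (P * M i h)) =
          P * (κ * ∑ h ∈ W, (s h : ℝ) * M i h) := by
        rw [Finset.mul_sum, Finset.mul_sum]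
        exact Finset.sum_congr rfl fun h _ => by ring
      rw [this]
      push_cast
      ring
    rw [heq] at hdiff
    refine hdiff.mono subset_rfl ?_
    have h1 : P * m ^ (K₁ + 1) ≤ m ^ (K₀ * r₂ + K₀ + K₁ + 2) := by
      calc P * m ^ (K₁ + 1) ≤ m ^ (K₀ * r₂) * m ^ (K₁ + 1) := Nat.mul_le_mul_right _ hPm
        _ = m ^ (K₀ * r₂ + K₁ + 1) := by ring
        _ ≤ _ := Nat.pow_le_pow_right (by omega) (by omega)
    have h2 : W.card * (κ * (m * m ^ (K₀ * r₂ + K₀))) ≤ m ^ (K₀ * r₂ + K₀ + K₁ + 2) := by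
      calc W.card * (κ * (m * m ^ (K₀ * r₂ + K₀)))
          ≤ m * (m ^ K₁ * (m * m ^ (K₀ * r₂ + K₀))) :=
            Nat.mul_le_mul (by omega) (Nat.mul_le_mul_right _ hκ)
        _ = _ := by ring
    calc _ ≤ 2 * m ^ (K₀ * r₂ + K₀ + K₁ + 2) := by omega
      _ ≤ m * m ^ (K₀ * r₂ + K₀ + K₁ + 2) := Nat.mul_le_mul_right _ hm2
      _ = _ := by ring

/-- The inverse theorem at the scale `2 ^ t`, for a concentrated quadratic form over any index
type. -/
lemma exists_quadratic_structure (C e : ℕ) : ∃ r K t₀ : ℕ, ∀ t, t₀ ≤ t → ∀ (ι : Type) [Fintype ι]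
    [DecidableEq ι], Fintype.card ι ≤ (2 ^ t) ^ e → ∀ (A : ι → ι → ℝ) (a : ℝ),
    (∀ i j, A i j = A j i) → 1 ≤ ((2 : ℝ) ^ t) ^ C * pr (fun x => quad A 0 x = a) →
    ∃ (W I : Finset ι) (k : ℕ) (c : ι → ι → ℤ) (a' : ι → ι → ℝ) (G : Finset ℝ),
      Disjoint I W ∧ W.card ≤ r ∧ Fintype.card ι ≤ I.card + (17 + r) * (2 ^ t) ^ 4 ∧ 0 < k ∧
      k ≤ (2 ^ t) ^ K ∧ (∀ i h, |c i h| ≤ ((2 ^ t) ^ K : ℕ)) ∧ G.card ≤ r ∧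
      ∀ i ∈ I, (∀ j ∈ I, (k : ℝ) ^ 2 * A i j =
          a' i j + k * ∑ h ∈ W, c i h * A h j + k * ∑ h ∈ W, c j h * A h i) ∧
        (I.filter fun j => ¬ ∃ q : ℤ, q ≠ 0 ∧ |q| ≤ ((2 ^ t) ^ K : ℕ) ∧
          Box G ((2 ^ t) ^ K) (q * a' i j)).card ≤ (2 ^ t) ^ 4 := by
  obtain ⟨r₁, K₁, C₁, t₁, h₁⟩ := exists_reduction C e
  obtain ⟨r₂, K₂, t₂, h₂⟩ := exists_uniform_boxes C₁ e r₁ K₁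
  obtain ⟨t₃, h₃⟩ := exists_mul_le_two_pow (r₁ * r₁ + 2)
  refine ⟨r₁ + r₂ + r₁ * r₁, K₂ + 2 * K₁ + 2, t₁ + t₂ + t₃ + 1, fun t ht ι _ _ hn A a hA hC => ?_⟩
  obtain ⟨W, S, k, c, M, l, b, E, G, d, hWS, hW, hS, hk0, hk, hc, hMr, hM, hp, hR⟩ :=
    h₁ t (by omega) ι hn A a hA hC
  obtain ⟨J, J', G', hJ, hG', hJ'⟩ := h₂ t (by omega) ι hn M l b E G d hM hp hR
  have h3 := h₃ t (by omega)
  set m : ℕ := 2 ^ t with hm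
  have hrm : r₁ * r₁ + 2 ≤ m := le_trans (Nat.le_mul_of_pos_right _ (by omega)) h3
  have hone : ∀ a, 1 ≤ m ^ a := fun a => Nat.one_le_pow _ _ (by omega)
  refine ⟨W, (S ∪ J)ᶜ, k, c, fun i j => M i j - ∑ h ∈ W, ∑ h' ∈ W, c i h * c j h' * A h h',
    G' ∪ (W ×ˢ W).image fun h => A h.1 h.2, ?_, by omega, ?_, hk0,
    hk.trans (Nat.pow_le_pow_right (by omega) (by omega)), fun i h => (hc i h).trans ?_, ?_,
    fun i hi => ⟨fun j hj => ?_, ?_⟩⟩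
  · refine Finset.disjoint_left.mpr fun i hi hiW => ?_
    exact Finset.mem_compl.mp hi (Finset.mem_union_left _ (hWS hiW))
  · have h1 := Finset.card_add_card_compl (S ∪ J)
    have h2 := Finset.card_union_le S J
    have h4 : m ^ 2 ≤ m ^ 4 := Nat.pow_le_pow_right (by omega) (by norm_num)
    have h5 : r₁ ≤ (r₁ + r₂ + r₁ * r₁) * m ^ 4 :=
      le_trans (by omega) (Nat.le_mul_of_pos_right _ (hone 4))
    rw [add_mul]
    omega
  · exact_mod_cast Nat.pow_le_pow_right (show 0 < m by omega) (show K₁ ≤ K₂ + 2 * K₁ + 2 by omega)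
  · refine (Finset.card_union_le _ _).trans ?_
    have := (Finset.card_image_le (s := W ×ˢ W) (f := fun h => A h.1 h.2)).trans
      ((Finset.card_product W W).le.trans (Nat.mul_le_mul hW hW))
    omega
  · simp only [Finset.mem_compl, Finset.mem_union, not_or] at hi hj
    beta_reduce
    rw [hMr i hi.1 j hj.1]
    unfold reduced
    ring
  · simp only [Finset.mem_compl, Finset.mem_union, not_or] at hi
    refine (Finset.card_le_card fun j hj => ?_).trans (hJ' i hi.2).1
    rw [Finset.mem_filter] at hj
    by_contra hjJ
    refine hj.2 ?_
    obtain ⟨q, hq0, hq, hb⟩ := (hJ' i hi.2).2 j hjJ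
    refine ⟨q, hq0, hq.trans ?_, ?_⟩
    · exact_mod_cast Nat.pow_le_pow_right (show 0 < m by omega)
        (show K₂ ≤ K₂ + 2 * K₁ + 2 by omega)
    rw [hM j i] at hb
    have hbW : ∀ h ∈ W, ∀ h' ∈ W, Box (G' ∪ (W ×ˢ W).image fun h => A h.1 h.2)
        (m ^ K₂ * (m ^ K₁ * (m ^ K₁ * 1)))
        ((q : ℝ) * ((c i h : ℝ) * ((c j h' : ℝ) * A h h'))) := by
      intro h hh h' hh'
      refine Box.zmul (Box.zmul (Box.zmul (Box.of_mem ?_) (hc j h')) (hc i h)) hq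
      exact Finset.mem_union_right _ (Finset.mem_image.mpr
        ⟨(h, h'), Finset.mem_product.mpr ⟨hh, hh'⟩, rfl⟩)
    have hsum := (hb.mono Finset.subset_union_left le_rfl).sub
      (Box.sum fun h hh => Box.sum fun h' hh' => hbW h hh h' hh')
    have heq : (q : ℝ) * M i j - ∑ h ∈ W, ∑ h' ∈ W, (q : ℝ) * ((c i h : ℝ) *
        ((c j h' : ℝ) * A h h')) =
        q * (M i j - ∑ h ∈ W, ∑ h' ∈ W, c i h * c j h' * A h h') := by
      rw [mul_sub, Finset.mul_sum]
      congr 1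
      refine Finset.sum_congr rfl fun h _ => ?_
      rw [Finset.mul_sum]
      exact Finset.sum_congr rfl fun h' _ => by ring
    rw [heq] at hsum
    refine hsum.mono subset_rfl ?_
    have h1 : m ^ K₂ ≤ m ^ (K₂ + 2 * K₁) := Nat.pow_le_pow_right (by omega) (by omega)
    calc m ^ K₂ + W.card * (W.card * (m ^ K₂ * (m ^ K₁ * (m ^ K₁ * 1))))
        = m ^ K₂ + W.card * W.card * m ^ (K₂ + 2 * K₁) := by ring
      _ ≤ m ^ (K₂ + 2 * K₁) + r₁ * r₁ * m ^ (K₂ + 2 * K₁) :=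
          Nat.add_le_add h1 (Nat.mul_le_mul_right _ (Nat.mul_le_mul hW hW))
      _ = (1 + r₁ * r₁) * m ^ (K₂ + 2 * K₁) := by ring
      _ ≤ m ^ 2 * m ^ (K₂ + 2 * K₁) := by
          refine Nat.mul_le_mul_right _ ?_
          nlinarith
      _ = _ := by ring

/-- A large `n` is bounded by a fixed power of a power of two which is at most `n ^ (ε / 4)`. -/
lemma exists_scale {ε : ℝ} (hε : 0 < ε) (t₀ : ℕ) : ∃ n₀ : ℕ, 1 ≤ n₀ ∧ ∀ n : ℕ, n₀ ≤ n →
    ∃ t, t₀ ≤ t ∧ ((2 : ℝ) ^ t) ^ 4 ≤ (n : ℝ) ^ ε ∧ n ≤ (2 ^ t) ^ ⌈8 / ε⌉₊ := by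
  have hlim : Filter.Tendsto (fun n : ℕ => (n : ℝ) ^ (ε / 4)) Filter.atTop Filter.atTop :=
    (tendsto_rpow_atTop (by positivity)).comp tendsto_natCast_atTop_atTop
  obtain ⟨n₀, hn₀⟩ := Filter.eventually_atTop.mp (hlim.eventually_ge_atTop ((2 : ℝ) ^ (t₀ + 2)))
  refine ⟨n₀ + 1, by omega, fun n hn => ?_⟩
  have hx := hn₀ n (by omega)
  have hn1 : (1 : ℝ) ≤ n := by exact_mod_cast (show 1 ≤ n by omega)
  obtain ⟨t, ht1, ht2⟩ := exists_nat_pow_near (Real.one_le_rpow (z := ε / 4) hn1 (by positivity))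
    (one_lt_two : (1 : ℝ) < 2)
  have ht : t₀ + 2 < t + 1 := (pow_lt_pow_iff_right₀ one_lt_two).mp (hx.trans_lt ht2)
  refine ⟨t, by omega, ?_, ?_⟩
  · calc ((2 : ℝ) ^ t) ^ 4 ≤ ((n : ℝ) ^ (ε / 4)) ^ 4 := pow_le_pow_left₀ (by positivity) ht1 _
      _ = (n : ℝ) ^ ε := by
        rw [← Real.rpow_natCast, ← Real.rpow_mul (by positivity)]
        congr 1
        push_cast
        ring
  · have h1 : (1 : ℝ) ≤ (2 : ℝ) ^ t := one_le_pow₀ one_le_two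
    have h2 : (n : ℝ) ≤ ((2 : ℝ) ^ t) ^ ⌈8 / ε⌉₊ := by
      calc (n : ℝ) = ((n : ℝ) ^ (ε / 4)) ^ (4 / ε) := by
            rw [← Real.rpow_mul (by positivity), show ε / 4 * (4 / ε) = 1 by field_simp,
              Real.rpow_one]
        _ ≤ (((2 : ℝ) ^ t) ^ 2) ^ (4 / ε) := by
            refine Real.rpow_le_rpow (by positivity) (ht2.le.trans ?_) (by positivity)
            rw [← pow_mul]
            exact pow_le_pow_right₀ one_le_two (by omega)
        _ = ((2 : ℝ) ^ t) ^ (8 / ε) := by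
            rw [← Real.rpow_natCast _ 2, ← Real.rpow_mul (by positivity)]
            congr 1
            push_cast
            ring
        _ ≤ ((2 : ℝ) ^ t) ^ ((⌈8 / ε⌉₊ : ℕ) : ℝ) :=
            Real.rpow_le_rpow_of_exponent_le h1 (Nat.le_ceil _)
        _ = _ := Real.rpow_natCast _ _
    exact_mod_cast h2

/-- The elements of a box, written with an enumeration of the generators. -/
lemma Box.exists_fin {G : Finset ℝ} {L : ℕ} {v : ℝ} (h : Box G L v) :
    ∃ p : Fin G.card → ℤ, (∀ h, |p h| ≤ L) ∧ v = ∑ h, (p h : ℝ) * (G.equivFin.symm h : ℝ) := by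
  obtain ⟨p, hp, hv⟩ := h
  refine ⟨fun h => p (G.equivFin.symm h), fun h => hp _, ?_⟩
  rw [hv, ← Finset.sum_coe_sort G]
  exact (G.equivFin.symm.sum_comp fun g : G => (p g : ℝ) * (g : ℝ)).symm

/-- A lower bound for `rhoQ` is attained, up to a factor of two, at a single value. -/
lemma exists_rpow_le_pr {n : ℕ} {A : Matrix (Fin n) (Fin n) ℝ} {C : ℝ} (hn : (1 : ℝ) ≤ n)
    (h : (n : ℝ) ^ (-C) ≤ rhoQ n A) :
    ∃ a, (n : ℝ) ^ (-C) ≤ 2 * pr fun x => quad A 0 x = a := by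
  have hpos : (0 : ℝ) < (n : ℝ) ^ (-C) := Real.rpow_pos_of_pos (by linarith) _
  obtain ⟨a, ha⟩ := exists_lt_of_lt_ciSup ((half_lt_self hpos).trans_le h)
  refine ⟨a, ?_⟩
  have hpr : (pr fun x : Fin n → Bool => quad A 0 x = a) =
      ((Finset.univ.filter fun x : Fin n → Bool =>
        ∑ i, ∑ j, A i j * signv (x i) * signv (x j) = a).card : ℝ) / 2 ^ n := by
    have hs : ∀ b : Bool, signv b = (sgz b : ℝ) := by
      rintro (_ | _) <;> simp [signv, sgz]
    simp [pr, avg, ind, quad, hs]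
  rw [hpr]
  linarith

/-- Inverse Littlewood-Offord theorem for quadratic forms, common structure. -/
theorem inverse_LO_quadratic_commonGAP (ε C : ℝ) (hε0 : 0 < ε) (hε1 : ε < 1) (hC : 0 < C) :
    ∃ r₀ : ℕ, ∃ c : ℝ, 0 < c ∧ ∃ n₀ : ℕ, ∀ n : ℕ, n₀ ≤ n →
      ∀ A : Matrix (Fin n) (Fin n) ℝ, A.IsSymm → (n : ℝ) ^ (-C) ≤ rhoQ n A →
        ∃ (I₀ I : Finset (Fin n)) (k : ℤ) (kk : Fin n → Fin n → ℤ)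
          (a' : Fin n → Fin n → ℝ) (s : ℕ) (g : Fin s → ℝ),
          Disjoint I I₀ ∧ I₀.card ≤ r₀ ∧
          (n : ℝ) - c * (n : ℝ) ^ ε ≤ (I.card : ℝ) ∧
          k ≠ 0 ∧ |(k : ℝ)| ≤ (n : ℝ) ^ c ∧
          (∀ i ∈ I, ∀ i₀ ∈ I₀, |(kk i i₀ : ℝ)| ≤ (n : ℝ) ^ c) ∧
          s ≤ r₀ ∧
          ∀ i ∈ I,
            (∀ j ∈ I, A i j = a' i j / ((k : ℝ) ^ 2)
                - (∑ i₀ ∈ I₀, (kk i i₀ : ℝ) * A i₀ j) / (k : ℝ)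
                - (∑ i₀ ∈ I₀, (kk j i₀ : ℝ) * A i₀ i) / (k : ℝ)) ∧
            ((I.filter fun j => ¬ ∃ p q : Fin s → ℤ,
                (∀ h, q h ≠ 0 ∧ |(p h : ℝ)| ≤ (n : ℝ) ^ c ∧ |(q h : ℝ)| ≤ (n : ℝ) ^ c) ∧
                a' i j = ∑ h, ((p h : ℝ) / (q h : ℝ)) * g h).card : ℝ) ≤ c * (n : ℝ) ^ ε := by
  set e : ℕ := ⌈8 / ε⌉₊ with he
  set C₀ : ℕ := e * ⌈C⌉₊ + 1 with hC₀
  obtain ⟨r, K, t₀, h₀⟩ := exists_quadratic_structure C₀ e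
  obtain ⟨n₀, hn₀, hscale⟩ := exists_scale hε0 (t₀ + 1)
  refine ⟨r, K + 17 + r, by positivity, n₀, fun n hn A hA hρ => ?_⟩
  obtain ⟨t, ht, htε, hnt⟩ := hscale n hn
  have hn1 : (1 : ℝ) ≤ n := by exact_mod_cast hn₀.trans hn
  obtain ⟨a, ha⟩ := exists_rpow_le_pr hn1 hρ
  have hconc : 1 ≤ ((2 : ℝ) ^ t) ^ C₀ * pr fun x => quad A 0 x = a := by
    have h2 : (2 : ℝ) ≤ 2 ^ t := le_self_pow₀ one_le_two (by omega)
    have hnC : (n : ℝ) ^ C ≤ ((2 : ℝ) ^ t) ^ (e * ⌈C⌉₊) := by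
      calc (n : ℝ) ^ C ≤ (n : ℝ) ^ ((⌈C⌉₊ : ℕ) : ℝ) :=
            Real.rpow_le_rpow_of_exponent_le hn1 (Nat.le_ceil _)
        _ = (n : ℝ) ^ ⌈C⌉₊ := Real.rpow_natCast _ _
        _ ≤ (((2 : ℝ) ^ t) ^ e) ^ ⌈C⌉₊ := by
            refine pow_le_pow_left₀ (by positivity) ?_ _
            exact_mod_cast hnt
        _ = _ := (pow_mul _ _ _).symm
    calc (1 : ℝ) = (n : ℝ) ^ C * (n : ℝ) ^ (-C) := by
          rw [← Real.rpow_add (by positivity), add_neg_cancel, Real.rpow_zero]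
      _ ≤ ((2 : ℝ) ^ t) ^ (e * ⌈C⌉₊) * (2 * pr fun x => quad A 0 x = a) :=
          mul_le_mul hnC ha (by positivity) (by positivity)
      _ ≤ ((2 : ℝ) ^ t) ^ (e * ⌈C⌉₊) * (2 ^ t * pr fun x => quad A 0 x = a) := by
          gcongr
          exact pr_nonneg _
      _ = _ := by rw [hC₀, pow_succ, mul_assoc]
  obtain ⟨W, I, k, c, a', G, hIW, hW, hI, hk0, hk, hc, hG, hrow⟩ :=
    h₀ t (by omega) (Fin n) (by rwa [Fintype.card_fin]) A a (fun i j => hA.apply j i) hconc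
  have hheight : (((2 ^ t) ^ K : ℕ) : ℝ) ≤ (n : ℝ) ^ ((K : ℝ) + 17 + r) := by
    have hmn : ((2 : ℝ) ^ t) ≤ n := by
      calc ((2 : ℝ) ^ t) ≤ ((2 : ℝ) ^ t) ^ 4 :=
            le_self_pow₀ (one_le_pow₀ one_le_two) (by norm_num)
        _ ≤ (n : ℝ) ^ ε := htε
        _ ≤ (n : ℝ) ^ (1 : ℝ) := Real.rpow_le_rpow_of_exponent_le hn1 hε1.le
        _ = n := Real.rpow_one _
    calc (((2 ^ t) ^ K : ℕ) : ℝ) = ((2 : ℝ) ^ t) ^ K := by push_cast; rfl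
      _ ≤ (n : ℝ) ^ K := pow_le_pow_left₀ (by positivity) hmn _
      _ = (n : ℝ) ^ (K : ℝ) := (Real.rpow_natCast _ _).symm
      _ ≤ _ := Real.rpow_le_rpow_of_exponent_le hn1
          (by linarith [Nat.cast_nonneg (α := ℝ) r])
  have hint : ∀ z : ℤ, |z| ≤ ((2 ^ t) ^ K : ℕ) → |(z : ℝ)| ≤ (n : ℝ) ^ ((K : ℝ) + 17 + r) :=
    fun z hz => le_trans (by exact_mod_cast hz) hheight
  have hnε : (0 : ℝ) ≤ (n : ℝ) ^ ε := by positivity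
  have hk0r : (k : ℝ) ≠ 0 := by exact_mod_cast hk0.ne'
  refine ⟨W, I, k, fun i h => -c i h, a', G.card, fun h => G.equivFin.symm h, hIW, hW, ?_,
    by exact_mod_cast hk0.ne', hint k (by rw [Nat.abs_cast]; exact_mod_cast hk),
    fun i _ h _ => hint _ (by rw [abs_neg]; exact hc i h), hG, fun i hi => ⟨fun j hj => ?_, ?_⟩⟩
  · rw [Fintype.card_fin] at hI
    have hI' : (n : ℝ) ≤ I.card + (17 + r) * ((2 : ℝ) ^ t) ^ 4 := by exact_mod_cast hI
    have h1 : (17 + (r : ℝ)) * ((2 : ℝ) ^ t) ^ 4 ≤ (17 + r) * (n : ℝ) ^ ε := by gcongr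
    have h2 : 0 ≤ (K : ℝ) * (n : ℝ) ^ ε := by positivity
    linarith
  · have h := (hrow i hi).1 j hj
    simp only [Int.cast_neg, neg_mul, Finset.sum_neg_distrib, Int.cast_natCast]
    field_simp
    linear_combination h
  · have hcard : (1 : ℝ) * (n : ℝ) ^ ε ≤ (K + 17 + r) * (n : ℝ) ^ ε := by
      refine mul_le_mul_of_nonneg_right ?_ hnε
      linarith [Nat.cast_nonneg (α := ℝ) r, Nat.cast_nonneg (α := ℝ) K]
    refine le_trans ?_ ((htε.trans_eq (one_mul _).symm).trans hcard)
    refine le_trans ?_ (show ((((2 ^ t) ^ 4 : ℕ)) : ℝ) ≤ ((2 : ℝ) ^ t) ^ 4 by push_cast; rfl)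
    refine Nat.cast_le.mpr (le_trans (Finset.card_le_card fun j hj => ?_) (hrow i hi).2)
    rw [Finset.mem_filter] at hj ⊢
    refine ⟨hj.1, fun ⟨q, hq0, hq, hb⟩ => hj.2 ?_⟩
    obtain ⟨p, hp, hv⟩ := hb.exists_fin
    refine ⟨p, fun _ => q, fun h => ⟨hq0, hint _ (hp h), hint _ hq⟩, ?_⟩
    have hq0r : (q : ℝ) ≠ 0 := by exact_mod_cast hq0
    rw [eq_comm, ← mul_right_inj' hq0r, hv, Finset.mul_sum]
    exact Finset.sum_congr rfl fun h _ => by field_simp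

end
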